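/- arXiv:1405.3024 — 8 statements merged into one kernel-verified Lean document; each statement's English description precedes it below -/
import Mathlib

section
/- Let p ∈ ℂ with ‖p‖ > 1 and define G : ℂ → ℝ by G(x) = 2 log‖x‖ − log‖x − p‖ − log‖x − p*‖, where p* = p/‖p‖². Then for every x ∈ ℂ with ‖x‖ = 1, the real Fréchet derivative of G at x evaluated in the direction x equals 1 (i.e., the outward normal derivative of G on the unit circle is identically 1). -/
/-- Away from `q`, the function `y ↦ log ‖y - q‖` has gradient `(y - q) / ‖y - q‖ ^ 2`. -/
theorem hasFDerivAt_log_norm_sub {F : Type*} [NormedAddCommGroup F] [InnerProductSpace ℝ F]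
    {q x : F} (hxq : x ≠ q) :
    HasFDerivAt (fun y : F => Real.log ‖y - q‖) ((‖x - q‖ ^ 2)⁻¹ • innerSL ℝ (x - q)) x := by
  have hne : ‖x - q‖ ^ 2 ≠ 0 := pow_ne_zero 2 (norm_ne_zero_iff.mpr (sub_ne_zero.mpr hxq))
  have h := ((((hasFDerivAt_id x).sub_const q).norm_sq).log hne).const_mul (1 / 2 : ℝ)
  have hfun : (fun y : F => Real.log ‖y - q‖) =
      fun y => 1 / 2 * Real.log (‖id y - q‖ ^ 2) := by
    ext y
    simp [Real.log_pow]
  rw [hfun]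
  refine h.congr_fderiv ?_
  ext v
  simp
  ring

/-- The radial derivatives of `log ‖· - p‖` and `log ‖· - p*‖` at a point of the unit sphere
add up to `1`, where `p* = p / ‖p‖ ^ 2` is the inversion of `p`. -/
theorem inner_div_norm_sq_add_inner_div_norm_sq_inversion {F : Type*} [NormedAddCommGroup F]
    [InnerProductSpace ℝ F] {p x : F} (hp : p ≠ 0) (hx : ‖x‖ = 1) (hxp : x ≠ p) :
    inner ℝ (x - p) x / ‖x - p‖ ^ 2 +
      inner ℝ (x - (‖p‖ ^ 2)⁻¹ • p) x / ‖x - (‖p‖ ^ 2)⁻¹ • p‖ ^ 2 = 1 := by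
  have hs : ‖p‖ ^ 2 ≠ 0 := pow_ne_zero 2 (norm_ne_zero_iff.mpr hp)
  have hd : ‖x - p‖ ^ 2 ≠ 0 := pow_ne_zero 2 (norm_ne_zero_iff.mpr (sub_ne_zero.mpr hxp))
  have hxx : inner ℝ x x = (1 : ℝ) := by rw [real_inner_self_eq_norm_sq, hx, one_pow]
  have hnum : inner ℝ (x - p) x = 1 - inner ℝ x p := by
    rw [inner_sub_left, hxx, real_inner_comm]
  have hden : ‖x - p‖ ^ 2 = 1 - 2 * inner ℝ x p + ‖p‖ ^ 2 := by
    rw [norm_sub_sq_real, hx, one_pow]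
  have hnum' : inner ℝ (x - (‖p‖ ^ 2)⁻¹ • p) x = (‖p‖ ^ 2 - inner ℝ x p) / ‖p‖ ^ 2 := by
    rw [inner_sub_left, hxx, real_inner_smul_left, real_inner_comm]
    field_simp
  have hden' : ‖x - (‖p‖ ^ 2)⁻¹ • p‖ ^ 2 = ‖x - p‖ ^ 2 / ‖p‖ ^ 2 := by
    rw [hden, norm_sub_sq_real, hx, real_inner_smul_right, norm_smul, mul_pow, Real.norm_eq_abs,
      sq_abs]
    field_simp
    ring
  rw [hnum', hden', hnum, div_div_div_cancel_right₀ hs, ← add_div, div_eq_one_iff_eq hd, hden]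
  ring

/-- Let `p : ℂ` with `‖p‖ > 1` and let
`G x = 2 log‖x‖ − log‖x − p‖ − log‖x − p*‖` where `p* = p/‖p‖²`.
Then for every `x` on the unit circle, the real Fréchet derivative of `G`
at `x` in the direction `x` (the outward normal derivative) equals `1`. -/
theorem normal_deriv_green_eq_one (p : ℂ) (hp : 1 < ‖p‖) (x : ℂ) (hx : ‖x‖ = 1) :
    fderiv ℝ (fun y : ℂ =>
        2 * Real.log ‖y‖ - Real.log ‖y - p‖ - Real.log ‖y - p / (‖p‖ : ℂ) ^ 2‖) x x = 1 := by
  have hp0 : p ≠ 0 := norm_pos_iff.mp (zero_lt_one.trans hp)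
  have hx0 : x ≠ 0 := norm_pos_iff.mp (hx ▸ zero_lt_one)
  have hxp : x ≠ p := by
    rintro rfl
    exact hp.ne' hx
  have hq : p / (‖p‖ : ℂ) ^ 2 = (‖p‖ ^ 2)⁻¹ • p := by
    rw [Complex.real_smul]
    push_cast
    rw [div_eq_inv_mul]
  have hxq : x ≠ (‖p‖ ^ 2)⁻¹ • p := by
    intro h
    have hn : ‖x‖ = ‖p‖⁻¹ := by
      rw [h, norm_smul, norm_inv, norm_pow, norm_norm]
      field_simp
    exact (inv_lt_one_of_one_lt₀ hp).ne (hn ▸ hx)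
  have h0 : HasFDerivAt (fun y : ℂ => Real.log ‖y‖) ((‖x‖ ^ 2)⁻¹ • innerSL ℝ x) x := by
    simpa only [sub_zero] using hasFDerivAt_log_norm_sub hx0
  have hsum := inner_div_norm_sq_add_inner_div_norm_sq_inversion hp0 hx hxp
  rw [hq, (((h0.const_mul 2).fun_sub (hasFDerivAt_log_norm_sub hxp)).fun_sub
    (hasFDerivAt_log_norm_sub hxq)).fderiv]
  simp only [sub_apply, smul_apply, innerSL_apply_apply,
    smul_eq_mul, real_inner_self_eq_norm_sq, hx, ← div_eq_inv_mul]
  linarith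
end

section
/- Let D ≥ 1 be an integer and p₁, …, p_D ∈ ℂ with ‖p_i‖ > 1 for all i and p_i ≠ p_j for i ≠ j, and let W(p₁,…,p_D) := π[ 3D ∑_{i=1}^D log‖p_i‖ − ∑_{i,j=1}^D log‖p_i − p_j*‖ − ∑_{i≠j} log‖p_i − p_j‖ ], where q* := q/‖q‖². Then W(p₁,…,p_D) ≥ 2π ∑_{i=1}^D log‖p_i‖ − π D (2D − 1) log 2. -/
open Finset

/-- The renormalized energy of the exterior problem:
`W(p₁,…,p_D) = π[ 3D ∑ᵢ log‖pᵢ‖ − ∑ᵢⱼ log‖pᵢ − pⱼ*‖ − ∑_{i≠j} log‖pᵢ − pⱼ‖ ]`,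
where `q* = q/‖q‖²` is the inversion of `q` in the unit circle. -/
noncomputable def Wext (D : ℕ) (p : Fin D → ℂ) : ℝ :=
  Real.pi * (3 * (D : ℝ) * ∑ i, Real.log ‖p i‖
    - ∑ i, ∑ j, Real.log ‖p i - p j / (‖p j‖ : ℂ) ^ 2‖
    - ∑ i, ∑ j ∈ univ.filter (fun j => j ≠ i), Real.log ‖p i - p j‖)

/-- Monotonicity of `log` on norms: when the bound is at least `1` the junk value
`log 0 = 0` does no harm. -/
theorem log_norm_le_log_of_one_le {E : Type*} [SeminormedAddCommGroup E] {z : E} {y : ℝ}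
    (hy : 1 ≤ y) (h : ‖z‖ ≤ y) : Real.log ‖z‖ ≤ Real.log y := by
  rcases (norm_nonneg z).eq_or_lt with h0 | h0
  · simpa [← h0] using Real.log_nonneg hy
  · exact Real.log_le_log h0 h

theorem log_norm_sub_inversion_le {z w : ℂ} (hz : 1 < ‖z‖) (hw : 1 < ‖w‖) :
    Real.log ‖z - w / (‖w‖ : ℂ) ^ 2‖ ≤ Real.log 2 + Real.log ‖z‖ := by
  rw [← Real.log_mul two_ne_zero (by positivity)]
  refine log_norm_le_log_of_one_le (by linarith) ((norm_sub_le _ _).trans ?_)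
  have hinv : ‖w / (‖w‖ : ℂ) ^ 2‖ ≤ 1 := by
    rw [norm_div, norm_pow, Complex.norm_real, norm_norm, div_le_one (by positivity)]
    nlinarith
  linarith

theorem log_norm_sub_le {z w : ℂ} (hz : 1 < ‖z‖) (hw : 1 < ‖w‖) :
    Real.log ‖z - w‖ ≤ Real.log 2 + (Real.log ‖z‖ + Real.log ‖w‖) := by
  rw [← Real.log_mul (by positivity) (by positivity),
    ← Real.log_mul two_ne_zero (by positivity)]
  refine log_norm_le_log_of_one_le (by nlinarith) ((norm_sub_le _ _).trans ?_)
  nlinarith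

/-- For distinct points `p₁, …, p_D` outside the closed unit disk, the renormalized
energy satisfies `W(p₁,…,p_D) ≥ 2π ∑ᵢ log‖pᵢ‖ − π D (2D − 1) log 2`. -/
theorem renormalized_energy_lower_bound (D : ℕ) (hD : 1 ≤ D) (p : Fin D → ℂ)
    (hp : ∀ i, 1 < ‖p i‖) (hinj : Function.Injective p) :
    2 * Real.pi * (∑ i, Real.log ‖p i‖)
        - Real.pi * (D : ℝ) * (2 * (D : ℝ) - 1) * Real.log 2
      ≤ Wext D p := by
  have h_mirror : ∑ i, ∑ j, Real.log ‖p i - p j / (‖p j‖ : ℂ) ^ 2‖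
      ≤ (D : ℝ) ^ 2 * Real.log 2 + D * ∑ i, Real.log ‖p i‖ := by
    calc _ ≤ ∑ i, ∑ _j : Fin D, (Real.log 2 + Real.log ‖p i‖) :=
          sum_le_sum fun i _ => sum_le_sum fun j _ => log_norm_sub_inversion_le (hp i) (hp j)
      _ = _ := by
        simp only [sum_const, card_univ, Fintype.card_fin, nsmul_eq_mul, ← mul_sum,
          sum_add_distrib]
        ring
  have h_pair : ∑ i, ∑ j ∈ univ.filter (fun j => j ≠ i), Real.log ‖p i - p j‖
      ≤ (D : ℝ) * (D - 1) * Real.log 2 + 2 * (D - 1) * ∑ i, Real.log ‖p i‖ := by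
    calc _ ≤ ∑ i, ∑ j ∈ univ.filter (fun j => j ≠ i),
            (Real.log 2 + (Real.log ‖p i‖ + Real.log ‖p j‖)) :=
          sum_le_sum fun i _ => sum_le_sum fun j _ => log_norm_sub_le (hp i) (hp j)
      _ = _ := by
        simp only [filter_ne', sum_erase_eq_sub (mem_univ _), sum_add_distrib,
          sum_sub_distrib, sum_const, card_univ, Fintype.card_fin, nsmul_eq_mul, ← mul_sum]
        ring
  have h_mul := mul_le_mul_of_nonneg_left (add_le_add h_mirror h_pair) Real.pi_pos.le
  unfold Wext
  linarith
end

section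
/- Let D ≥ 1 be an integer, let A_D := { p : Fin D → ℂ | ‖p i‖ > 1 for all i, and p i ≠ p j for i ≠ j }, and for p ∈ A_D let W(p) := π[ 3D ∑_i log‖p i‖ − ∑_{i,j} log‖p i − (p j)*‖ − ∑_{i≠j} log‖p i − p j‖ ], where q* := q/‖q‖². Then W attains its minimum on A_D: there exists q ∈ A_D such that W(q) ≤ W(p) for all p ∈ A_D. -/
open Finset

/-- The admissible set `A_D` of `D`-tuples of distinct points outside the closed
unit disk. -/
def admissible (D : ℕ) : Set (Fin D → ℂ) :=
  {p | (∀ i, 1 < ‖p i‖) ∧ Function.Injective p}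

/-- The quantity whose logarithm is `-W/π` on the admissible set. -/
noncomputable def energyProduct (D : ℕ) (p : Fin D → ℂ) : ℝ :=
  ((∏ i, ∏ j, ‖p i - p j / (‖p j‖ : ℂ) ^ 2‖) *
    ∏ i, ∏ j ∈ univ.filter (fun j => j ≠ i), ‖p i - p j‖) / (∏ i, ‖p i‖) ^ (3 * D)

lemma norm_div_norm_sq (z : ℂ) : ‖z / (‖z‖ : ℂ) ^ 2‖ = ‖z‖⁻¹ := by
  rcases eq_or_ne z 0 with rfl | hz
  · simp
  · have : ‖z‖ ≠ 0 := norm_ne_zero_iff.2 hz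
    simp only [norm_div, norm_pow, Complex.norm_real, norm_norm]
    field_simp

lemma sub_inversion_ne_zero {z w : ℂ} (hz : 1 < ‖z‖) (hw : 1 < ‖w‖) :
    z - w / (‖w‖ : ℂ) ^ 2 ≠ 0 := by
  intro h
  have h2 := norm_div_norm_sq w
  rw [← sub_eq_zero.1 h] at h2
  have := inv_lt_one_of_one_lt₀ hw
  linarith

lemma energyProduct_pos {D : ℕ} {p : Fin D → ℂ} (hp : p ∈ admissible D) :
    0 < energyProduct D p := by
  obtain ⟨h1, h2⟩ := hp
  refine div_pos (mul_pos ?_ ?_) (pow_pos ?_ _)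
  · exact prod_pos fun i _ => prod_pos fun j _ =>
      norm_pos_iff.2 (sub_inversion_ne_zero (h1 i) (h1 j))
  · refine prod_pos fun i _ => prod_pos fun j hj => norm_pos_iff.2 (sub_ne_zero.2 fun h => ?_)
    exact (mem_filter.1 hj).2 (h2 h).symm
  · exact prod_pos fun i _ => by linarith [h1 i]

lemma Wext_eq_neg_log_energyProduct {D : ℕ} {p : Fin D → ℂ} (hp : p ∈ admissible D) :
    Wext D p = -(Real.pi * Real.log (energyProduct D p)) := by
  obtain ⟨h1, h2⟩ := hp
  have ha : ∀ i j, ‖p i - p j / (‖p j‖ : ℂ) ^ 2‖ ≠ 0 := fun i j =>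
    norm_ne_zero_iff.2 (sub_inversion_ne_zero (h1 i) (h1 j))
  have hb : ∀ i, ∀ j ∈ univ.filter (fun j => j ≠ i), ‖p i - p j‖ ≠ 0 := fun i j hj =>
    norm_ne_zero_iff.2 (sub_ne_zero.2 fun h => (mem_filter.1 hj).2 (h2 h).symm)
  have hc : ∀ i, ‖p i‖ ≠ 0 := fun i => by linarith [h1 i]
  have hA : ∀ i, ∏ j, ‖p i - p j / (‖p j‖ : ℂ) ^ 2‖ ≠ 0 := fun i =>
    prod_ne_zero_iff.2 fun j _ => ha i j
  have hB : ∀ i, ∏ j ∈ univ.filter (fun j => j ≠ i), ‖p i - p j‖ ≠ 0 := fun i =>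
    prod_ne_zero_iff.2 (hb i)
  rw [Wext, energyProduct, Real.log_div
      (mul_ne_zero (prod_ne_zero_iff.2 fun i _ => hA i) (prod_ne_zero_iff.2 fun i _ => hB i))
      (pow_ne_zero _ (prod_ne_zero_iff.2 fun i _ => hc i)),
    Real.log_mul (prod_ne_zero_iff.2 fun i _ => hA i) (prod_ne_zero_iff.2 fun i _ => hB i),
    Real.log_pow, Real.log_prod fun i _ => hA i, Real.log_prod fun i _ => hB i,
    Real.log_prod fun i _ => hc i,
    sum_congr rfl fun i _ => Real.log_prod fun j _ => ha i j,
    sum_congr rfl fun i _ => Real.log_prod (hb i)]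
  push_cast
  ring

lemma continuousOn_energyProduct (D : ℕ) :
    ContinuousOn (energyProduct D) {p | ∀ i, 1 ≤ ‖p i‖} := by
  have hc : ∀ p ∈ {p : Fin D → ℂ | ∀ i, 1 ≤ ‖p i‖}, ∀ i, ‖p i‖ ≠ 0 := fun p hp i => by
    have := hp i
    linarith
  refine ContinuousOn.div (ContinuousOn.mul ?_ ?_) (by fun_prop) fun p hp =>
    pow_ne_zero _ (prod_ne_zero_iff.2 fun i _ => hc p hp i)
  · refine continuousOn_finsetProd _ fun i _ => continuousOn_finsetProd _ fun j _ => ?_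
    refine (ContinuousOn.sub (by fun_prop) (ContinuousOn.div (by fun_prop) (by fun_prop) ?_)).norm
    exact fun p hp => pow_ne_zero _ (Complex.ofReal_ne_zero.2 (hc p hp j))
  · fun_prop

lemma energyProduct_mul_sq_le {D : ℕ} {p : Fin D → ℂ} (hp : ∀ i, 1 ≤ ‖p i‖) :
    energyProduct D p * (∏ i, ‖p i‖) ^ 2 ≤ (2 ^ D) ^ D * (2 ^ D) ^ D := by
  have hR : 0 < ∏ i, ‖p i‖ := prod_pos fun i _ => by linarith [hp i]
  have hA : ∏ i, ∏ j, ‖p i - p j / (‖p j‖ : ℂ) ^ 2‖ ≤ (2 ^ D) ^ D * (∏ i, ‖p i‖) ^ D := by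
    calc _ ≤ ∏ i, ∏ _j : Fin D, (2 * ‖p i‖) := by
          refine prod_le_prod (fun i _ => by positivity) fun i _ =>
            prod_le_prod (fun j _ => by positivity) fun j _ => ?_
          have h := norm_sub_le (p i) (p j / (‖p j‖ : ℂ) ^ 2)
          rw [norm_div_norm_sq] at h
          have := inv_le_one_of_one_le₀ (hp j)
          linarith [hp i]
      _ = _ := by simp [mul_pow, prod_mul_distrib, prod_pow]
  have hB : (∏ i, ∏ j ∈ univ.filter (fun j => j ≠ i), ‖p i - p j‖) * (∏ i, ‖p i‖) ^ 2
      ≤ (2 ^ D) ^ D * (∏ i, ‖p i‖) ^ (2 * D) := by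
    calc _ = ∏ i, (‖p i‖ ^ 2 * ∏ j ∈ univ.erase i, ‖p i - p j‖) := by
          simp_rw [filter_ne', prod_mul_distrib, prod_pow]
          ring
      _ ≤ ∏ i, ∏ j, (2 * (‖p i‖ * ‖p j‖)) := by
          refine prod_le_prod (fun i _ => by positivity) fun i _ => ?_
          rw [← mul_prod_erase univ _ (mem_univ i)]
          refine mul_le_mul (by nlinarith [hp i]) ?_ (by positivity) (by positivity)
          refine prod_le_prod (fun j _ => by positivity) fun j _ => ?_
          have h := norm_sub_le (p i) (p j)
          nlinarith [hp i, hp j, mul_nonneg (sub_nonneg.2 (hp i)) (sub_nonneg.2 (hp j))]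
      _ = _ := by
          simp only [prod_mul_distrib, prod_const, card_univ, Fintype.card_fin, prod_pow]
          ring
  rw [energyProduct, div_mul_eq_mul_div, div_le_iff₀ (pow_pos hR _), mul_assoc]
  calc _ ≤ ((2 ^ D) ^ D * (∏ i, ‖p i‖) ^ D) * ((2 ^ D) ^ D * (∏ i, ‖p i‖) ^ (2 * D)) :=
        mul_le_mul hA hB (by positivity) (by positivity)
    _ = _ := by ring

lemma mem_admissible_of_energyProduct_pos {D : ℕ} {p : Fin D → ℂ} (hp : ∀ i, 1 ≤ ‖p i‖)
    (h : 0 < energyProduct D p) : p ∈ admissible D := by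
  have hn : (∏ i, ∏ j, ‖p i - p j / (‖p j‖ : ℂ) ^ 2‖) *
      ∏ i, ∏ j ∈ univ.filter (fun j => j ≠ i), ‖p i - p j‖ ≠ 0 := fun h0 => by
    rw [energyProduct, h0, zero_div] at h
    exact lt_irrefl _ h
  obtain ⟨hA, hB⟩ := mul_ne_zero_iff.1 hn
  refine ⟨fun i => lt_of_le_of_ne (hp i) fun hi => ?_, fun i j hij => ?_⟩
  · have := prod_ne_zero_iff.1 (prod_ne_zero_iff.1 hA i (mem_univ i)) i (mem_univ i)
    simp [← hi] at this
  · by_contra hne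
    have := prod_ne_zero_iff.1 (prod_ne_zero_iff.1 hB i (mem_univ i)) j
      (mem_filter.2 ⟨mem_univ j, Ne.symm hne⟩)
    simp [hij] at this

lemma admissible_nonempty (D : ℕ) : (admissible D).Nonempty := by
  refine ⟨fun i => ((i : ℕ) + 2 : ℕ), fun i => ?_, fun i j hij => ?_⟩
  · rw [Complex.norm_natCast]
    exact_mod_cast (by omega : 1 < (i : ℕ) + 2)
  · have : (i : ℕ) + 2 = (j : ℕ) + 2 := Nat.cast_injective (R := ℂ) hij
    exact Fin.ext (by omega)

lemma isCompact_energyProduct_superlevel {D : ℕ} {c : ℝ} (hc : 0 < c) :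
    IsCompact ({p : Fin D → ℂ | ∀ i, 1 ≤ ‖p i‖} ∩ energyProduct D ⁻¹' Set.Ici c) := by
  refine Metric.isCompact_of_isClosed_isBounded ?_ ?_
  · refine (continuousOn_energyProduct D).preimage_isClosed_of_isClosed ?_ isClosed_Ici
    rw [Set.ofPred_forall]
    exact isClosed_iInter fun i => isClosed_le continuous_const (by fun_prop)
  · refine isBounded_iff_forall_norm_le.2 ⟨(2 ^ D) ^ D * (2 ^ D) ^ D / c, fun p hp => ?_⟩
    obtain ⟨h1, h2⟩ := hp
    rw [Set.mem_preimage, Set.mem_Ici] at h2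
    have hR : 1 ≤ ∏ i, ‖p i‖ := Finset.one_le_prod fun i _ => h1 i
    refine (pi_norm_le_iff_of_nonneg (by positivity)).2 fun i => ?_
    have hi : ‖p i‖ ≤ ∏ i, ‖p i‖ := by
      rw [← mul_prod_erase univ _ (mem_univ i)]
      exact le_mul_of_one_le_right (norm_nonneg _) (Finset.one_le_prod fun i _ => h1 i)
    rw [le_div_iff₀ hc]
    have := energyProduct_mul_sq_le h1
    calc ‖p i‖ * c ≤ (∏ i, ‖p i‖) ^ 2 * energyProduct D p := by
          refine mul_le_mul (by nlinarith) h2 hc.le (by positivity)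
      _ ≤ _ := by linarith

/-- The renormalized energy `W` attains its minimum on the admissible set `A_D`. -/
theorem renormalized_energy_attains_min (D : ℕ) (hD : 1 ≤ D) :
    ∃ q ∈ admissible D, ∀ p ∈ admissible D, Wext D q ≤ Wext D p := by
  obtain ⟨p₀, hp₀⟩ := admissible_nonempty D
  have hc := energyProduct_pos hp₀
  obtain ⟨q, ⟨hq1, hq2⟩, hq⟩ := (isCompact_energyProduct_superlevel hc).exists_isMaxOn
    ⟨p₀, fun i => (hp₀.1 i).le, Set.mem_preimage.2 Set.self_mem_Ici⟩
    ((continuousOn_energyProduct D).mono Set.inter_subset_left)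
  have hqA := mem_admissible_of_energyProduct_pos hq1 (hc.trans_le hq2)
  refine ⟨q, hqA, fun p hp => ?_⟩
  have hle : energyProduct D p ≤ energyProduct D q := by
    rcases le_total (energyProduct D p₀) (energyProduct D p) with h | h
    · exact hq ⟨fun i => (hp.1 i).le, h⟩
    · exact h.trans hq2
  rw [Wext_eq_neg_log_energyProduct hqA, Wext_eq_neg_log_energyProduct hp, neg_le_neg_iff]
  exact mul_le_mul_of_nonneg_left (Real.log_le_log (energyProduct_pos hp) hle) Real.pi_pos.le
end

section
/- For all real t₁, t₂ > 1, one has t₁⁸ t₂⁸ / ( (t₁² − 1)(t₂² − 1)(t₁ t₂ + 1)² ) ≥ 16, with equality if and only if t₁ = t₂ = 2^{1/4}. -/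
/-- Sum-of-squares decomposition of the numerator minus sixteen times the denominator. -/
lemma droplet_energy_identity (a b : ℝ) :
    a ^ 8 * b ^ 8 - 16 * ((a ^ 2 - 1) * (b ^ 2 - 1) * (a * b + 1) ^ 2) =
      ((a * b) ^ 2 - 2) ^ 2 * ((a * b) ^ 4 + 4 * ((a * b) ^ 2 - 1)) +
        16 * ((a - b) * (a * b + 1)) ^ 2 := by
  ring


/-- For all real `t₁, t₂ > 1`, one has
`t₁⁸ t₂⁸ / ((t₁² − 1)(t₂² − 1)(t₁t₂ + 1)²) ≥ 16`, with equality iff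
`t₁ = t₂ = 2^(1/4)`. -/
theorem droplet_energy_min (t₁ t₂ : ℝ) (h₁ : 1 < t₁) (h₂ : 1 < t₂) :
    16 ≤ t₁ ^ 8 * t₂ ^ 8 / ((t₁ ^ 2 - 1) * (t₂ ^ 2 - 1) * (t₁ * t₂ + 1) ^ 2) ∧
      (t₁ ^ 8 * t₂ ^ 8 / ((t₁ ^ 2 - 1) * (t₂ ^ 2 - 1) * (t₁ * t₂ + 1) ^ 2) = 16 ↔
        t₁ = (2 : ℝ) ^ ((1 : ℝ) / 4) ∧ t₂ = (2 : ℝ) ^ ((1 : ℝ) / 4)) := by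
  have hp : 1 < t₁ * t₂ := one_lt_mul_of_lt_of_le h₁ h₂.le
  have hD : 0 < (t₁ ^ 2 - 1) * (t₂ ^ 2 - 1) * (t₁ * t₂ + 1) ^ 2 := by
    have ha : 0 < t₁ ^ 2 - 1 := by nlinarith
    have hb : 0 < t₂ ^ 2 - 1 := by nlinarith
    positivity
  have hc : 0 < (t₁ * t₂) ^ 4 + 4 * ((t₁ * t₂) ^ 2 - 1) := by
    have : 0 < (t₁ * t₂) ^ 2 - 1 := by nlinarith
    positivity
  have key := droplet_energy_identity t₁ t₂
  have hx : 0 ≤ ((t₁ * t₂) ^ 2 - 2) ^ 2 * ((t₁ * t₂) ^ 4 + 4 * ((t₁ * t₂) ^ 2 - 1)) :=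
    mul_nonneg (sq_nonneg _) hc.le
  have hy : 0 ≤ ((t₁ - t₂) * (t₁ * t₂ + 1)) ^ 2 := sq_nonneg _
  have hr : ((2 : ℝ) ^ ((1 : ℝ) / 4)) ^ 4 = 2 := by
    rw [← Real.rpow_natCast, ← Real.rpow_mul (by norm_num)]
    norm_num
  refine ⟨(le_div_iff₀ hD).2 (by linarith), ?_⟩
  rw [div_eq_iff hD.ne']
  constructor
  · intro h
    have hx0 : ((t₁ * t₂) ^ 2 - 2) ^ 2 * ((t₁ * t₂) ^ 4 + 4 * ((t₁ * t₂) ^ 2 - 1)) = 0 := by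
      linarith
    have hy0 : ((t₁ - t₂) * (t₁ * t₂ + 1)) ^ 2 = 0 := by linarith
    have hpp : (t₁ * t₂) ^ 2 - 2 = 0 :=
      pow_eq_zero_iff two_ne_zero |>.1 ((mul_eq_zero.1 hx0).resolve_right hc.ne')
    have heq : t₁ - t₂ = 0 :=
      (mul_eq_zero.1 (pow_eq_zero_iff two_ne_zero |>.1 hy0)).resolve_right (by linarith)
    obtain rfl : t₁ = t₂ := sub_eq_zero.1 heq
    have ht : t₁ = (2 : ℝ) ^ ((1 : ℝ) / 4) :=
      (pow_left_inj₀ (by linarith) (by positivity) four_ne_zero).1 (by rw [hr]; linarith)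
    exact ⟨ht, ht⟩
  · rintro ⟨ha, hb⟩
    obtain rfl : t₁ = t₂ := ha.trans hb.symm
    have ht : (t₁ * t₁) ^ 2 - 2 = 0 := by
      rw [← ha] at hr
      linarith
    rw [ht] at key
    linarith
end

section
/- Let D ≥ 1 be an integer and p : Fin D → ℂ with ‖p i‖ = 1 for every i. Then ∏_{i < j} ‖p i − p j‖² ≤ D^D, and equality holds when the p i are the D-th roots of unity p k = e^{2πik/D}. Consequently, the boundary renormalized energy W_Γ(p₁,…,p_D) = −2π ∑_{i≠j} log‖p_i − p_j‖ + (D²/2)c₀ is minimized over D-tuples of points on the unit circle by equally spaced points. -/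
open Finset

open scoped ComplexOrder in
/-- The determinant of a positive semidefinite `n × n` matrix is at most the `n`-th power of the
mean of its eigenvalues, by the inequality of arithmetic and geometric means. -/
theorem Matrix.PosSemidef.re_det_le_trace_div_card_pow {n : Type*} [Fintype n] [DecidableEq n]
    [Nonempty n] {A : Matrix n n ℂ} (hA : A.PosSemidef) :
    A.det.re ≤ (A.trace.re / Fintype.card n) ^ Fintype.card n := by
  have hdet : A.det.re = ∏ i, hA.isHermitian.eigenvalues i := by
    rw [hA.isHermitian.det_eq_prod_eigenvalues]
    norm_cast
  have htr : A.trace.re = ∑ i, hA.isHermitian.eigenvalues i := by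
    rw [hA.isHermitian.trace_eq_sum_eigenvalues]
    norm_cast
  have hcard : (0 : ℝ) < Fintype.card n := by exact_mod_cast Fintype.card_pos
  have hnn : ∀ i ∈ univ, 0 ≤ hA.isHermitian.eigenvalues i := fun i _ => hA.eigenvalues_nonneg i
  have hamgm := Real.geom_mean_le_arith_mean univ (fun _ => 1) hA.isHermitian.eigenvalues
    (fun _ _ => zero_le_one) (by simpa using Fintype.card_pos) hnn
  simp only [Real.rpow_one, one_mul, sum_const, card_univ, nsmul_eq_mul, mul_one] at hamgm
  have hprod : 0 ≤ ∏ i, hA.isHermitian.eigenvalues i := prod_nonneg hnn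
  rw [hdet, htr, ← Real.rpow_natCast]
  exact (Real.rpow_inv_le_iff_of_pos hprod (div_nonneg (sum_nonneg hnn) hcard.le) hcard).1 hamgm

/-- The squared modulus of the Vandermonde determinant as a product of squared distances. -/
theorem Matrix.det_vandermonde_mul_conjTranspose {D : ℕ} (p : Fin D → ℂ) :
    (vandermonde p * (vandermonde p).conjTranspose).det =
      ((∏ i, ∏ j ∈ univ.filter (fun j => i < j), ‖p i - p j‖ ^ 2 : ℝ) : ℂ) := by
  rw [det_mul, det_conjTranspose, ← starRingEnd_apply, Complex.mul_conj, Complex.normSq_eq_norm_sq,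
    det_vandermonde, norm_prod, ← prod_pow]
  congr 1
  refine prod_congr rfl fun i _ => ?_
  rw [norm_prod, ← prod_pow]
  exact prod_congr (by ext; simp) fun j _ => by rw [norm_sub_rev]

theorem Matrix.vandermonde_mul_conjTranspose_apply {D : ℕ} (p : Fin D → ℂ) (i j : Fin D) :
    (vandermonde p * (vandermonde p).conjTranspose) i j =
      ∑ k ∈ range D, (p i * star (p j)) ^ k := by
  simp [mul_apply, vandermonde_apply, mul_pow, ← Fin.sum_univ_eq_sum_range]

theorem Matrix.trace_vandermonde_mul_conjTranspose {D : ℕ} {p : Fin D → ℂ}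
    (hp : ∀ i, ‖p i‖ = 1) :
    (vandermonde p * (vandermonde p).conjTranspose).trace = D * D := by
  have h (i : Fin D) : p i * star (p i) = 1 := by
    rw [← starRingEnd_apply, Complex.mul_conj, Complex.normSq_eq_norm_sq, hp]; simp
  simp only [trace, diag_apply, vandermonde_mul_conjTranspose_apply, h]
  simp

open scoped ComplexOrder in
theorem prod_norm_sub_sq_le_pow {D : ℕ} (hD : 1 ≤ D) {p : Fin D → ℂ} (hp : ∀ i, ‖p i‖ = 1) :
    ∏ i, ∏ j ∈ univ.filter (fun j => i < j), ‖p i - p j‖ ^ 2 ≤ (D : ℝ) ^ D := by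
  have : Nonempty (Fin D) := ⟨⟨0, hD⟩⟩
  have hD' : (D : ℝ) ≠ 0 := by positivity
  have h := (Matrix.posSemidef_self_mul_conjTranspose
    (Matrix.vandermonde p)).re_det_le_trace_div_card_pow
  rw [Matrix.det_vandermonde_mul_conjTranspose, Matrix.trace_vandermonde_mul_conjTranspose hp,
    Complex.ofReal_re, Fintype.card_fin] at h
  simpa [hD'] using h

theorem IsPrimitiveRoot.prod_norm_sub_sq_eq_pow {D : ℕ} (hD : 1 ≤ D) {ζ : ℂ}
    (hζ : IsPrimitiveRoot ζ D) :
    ∏ i : Fin D, ∏ j ∈ univ.filter (fun j => i < j), ‖ζ ^ (i : ℕ) - ζ ^ (j : ℕ)‖ ^ 2 =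
      (D : ℝ) ^ D := by
  have hnorm : ζ * star ζ = 1 := by
    rw [← starRingEnd_apply, Complex.mul_conj, Complex.normSq_eq_norm_sq,
      hζ.norm'_eq_one (by lia)]
    simp
  have hpow (k : ℕ) : ζ ^ k * star (ζ ^ k) = 1 := by rw [star_pow, ← mul_pow, hnorm, one_pow]
  have hgram : Matrix.vandermonde (fun i : Fin D => ζ ^ (i : ℕ)) *
      (Matrix.vandermonde fun i : Fin D => ζ ^ (i : ℕ)).conjTranspose = (D : ℂ) • 1 := by
    ext i j
    rw [Matrix.vandermonde_mul_conjTranspose_apply]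
    by_cases hij : i = j
    · subst hij
      simp only [hpow]
      simp
    · have hne : ζ ^ (i : ℕ) * star (ζ ^ (j : ℕ)) ≠ 1 := fun h => hij <| Fin.ext <|
        hζ.pow_inj i.2 j.2 <| mul_right_cancel₀ (right_ne_zero_of_mul_eq_one (hpow j))
          (h.trans (hpow j).symm)
      have hone : (ζ ^ (i : ℕ) * star (ζ ^ (j : ℕ))) ^ D = 1 := by
        rw [mul_pow, ← star_pow, pow_right_comm ζ i, pow_right_comm ζ j, hζ.pow_eq_one]
        simp
      rw [geom_sum_eq hne, hone]
      simp [hij]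
  have h := Matrix.det_vandermonde_mul_conjTranspose fun i : Fin D => ζ ^ (i : ℕ)
  rw [hgram, Matrix.det_smul, Matrix.det_one, Fintype.card_fin, mul_one] at h
  exact_mod_cast h.symm

theorem sum_log_norm_sub_eq_log_prod {D : ℕ} {p : Fin D → ℂ} (hp : Function.Injective p) :
    ∑ i, ∑ j ∈ univ.filter (fun j => j ≠ i), Real.log ‖p i - p j‖ =
      Real.log (∏ i, ∏ j ∈ univ.filter (fun j => i < j), ‖p i - p j‖ ^ 2) := by
  have hne {i j : Fin D} (hij : i < j) : ‖p i - p j‖ ^ 2 ≠ 0 :=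
    pow_ne_zero _ (norm_ne_zero_iff.2 (sub_ne_zero.2 (hp.ne hij.ne)))
  have hsplit (i : Fin D) : ∑ j ∈ univ.filter (fun j => j ≠ i), Real.log ‖p i - p j‖ =
      ∑ j ∈ univ.filter (fun j => i < j), Real.log ‖p i - p j‖ +
        ∑ j ∈ univ.filter (fun j => j < i), Real.log ‖p i - p j‖ := by
    rw [← sum_union (disjoint_filter.2 fun j _ h h' => lt_asymm h h'), ← filter_or]
    exact sum_congr (by ext; simp [lt_or_lt_iff_ne, ne_comm]) fun _ _ => rfl
  have hswap : ∑ i, ∑ j ∈ univ.filter (fun j => j < i), Real.log ‖p i - p j‖ =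
      ∑ i, ∑ j ∈ univ.filter (fun j => i < j), Real.log ‖p i - p j‖ := by
    simp only [sum_filter]
    rw [sum_comm]
    simp only [norm_sub_rev]
  rw [Real.log_prod fun i _ => prod_ne_zero_iff.2 fun j hj => hne (mem_filter.1 hj).2]
  simp only [hsplit, sum_add_distrib, hswap]
  rw [← two_mul, mul_sum]
  refine sum_congr rfl fun i _ => ?_
  rw [Real.log_prod fun j hj => hne (mem_filter.1 hj).2, mul_sum]
  simp [Real.log_pow]

/-- Let `D ≥ 1` and let `q k = e^{2πik/D}` be the `D`-th roots of unity.  Then: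
(1) for any `D`-tuple `p` of points on the unit circle,
`∏_{i<j} ‖pᵢ − pⱼ‖² ≤ D^D`;
(2) equality holds for the roots of unity `q`;
(3) consequently the boundary renormalized energy
`W_Γ(p) = −2π ∑_{i≠j} log‖pᵢ − pⱼ‖ + (D²/2)c₀` is minimized over `D`-tuples of
distinct points on the unit circle by the equally spaced points `q`. -/
theorem boundary_renormalized_energy_min (D : ℕ) (hD : 1 ≤ D) (c₀ : ℝ)
    (q : Fin D → ℂ)
    (hq : ∀ k : Fin D, q k = Complex.exp (2 * Real.pi * (k : ℕ) * Complex.I / D)) :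
    (∀ p : Fin D → ℂ, (∀ i, ‖p i‖ = 1) →
        (∏ i, ∏ j ∈ univ.filter (fun j => i < j), ‖p i - p j‖ ^ 2) ≤ (D : ℝ) ^ D) ∧
      (∏ i, ∏ j ∈ univ.filter (fun j => i < j), ‖q i - q j‖ ^ 2) = (D : ℝ) ^ D ∧
      (∀ p : Fin D → ℂ, (∀ i, ‖p i‖ = 1) → Function.Injective p →
        (-(2 * Real.pi)) * (∑ i, ∑ j ∈ univ.filter (fun j => j ≠ i),
              Real.log ‖q i - q j‖) + (D : ℝ) ^ 2 / 2 * c₀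
          ≤ (-(2 * Real.pi)) * (∑ i, ∑ j ∈ univ.filter (fun j => j ≠ i),
              Real.log ‖p i - p j‖) + (D : ℝ) ^ 2 / 2 * c₀) := by
  have hζ := Complex.isPrimitiveRoot_exp D (by lia)
  have hqζ : q = fun k : Fin D => Complex.exp (2 * Real.pi * Complex.I / D) ^ (k : ℕ) := by
    ext k
    rw [hq, ← Complex.exp_nat_mul]
    ring_nf
  have hprod : ∏ i, ∏ j ∈ univ.filter (fun j => i < j), ‖q i - q j‖ ^ 2 = (D : ℝ) ^ D := by
    rw [hqζ]
    exact hζ.prod_norm_sub_sq_eq_pow hD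
  have hqinj : Function.Injective q := by
    rw [hqζ]
    exact fun i j h => Fin.ext (hζ.pow_inj i.2 j.2 h)
  refine ⟨fun p hp => prod_norm_sub_sq_le_pow hD hp, hprod, fun p hp hinj => ?_⟩
  rw [sum_log_norm_sub_eq_log_prod hqinj, sum_log_norm_sub_eq_log_prod hinj, hprod]
  have hpos : 0 < ∏ i, ∏ j ∈ univ.filter (fun j => i < j), ‖p i - p j‖ ^ 2 :=
    prod_pos fun i _ => prod_pos fun j hj =>
      pow_pos (norm_pos_iff.2 (sub_ne_zero.2 (hinj.ne (mem_filter.1 hj).2.ne))) 2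
  have hlog := Real.log_le_log hpos (prod_norm_sub_sq_le_pow hD hp)
  nlinarith [Real.pi_pos]
end

section
/- Let L > 0, let u : ℂ → ℂ be Lipschitz with Lipschitz constant L, and let x₂ ∈ ℂ satisfy ‖u(x₂)‖ ≤ 1/2. Then ‖u(x)‖ ≤ 3/4 for every x in the closed ball of radius 1/(4L) about x₂, and consequently ∫_{B(x₂, 1/(4L))} (1 − ‖u(x)‖²)² dx ≥ 49π / (4096 L²), the integral being with respect to two-dimensional Lebesgue measure on ℂ ≅ ℝ². -/
open MeasureTheory

/-- Let `u : ℂ → ℂ` be Lipschitz with constant `L > 0` and suppose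
`‖u x₂‖ ≤ 1/2`.  Then `‖u x‖ ≤ 3/4` on the closed ball of radius `1/(4L)`
about `x₂`, and consequently
`∫_{B(x₂,1/(4L))} (1 − ‖u‖²)² dx ≥ 49π/(4096 L²)`. -/
theorem potential_lower_bound_near_vortex (L : ℝ) (hL : 0 < L) (u : ℂ → ℂ)
    (hu : LipschitzWith (Real.toNNReal L) u) (x₂ : ℂ) (h2 : ‖u x₂‖ ≤ 1 / 2) :
    (∀ x ∈ Metric.closedBall x₂ (1 / (4 * L)), ‖u x‖ ≤ 3 / 4) ∧
      49 * Real.pi / (4096 * L ^ 2)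
        ≤ ∫ x in Metric.closedBall x₂ (1 / (4 * L)), (1 - ‖u x‖ ^ 2) ^ 2 := by
  have hbound : ∀ x ∈ Metric.closedBall x₂ (1 / (4 * L)), ‖u x‖ ≤ 3 / 4 := by
    intro x hx
    have hlip : ‖u x - u x₂‖ ≤ 1 / 4 := by
      calc ‖u x - u x₂‖ ≤ L * dist x x₂ := by
            simpa [dist_eq_norm, hL.le] using hu.dist_le_mul x x₂
        _ ≤ L * (1 / (4 * L)) := by
            gcongr
            exact Metric.mem_closedBall.mp hx
        _ = 1 / 4 := by field_simp
    linarith [norm_le_norm_add_norm_sub' (u x) (u x₂)]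
  refine ⟨hbound, ?_⟩
  have hcont : Continuous fun x => (1 - ‖u x‖ ^ 2) ^ 2 := by
    have := hu.continuous
    fun_prop
  have hvol : volume.real (Metric.closedBall x₂ (1 / (4 * L))) = (1 / (4 * L)) ^ 2 * Real.pi := by
    have hr : 0 ≤ 1 / (4 * L) := by positivity
    rw [measureReal_def, Complex.volume_closedBall, ENNReal.toReal_mul, ENNReal.toReal_pow,
      ENNReal.toReal_ofReal hr, ENNReal.coe_toReal, NNReal.coe_real_pi]
  have hpointwise : ∀ x ∈ Metric.closedBall x₂ (1 / (4 * L)),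
      (7 / 16 : ℝ) ^ 2 ≤ (1 - ‖u x‖ ^ 2) ^ 2 := by
    intro x hx
    gcongr
    nlinarith [hbound x hx, norm_nonneg (u x)]
  calc 49 * Real.pi / (4096 * L ^ 2)
      = (7 / 16) ^ 2 * volume.real (Metric.closedBall x₂ (1 / (4 * L))) := by
        rw [hvol]
        field_simp
        norm_num
    _ ≤ _ := setIntegral_ge_of_const_le_real Metric.isClosed_closedBall.measurableSet
        measure_closedBall_lt_top.ne hpointwise
        (hcont.continuousOn.integrableOn_compact (isCompact_closedBall _ _))
end

section
/- For every integer d and every C₂ ≥ 0 there is a constant C such that the following holds. Let 0 < r < R, let ε ∈ (0, r], and let u : ℂ → ℂ be C¹ on a neighborhood of the closed annulus A = {z : r ≤ ‖z‖ ≤ R}, with 1/2 ≤ ‖u(z)‖ ≤ 1 on A, with (1/(2ε²)) ∫_{r < ‖z‖ < R} (1 − ‖u(z)‖²)² dz ≤ C₂, and such that for every s ∈ [r, R] the degree condition (1/(2π)) ∫_0^{2π} ⟨ i·u(s e^{iθ}), ∂_θ [u(s e^{iθ})] ⟩ / ‖u(s e^{iθ})‖² dθ = d holds, where ⟨·,·⟩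 is the real inner product on ℂ ≅ ℝ². Then (1/2) ∫_{r < ‖z‖ < R} ‖Du(z)‖² dz ≥ π d² log(R/r) − C, where Du is the real Fréchet derivative and ‖Du‖ is its Hilbert–Schmidt (Frobenius) norm. -/
open MeasureTheory

/-- The `θ`-derivative of `u` at `z`, paired with `i u` and divided by `‖u‖²`: the derivative of
the phase of `u` along the circle through `z`. -/
noncomputable def angularCurrent (u : ℂ → ℂ) (z : ℂ) : ℝ :=
  ((Complex.I * u z).re * (fderiv ℝ u z (Complex.I * z)).re +
    (Complex.I * u z).im * (fderiv ℝ u z (Complex.I * z)).im) / ‖u z‖ ^ 2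

lemma norm_real_mul_exp_I {s : ℝ} (hs : 0 ≤ s) (θ : ℝ) :
    ‖(s : ℂ) * Complex.exp (Complex.I * (θ : ℂ))‖ = s := by
  rw [norm_mul, Complex.norm_exp_I_mul_ofReal, mul_one, Complex.norm_real, Real.norm_of_nonneg hs]

/-- Integration over an annulus in polar coordinates. -/
lemma setIntegral_annulus_eq {r R : ℝ} (hr : 0 < r) (hrR : r < R) {g : ℂ → ℝ}
    (hg : ContinuousOn g {z : ℂ | r ≤ ‖z‖ ∧ ‖z‖ ≤ R}) :
    ∫ z in {z : ℂ | r < ‖z‖ ∧ ‖z‖ < R}, g z =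
      ∫ s in r..R, s * ∫ θ in (0 : ℝ)..(2 * Real.pi),
        g ((s : ℂ) * Complex.exp (Complex.I * (θ : ℂ))) := by
  have hA : MeasurableSet {z : ℂ | r < ‖z‖ ∧ ‖z‖ < R} :=
    ((isOpen_lt continuous_const continuous_norm).inter
      (isOpen_lt continuous_norm continuous_const)).measurableSet
  have hsymm : ∀ p : ℝ × ℝ, Complex.polarCoord.symm p =
      (p.1 : ℂ) * Complex.exp (Complex.I * (p.2 : ℂ)) := by
    intro p
    rw [Complex.polarCoord_symm_apply, mul_comm Complex.I, Complex.exp_mul_I]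
    push_cast
    ring
  have hcont : ContinuousOn (fun p : ℝ × ℝ =>
      p.1 * g ((p.1 : ℂ) * Complex.exp (Complex.I * (p.2 : ℂ))))
      (Set.Icc r R ×ˢ Set.Icc (-Real.pi) Real.pi) := by
    refine continuousOn_fst.mul (hg.comp (by fun_prop) ?_)
    rintro ⟨s, θ⟩ ⟨hs, -⟩
    simp only [Set.mem_ofPred_eq]
    rw [norm_real_mul_exp_I (hr.le.trans hs.1)]
    exact hs
  have hint : IntegrableOn (fun p : ℝ × ℝ =>
      p.1 * g ((p.1 : ℂ) * Complex.exp (Complex.I * (p.2 : ℂ))))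
      (Set.Ioc r R ×ˢ Set.Ioc (-Real.pi) Real.pi) (volume.prod volume) :=
    (hcont.integrableOn_compact (isCompact_Icc.prod isCompact_Icc)).mono_set
      (Set.prod_mono Set.Ioc_subset_Icc_self Set.Ioc_subset_Icc_self)
  have hper : ∀ s : ℝ, ∫ θ in (0 : ℝ)..(2 * Real.pi),
      g ((s : ℂ) * Complex.exp (Complex.I * (θ : ℂ))) =
      ∫ θ in Set.Ioc (-Real.pi) Real.pi,
        g ((s : ℂ) * Complex.exp (Complex.I * (θ : ℂ))) := by
    intro s
    have hp : Function.Periodic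
        (fun θ : ℝ => g ((s : ℂ) * Complex.exp (Complex.I * (θ : ℂ)))) (2 * Real.pi) := by
      intro θ
      have : Complex.exp (Complex.I * ((θ + 2 * Real.pi : ℝ) : ℂ)) =
          Complex.exp (Complex.I * (θ : ℂ)) := by
        rw [← Complex.exp_periodic (Complex.I * (θ : ℂ))]
        congr 1
        push_cast
        ring
      simp only [this]
    have := hp.intervalIntegral_add_eq 0 (-Real.pi)
    rw [zero_add, show -Real.pi + 2 * Real.pi = Real.pi by ring] at this
    rw [this, intervalIntegral.integral_of_le (by linarith [Real.pi_pos])]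
  rw [← integral_indicator hA, ← Complex.integral_comp_polarCoord_symm, polarCoord_target]
  have hind : ∀ p ∈ Set.Ioi (0 : ℝ) ×ˢ Set.Ioo (-Real.pi) Real.pi,
      p.1 • Set.indicator {z : ℂ | r < ‖z‖ ∧ ‖z‖ < R} g (Complex.polarCoord.symm p) =
      Set.indicator (Set.Ioo r R ×ˢ Set.Ioo (-Real.pi) Real.pi) (fun p : ℝ × ℝ =>
        p.1 * g ((p.1 : ℂ) * Complex.exp (Complex.I * (p.2 : ℂ)))) p := by
    rintro ⟨s, θ⟩ ⟨hs, hθ⟩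
    have hs' : (0 : ℝ) < s := hs
    have hθ' : θ ∈ Set.Ioo (-Real.pi) Real.pi := hθ
    rw [hsymm]
    by_cases h : r < s ∧ s < R
    · rw [Set.indicator_of_mem, Set.indicator_of_mem, smul_eq_mul]
      · exact ⟨h, hθ'⟩
      · simpa only [Set.mem_ofPred_eq, norm_real_mul_exp_I hs'.le] using h
    · rw [Set.indicator_of_notMem, Set.indicator_of_notMem, smul_zero]
      · exact fun h' => h h'.1
      · simpa only [Set.mem_ofPred_eq, norm_real_mul_exp_I hs'.le] using h
  rw [setIntegral_congr_fun (measurableSet_Ioi.prod measurableSet_Ioo) hind,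
    setIntegral_indicator (measurableSet_Ioo.prod measurableSet_Ioo),
    Set.inter_eq_right.mpr (Set.prod_mono (fun s (hs : s ∈ Set.Ioo r R) => hr.trans hs.1) subset_rfl :
      Set.Ioo r R ×ˢ Set.Ioo (-Real.pi) Real.pi ⊆ Set.Ioi 0 ×ˢ Set.Ioo (-Real.pi) Real.pi),
    Measure.volume_eq_prod,
    setIntegral_congr_set (Measure.set_prod_ae_eq Ioo_ae_eq_Ioc Ioo_ae_eq_Ioc),
    setIntegral_prod _ hint, intervalIntegral.integral_of_le hrR.le]
  simp only [hper, integral_const_mul]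

lemma deriv_comp_circle {u : ℂ → ℂ} {s θ : ℝ}
    (hu : DifferentiableAt ℝ u ((s : ℂ) * Complex.exp (Complex.I * (θ : ℂ)))) :
    deriv (fun t : ℝ => u ((s : ℂ) * Complex.exp (Complex.I * (t : ℂ)))) θ =
      fderiv ℝ u ((s : ℂ) * Complex.exp (Complex.I * (θ : ℂ)))
        (Complex.I * ((s : ℂ) * Complex.exp (Complex.I * (θ : ℂ)))) := by
  have h : HasDerivAt (fun t : ℝ => (s : ℂ) * Complex.exp (Complex.I * (t : ℂ)))
      (Complex.I * ((s : ℂ) * Complex.exp (Complex.I * (θ : ℂ)))) θ := by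
    have h1 : HasDerivAt (fun t : ℝ => Complex.I * (t : ℂ)) (Complex.I * 1) θ :=
      (Complex.ofRealCLM.hasDerivAt (x := θ)).const_mul Complex.I
    exact (h1.cexp.const_mul (s : ℂ)).congr_deriv (by ring)
  exact (hu.hasFDerivAt.comp_hasDerivAt θ h).deriv

/-- A real-linear map of `ℂ` is bounded by its Frobenius norm. -/
lemma norm_sq_apply_le (L : ℂ →L[ℝ] ℂ) (w : ℂ) :
    ‖L w‖ ^ 2 ≤ ‖w‖ ^ 2 * (‖L 1‖ ^ 2 + ‖L Complex.I‖ ^ 2) := by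
  have hw : L w = (w.re : ℂ) * L 1 + (w.im : ℂ) * L Complex.I := by
    have : w = w.re • (1 : ℂ) + w.im • Complex.I := by
      simp [Complex.re_add_im]
    conv_lhs => rw [this]
    rw [map_add, map_smul, map_smul, Complex.real_smul, Complex.real_smul]
  rw [hw]
  simp only [← Complex.normSq_eq_norm_sq, Complex.normSq_apply, Complex.add_re, Complex.add_im,
    Complex.mul_re, Complex.mul_im, Complex.ofReal_re, Complex.ofReal_im, zero_mul, sub_zero,
    add_zero]
  nlinarith [sq_nonneg (w.im * (L 1).re - w.re * (L Complex.I).re),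
    sq_nonneg (w.im * (L 1).im - w.re * (L Complex.I).im)]

/-- Linear lower bound for the energy density in terms of the angular current. -/
lemma angularCurrent_le_energyDensity (u : ℂ → ℂ) (z : ℂ) (hz : z ≠ 0) (h1 : 1 / 2 ≤ ‖u z‖)
    (h2 : ‖u z‖ ≤ 1) (d : ℝ) {ε : ℝ} (hε : 0 < ε) :
    2 * d * (angularCurrent u z / ‖z‖ ^ 2) - d ^ 2 * (1 / ‖z‖ ^ 2) -
      2 * d ^ 2 / ε ^ 2 * (1 - ‖u z‖ ^ 2) ^ 2 - 2 * d ^ 2 * ε ^ 2 * (1 / ‖z‖ ^ 4) ≤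
      ‖fderiv ℝ u z 1‖ ^ 2 + ‖fderiv ℝ u z Complex.I‖ ^ 2 := by
  have hL := norm_sq_apply_le (fderiv ℝ u z) (Complex.I * z)
  rw [norm_mul, Complex.norm_I, one_mul] at hL
  set E := ‖fderiv ℝ u z 1‖ ^ 2 + ‖fderiv ℝ u z Complex.I‖ ^ 2
  set v := fderiv ℝ u z (Complex.I * z) with hv
  have hzpos : 0 < ‖z‖ := norm_pos_iff.mpr hz
  have hupos : 0 < ‖u z‖ := by linarith
  set ψ := angularCurrent u z with hψ
  have hN : (Complex.I * u z).re * v.re + (Complex.I * u z).im * v.im = ψ * ‖u z‖ ^ 2 := by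
    rw [hψ, angularCurrent, div_mul_cancel₀ _ (by positivity)]
  have hCS : ((Complex.I * u z).re * v.re + (Complex.I * u z).im * v.im) ^ 2 ≤
      ‖u z‖ ^ 2 * ‖v‖ ^ 2 := by
    simp only [← Complex.normSq_eq_norm_sq, Complex.normSq_apply, Complex.mul_re, Complex.mul_im,
      Complex.I_re, Complex.I_im]
    nlinarith [sq_nonneg ((u z).re * v.re + (u z).im * v.im)]
  rw [hN] at hCS
  set ρ := ‖u z‖
  set t := ‖z‖
  have hψv : ψ ^ 2 * ρ ^ 2 ≤ ‖v‖ ^ 2 := by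
    have : 0 < ρ ^ 2 := by positivity
    nlinarith
  have hinv : 1 / ρ ^ 2 ≤ 1 + 4 * (1 - ρ ^ 2) := by
    rw [div_le_iff₀ (by positivity)]
    nlinarith [mul_nonneg (show (0 : ℝ) ≤ ρ ^ 2 - 1 / 4 by nlinarith)
      (show (0 : ℝ) ≤ 1 - ρ ^ 2 by nlinarith)]
  have hsq : 2 * d * ψ - d ^ 2 * (1 / ρ ^ 2) ≤ ψ ^ 2 * ρ ^ 2 := by
    have : (ψ * ρ - d / ρ) ^ 2 = ψ ^ 2 * ρ ^ 2 - 2 * d * ψ + d ^ 2 * (1 / ρ ^ 2) := by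
      field_simp
      ring
    linarith [sq_nonneg (ψ * ρ - d / ρ)]
  have hcore : (2 * d * ψ - d ^ 2 * (1 + 4 * (1 - ρ ^ 2))) / t ^ 2 ≤ E := by
    rw [div_le_iff₀ (by positivity)]
    nlinarith [mul_le_mul_of_nonneg_left hinv (sq_nonneg d)]
  have hamgm : 4 * d ^ 2 * (1 - ρ ^ 2) / t ^ 2 ≤
      2 * d ^ 2 / ε ^ 2 * (1 - ρ ^ 2) ^ 2 + 2 * d ^ 2 * ε ^ 2 * (1 / t ^ 4) := by
    have : 2 * d ^ 2 * ((1 - ρ ^ 2) / ε - ε / t ^ 2) ^ 2 =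
        2 * d ^ 2 / ε ^ 2 * (1 - ρ ^ 2) ^ 2 + 2 * d ^ 2 * ε ^ 2 * (1 / t ^ 4) -
          4 * d ^ 2 * (1 - ρ ^ 2) / t ^ 2 := by
      field_simp
      ring
    have h0 : 0 ≤ 2 * d ^ 2 * ((1 - ρ ^ 2) / ε - ε / t ^ 2) ^ 2 := by positivity
    linarith
  have hsplit : (2 * d * ψ - d ^ 2 * (1 + 4 * (1 - ρ ^ 2))) / t ^ 2 =
      2 * d * (ψ / t ^ 2) - d ^ 2 * (1 / t ^ 2) - 4 * d ^ 2 * (1 - ρ ^ 2) / t ^ 2 := by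
    ring
  linarith

/-- On an annulus, a function whose circular integrals all equal `c` has weighted integral
`c log(R/r)` against `‖z‖⁻²`. -/
lemma setIntegral_annulus_div_norm_sq {r R : ℝ} (hr : 0 < r) (hrR : r < R) {g : ℂ → ℝ}
    (hg : ContinuousOn g {z : ℂ | r ≤ ‖z‖ ∧ ‖z‖ ≤ R}) {c : ℝ}
    (hc : ∀ s ∈ Set.Icc r R, ∫ θ in (0 : ℝ)..(2 * Real.pi),
      g ((s : ℂ) * Complex.exp (Complex.I * (θ : ℂ))) = c) :
    ∫ z in {z : ℂ | r < ‖z‖ ∧ ‖z‖ < R}, g z / ‖z‖ ^ 2 = c * Real.log (R / r) := by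
  have hcont : ContinuousOn (fun z => g z / ‖z‖ ^ 2) {z : ℂ | r ≤ ‖z‖ ∧ ‖z‖ ≤ R} :=
    hg.div (by fun_prop) fun z hz => pow_ne_zero _ (hr.trans_le hz.1).ne'
  rw [setIntegral_annulus_eq hr hrR hcont]
  have : ∀ s ∈ Set.uIcc r R, s * ∫ θ in (0 : ℝ)..(2 * Real.pi),
      g ((s : ℂ) * Complex.exp (Complex.I * (θ : ℂ))) /
        ‖(s : ℂ) * Complex.exp (Complex.I * (θ : ℂ))‖ ^ 2 = c * s⁻¹ := by
    intro s hs
    rw [Set.uIcc_of_le hrR.le] at hs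
    have hs0 : 0 < s := hr.trans_le hs.1
    simp only [norm_real_mul_exp_I hs0.le, intervalIntegral.integral_div, hc s hs]
    field_simp
  rw [intervalIntegral.integral_congr this, intervalIntegral.integral_const_mul,
    integral_inv_of_pos hr (hr.trans hrR)]

lemma setIntegral_annulus_inv_norm_pow_four_le {r R : ℝ} (hr : 0 < r) (hrR : r < R) :
    ∫ z in {z : ℂ | r < ‖z‖ ∧ ‖z‖ < R}, 1 / ‖z‖ ^ 4 ≤ Real.pi / r ^ 2 := by
  have hcont : ContinuousOn (fun z : ℂ => 1 / ‖z‖ ^ 4) {z : ℂ | r ≤ ‖z‖ ∧ ‖z‖ ≤ R} :=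
    continuousOn_const.div (by fun_prop) fun z hz => pow_ne_zero _ (hr.trans_le hz.1).ne'
  rw [setIntegral_annulus_eq hr hrR hcont]
  have hR : 0 < R := hr.trans hrR
  have : ∀ s ∈ Set.uIcc r R, s * ∫ θ in (0 : ℝ)..(2 * Real.pi),
      1 / ‖(s : ℂ) * Complex.exp (Complex.I * (θ : ℂ))‖ ^ 4 =
        2 * Real.pi * s ^ (-3 : ℤ) := by
    intro s hs
    rw [Set.uIcc_of_le hrR.le] at hs
    have hs0 : 0 < s := hr.trans_le hs.1
    simp only [norm_real_mul_exp_I hs0.le, intervalIntegral.integral_const, smul_eq_mul]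
    rw [zpow_neg]
    field_simp
    norm_cast
    ring
  have h0 : (0 : ℝ) ∉ Set.uIcc r R := by
    rw [Set.uIcc_of_le hrR.le]
    exact fun h => absurd h.1 (not_le.mpr hr)
  rw [intervalIntegral.integral_congr this, intervalIntegral.integral_const_mul,
    integral_zpow (Or.inr ⟨by norm_num, h0⟩)]
  have h1 : (2 * Real.pi * ((R ^ ((-3 : ℤ) + 1) - r ^ ((-3 : ℤ) + 1)) / (((-3 : ℤ) : ℝ) + 1))) =
      Real.pi / r ^ 2 - Real.pi / R ^ 2 := by
    rw [show (-3 : ℤ) + 1 = -2 by norm_num, show (((-3 : ℤ) : ℝ) + 1) = -2 by norm_num, zpow_neg,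
      zpow_neg, zpow_ofNat, zpow_ofNat]
    ring
  rw [h1]
  have : 0 < Real.pi / R ^ 2 := by have := Real.pi_pos; positivity
  linarith

/-- Interior-vortex lower bound.  For every degree `d : ℤ` and every potential
energy bound `C₂ ≥ 0` there is a constant `C` with the following property.
Whenever `0 < r < R`, `ε ∈ (0, r]`, and `u : ℂ → ℂ` is `C¹` on a neighborhood
of the closed annulus `{r ≤ ‖z‖ ≤ R}`, with `1/2 ≤ ‖u‖ ≤ 1` there, with
`(1/2ε²)∫_{r<‖z‖<R} (1−‖u‖²)² ≤ C₂`, and with winding number `d` on every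
circle of radius `s ∈ [r,R]` (expressed via the degree formula
`(1/2π)∫₀^{2π} ⟨ i u, ∂_θ u ⟩/‖u‖² dθ = d`, with the real inner product on
`ℂ ≅ ℝ²` written out in coordinates), then
`(1/2)∫_{r<‖z‖<R} ‖Du‖² ≥ π d² log(R/r) − C`, where `‖Du‖²` is the squared
Frobenius norm `‖Du(1)‖² + ‖Du(I)‖²` of the real Fréchet derivative. -/
theorem interior_vortex_lower_bound (d : ℤ) (C₂ : ℝ) (hC₂ : 0 ≤ C₂) :
    ∃ C : ℝ, ∀ (r R ε : ℝ) (u : ℂ → ℂ),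
      0 < r → r < R → 0 < ε → ε ≤ r →
      (∃ U : Set ℂ, IsOpen U ∧ {z : ℂ | r ≤ ‖z‖ ∧ ‖z‖ ≤ R} ⊆ U ∧
        ContDiffOn ℝ 1 u U) →
      (∀ z : ℂ, r ≤ ‖z‖ → ‖z‖ ≤ R → 1 / 2 ≤ ‖u z‖ ∧ ‖u z‖ ≤ 1) →
      (1 / (2 * ε ^ 2)) *
          (∫ z in {z : ℂ | r < ‖z‖ ∧ ‖z‖ < R}, (1 - ‖u z‖ ^ 2) ^ 2) ≤ C₂ →
      (∀ s ∈ Set.Icc r R,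
        (1 / (2 * Real.pi)) * (∫ θ in (0 : ℝ)..(2 * Real.pi),
          ((Complex.I * u ((s : ℂ) * Complex.exp (Complex.I * (θ : ℂ)))).re *
              (deriv (fun t : ℝ =>
                u ((s : ℂ) * Complex.exp (Complex.I * (t : ℂ)))) θ).re +
            (Complex.I * u ((s : ℂ) * Complex.exp (Complex.I * (θ : ℂ)))).im *
              (deriv (fun t : ℝ =>
                u ((s : ℂ) * Complex.exp (Complex.I * (t : ℂ)))) θ).im) /
            ‖u ((s : ℂ) * Complex.exp (Complex.I * (θ : ℂ)))‖ ^ 2) = (d : ℝ)) →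
      Real.pi * (d : ℝ) ^ 2 * Real.log (R / r) - C ≤
        (1 / 2) * ∫ z in {z : ℂ | r < ‖z‖ ∧ ‖z‖ < R},
          (‖fderiv ℝ u z 1‖ ^ 2 + ‖fderiv ℝ u z Complex.I‖ ^ 2) := by
  refine ⟨(d : ℝ) ^ 2 * (2 * C₂ + Real.pi), ?_⟩
  rintro r R ε u hr hrR hε hεr ⟨U, hU, hKU, hu⟩ hbd hpot hdeg
  set K : Set ℂ := {z : ℂ | r ≤ ‖z‖ ∧ ‖z‖ ≤ R} with hK
  set A : Set ℂ := {z : ℂ | r < ‖z‖ ∧ ‖z‖ < R}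
  have hAK : A ⊆ K := fun z hz => ⟨hz.1.le, hz.2.le⟩
  have hAm : MeasurableSet A :=
    ((isOpen_lt continuous_const continuous_norm).inter
      (isOpen_lt continuous_norm continuous_const)).measurableSet
  have hKc : IsCompact K := by
    refine (isCompact_closedBall (0 : ℂ) R).of_isClosed_subset
      ((isClosed_le continuous_const continuous_norm).inter
        (isClosed_le continuous_norm continuous_const)) fun z hz => ?_
    simpa using hz.2
  have hint : ∀ {g : ℂ → ℝ}, ContinuousOn g K → IntegrableOn g A := fun hg =>
    (hg.integrableOn_compact hKc).mono_set hAK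
  have huK : ContinuousOn u K := hu.continuousOn.mono hKU
  have hDu : ContinuousOn (fderiv ℝ u) K :=
    (hu.continuousOn_fderiv_of_isOpen hU le_rfl).mono hKU
  have hz0 : ∀ z ∈ K, ‖z‖ ≠ 0 := fun z hz => (hr.trans_le hz.1).ne'
  have hψ : ContinuousOn (angularCurrent u) K := by
    have hv : ContinuousOn (fun z => fderiv ℝ u z (Complex.I * z)) K :=
      hDu.clm_apply (by fun_prop)
    have hw : ContinuousOn (fun z => Complex.I * u z) K := continuousOn_const.mul huK
    refine ContinuousOn.div ?_ (huK.norm.pow 2) fun z hz => ?_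
    · exact ((Complex.continuous_re.comp_continuousOn hw).mul
        (Complex.continuous_re.comp_continuousOn hv)).add
        ((Complex.continuous_im.comp_continuousOn hw).mul
          (Complex.continuous_im.comp_continuousOn hv))
    · have := (hbd z hz.1 hz.2).1
      positivity
  have hcirc : ∀ s ∈ Set.Icc r R, ∫ θ in (0 : ℝ)..(2 * Real.pi),
      angularCurrent u ((s : ℂ) * Complex.exp (Complex.I * (θ : ℂ))) = 2 * Real.pi * d := by
    intro s hs
    rw [← hdeg s hs, ← mul_assoc, mul_one_div_cancel (by positivity), one_mul]
    refine intervalIntegral.integral_congr fun θ _ => ?_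
    have hmem : (s : ℂ) * Complex.exp (Complex.I * (θ : ℂ)) ∈ U := hKU (by
      rw [hK, Set.mem_ofPred_eq, norm_real_mul_exp_I (hr.le.trans hs.1)]
      exact hs)
    simp only [angularCurrent]
    rw [deriv_comp_circle ((hu.differentiableOn one_ne_zero).differentiableAt
      (hU.mem_nhds hmem))]
  have hi1 : ContinuousOn (fun z => angularCurrent u z / ‖z‖ ^ 2) K :=
    hψ.div (by fun_prop) fun z hz => pow_ne_zero _ (hz0 z hz)
  have hi2 : ContinuousOn (fun z : ℂ => 1 / ‖z‖ ^ 2) K :=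
    continuousOn_const.div (by fun_prop) fun z hz => pow_ne_zero _ (hz0 z hz)
  have hi3 : ContinuousOn (fun z => (1 - ‖u z‖ ^ 2) ^ 2) K :=
    (continuousOn_const.sub (huK.norm.pow 2)).pow 2
  have hi4 : ContinuousOn (fun z : ℂ => 1 / ‖z‖ ^ 4) K :=
    continuousOn_const.div (by fun_prop) fun z hz => pow_ne_zero _ (hz0 z hz)
  have hiE : ContinuousOn (fun z => ‖fderiv ℝ u z 1‖ ^ 2 + ‖fderiv ℝ u z Complex.I‖ ^ 2) K :=
    ((hDu.clm_apply continuousOn_const).norm.pow 2).add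
      ((hDu.clm_apply continuousOn_const).norm.pow 2)
  have j1 := (hint hi1).const_mul (2 * (d : ℝ))
  have j2 := (hint hi2).const_mul ((d : ℝ) ^ 2)
  have j3 := (hint hi3).const_mul (2 * (d : ℝ) ^ 2 / ε ^ 2)
  have j4 := (hint hi4).const_mul (2 * (d : ℝ) ^ 2 * ε ^ 2)
  have hmono := setIntegral_mono_on (((j1.sub j2).sub j3).sub j4) (hint hiE) hAm fun z hz =>
    angularCurrent_le_energyDensity u z (norm_ne_zero_iff.mp (hz0 z (hAK hz)))
      (hbd z hz.1.le hz.2.le).1 (hbd z hz.1.le hz.2.le).2 (d : ℝ) hε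
  rw [integral_sub' ((j1.sub j2).sub j3) j4, integral_sub' (j1.sub j2) j3, integral_sub' j1 j2,
    integral_const_mul, integral_const_mul, integral_const_mul, integral_const_mul] at hmono
  have e1 := setIntegral_annulus_div_norm_sq hr hrR hψ hcirc
  have e2 := setIntegral_annulus_div_norm_sq hr hrR (g := fun _ => 1) continuousOn_const
    (c := 2 * Real.pi) (by intro s _; simp)
  have e4 := setIntegral_annulus_inv_norm_pow_four_le hr hrR
  have e3 : 2 * (d : ℝ) ^ 2 / ε ^ 2 * (∫ z in A, (1 - ‖u z‖ ^ 2) ^ 2) ≤ 4 * (d : ℝ) ^ 2 * C₂ := by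
    have h := mul_le_mul_of_nonneg_left hpot (show 0 ≤ 4 * (d : ℝ) ^ 2 by positivity)
    refine le_of_eq_of_le ?_ h
    field_simp
    ring
  have e4' : 2 * (d : ℝ) ^ 2 * ε ^ 2 * (∫ z in A, 1 / ‖z‖ ^ 4) ≤ 2 * (d : ℝ) ^ 2 * Real.pi := by
    have hεr2 : ε ^ 2 * (Real.pi / r ^ 2) ≤ Real.pi := by
      rw [← mul_div_assoc, div_le_iff₀ (by positivity), mul_comm]
      gcongr
    calc _ ≤ 2 * (d : ℝ) ^ 2 * ε ^ 2 * (Real.pi / r ^ 2) := by gcongr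
      _ = 2 * (d : ℝ) ^ 2 * (ε ^ 2 * (Real.pi / r ^ 2)) := by ring
      _ ≤ _ := by gcongr
  rw [e1, e2] at hmono
  linarith
end

section
/- Let D ≥ 1 be an integer, α ∈ (0, 1], K > 0, and R > 1. Then there exists a constant C such that for every ε ∈ (0, 1) there is a Lipschitz map u : {x ∈ ℂ : 1 ≤ ‖x‖ ≤ R} → ℂ with u(x) = 1 whenever ‖x‖ = R, satisfying (1/2) ∫_{1 < ‖x‖ < R} ( ‖Du(x)‖² + (1/(2ε²)) (‖u(x)‖² − 1)² ) dx + (K ε^{−α}/2) ∫_0^{2π} ‖u(e^{iθ}) − e^{iDθ}‖² dθ ≤ π · min{2α, 1} · D · log(1/ε) + C, where Du denotes the (almost everywhere defined) real Fréchet derivative of u, ‖Du‖ its Hilbert–Schmidt norm, and the area integral is with respect to two-dimensional Lebesgue measure. -/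
open MeasureTheory

theorem integral_inv_add_mul_cos {a b : ℝ} (hb : 0 ≤ b) (hab : b < a) :
    ∫ φ in (0 : ℝ)..(2 * Real.pi), (a + b * Real.cos φ)⁻¹ =
      2 * Real.pi / √(a ^ 2 - b ^ 2) := by
  have hd : 0 < a ^ 2 - b ^ 2 := by nlinarith
  set w := √(a ^ 2 - b ^ 2) with hw
  have hw0 : 0 < w := Real.sqrt_pos.2 hd
  have hw2 : w ^ 2 = a ^ 2 - b ^ 2 := Real.sq_sqrt hd.le
  set q : ℝ := b / (a + w) with hq
  have haw : 0 < a + w := by linarith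
  have hqa : q * (a + w) = b := by rw [hq]; field_simp
  have hq0 : 0 ≤ q := by positivity
  have hq1 : q < 1 := by rw [hq, div_lt_one haw]; linarith
  have hmem : (-(q : ℂ)) ∈ Metric.ball (0 : ℂ) 1 := by
    simp [abs_of_nonneg hq0, hq1]
  have key := DiffContOnCl.circleAverage_re_herglotzRieszKernel_smul (f := fun _ : ℂ => (1 : ℂ))
    (c := 0) (R := 1) (w := -(q : ℂ)) (by exact diffContOnCl_const) hmem
  rw [← poissonKernel_eq_re_herglotzRieszKernel, Real.circleAverage_def] at key
  have hpt : ∀ φ : ℝ, (poissonKernel 0 (-(q : ℂ)) • fun _ : ℂ => (1 : ℂ)) (circleMap 0 1 φ)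
      = ((w * (a + b * Real.cos φ)⁻¹ : ℝ) : ℂ) := by
    intro φ
    have h1 : ‖circleMap 0 1 φ + (q : ℂ)‖ ^ 2 = 1 + q ^ 2 + 2 * q * Real.cos φ := by
      rw [← Complex.normSq_eq_norm_sq, circleMap, Complex.exp_mul_I, ← Complex.ofReal_cos,
        ← Complex.ofReal_sin, Complex.normSq_apply]
      simp only [Complex.add_re, Complex.add_im, Complex.mul_re, Complex.mul_im,
        Complex.ofReal_re, Complex.ofReal_im, Complex.zero_re, Complex.zero_im, Complex.I_re,
        Complex.I_im, Complex.ofReal_one, Complex.one_re, Complex.one_im]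
      nlinarith [Real.sin_sq_add_cos_sq φ]
    have h2 : 0 < a + b * Real.cos φ := by
      nlinarith [Real.neg_one_le_cos φ]
    have h4 : (a + w) / 2 * (1 + q ^ 2) = a := by
      have : (a + w) ^ 2 + b ^ 2 = 2 * a * (a + w) := by nlinarith
      rw [← hqa] at this
      have h5 : (a + w) * ((a + w) / 2 * (1 + q ^ 2)) = (a + w) * a := by nlinarith
      exact mul_left_cancel₀ haw.ne' h5
    have h3 : a + b * Real.cos φ = (a + w) / 2 * (1 + q ^ 2 + 2 * q * Real.cos φ) := by
      rw [← hqa]; linear_combination -h4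
    have h6 : (a + w) / 2 * (1 - q ^ 2) = w := by linear_combination -h4
    have h7 : 0 < 1 + q ^ 2 + 2 * q * Real.cos φ := by
      rw [h3] at h2
      exact (mul_pos_iff_of_pos_left (by positivity)).1 h2
    simp only [Pi.smul_apply', poissonKernel_def, sub_zero, sub_neg_eq_add, h1]
    simp only [Complex.real_smul, mul_one, norm_circleMap_zero, norm_neg, Complex.norm_real,
      Real.norm_eq_abs, sq_abs]
    congr 1
    rw [h3, ← div_eq_mul_inv, div_eq_div_iff h7.ne' (by positivity)]
    linear_combination (1 + q ^ 2 + 2 * q * Real.cos φ) * h6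
  simp_rw [hpt] at key
  rw [Complex.real_smul, intervalIntegral.integral_ofReal, intervalIntegral.integral_const_mul] at key
  have key' : (2 * Real.pi)⁻¹ * (w * ∫ φ in (0 : ℝ)..(2 * Real.pi), (a + b * Real.cos φ)⁻¹) = 1 := by
    exact_mod_cast key
  field_simp at key' ⊢
  linarith

theorem integral_inv_add_mul_cos_nat_mul {a b : ℝ} (hb : 0 ≤ b) (hab : b < a) {D : ℕ}
    (hD : D ≠ 0) :
    ∫ θ in (-Real.pi)..Real.pi, (a + b * Real.cos (D * θ))⁻¹ =
      2 * Real.pi / √(a ^ 2 - b ^ 2) := by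
  have hper : Function.Periodic (fun φ : ℝ => (a + b * Real.cos φ)⁻¹) (2 * Real.pi) := by
    intro φ; simp
  have hcont : Continuous (fun φ : ℝ => (a + b * Real.cos φ)⁻¹) := by
    refine Continuous.inv₀ (by fun_prop) fun φ => ?_
    nlinarith [Real.neg_one_le_cos φ]
  have hD' : (D : ℝ) ≠ 0 := by exact_mod_cast hD
  have h1 := intervalIntegral.integral_comp_mul_left (a := -Real.pi) (b := Real.pi)
    (fun φ : ℝ => (a + b * Real.cos φ)⁻¹) hD'
  have h2 := hper.intervalIntegral_add_zsmul_eq (D : ℤ) (D * -Real.pi)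
    (fun t₁ t₂ => hcont.intervalIntegrable t₁ t₂)
  have h3 : (D : ℝ) * -Real.pi + (D : ℤ) • (2 * Real.pi) = D * Real.pi := by
    simp; ring
  rw [h3, hper.intervalIntegral_add_eq _ 0, zero_add, integral_inv_add_mul_cos hb hab] at h2
  rw [h1, h2]
  simp only [zsmul_eq_mul, smul_eq_mul]
  push_cast
  field_simp

theorem exists_lipschitzOnWith_of_contDiffAt {s : Set ℂ} (hs : IsCompact s) {u : ℂ → ℂ}
    (hu : ∀ z ∈ s, ContDiffAt ℝ 1 u z) : ∃ L : NNReal, LipschitzOnWith L u s := by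
  refine LocallyLipschitzOn.exists_lipschitzOnWith_of_compact hs fun z hz => ?_
  obtain ⟨K, t, ht, hK⟩ := (hu z hz).exists_lipschitzOnWith
  exact ⟨K, t, mem_nhdsWithin_of_mem_nhds ht, hK⟩

theorem norm_sq_map_add_norm_sq_map_I_mul (L : ℂ →L[ℝ] ℂ) (z : ℂ) :
    ‖L z‖ ^ 2 + ‖L (Complex.I * z)‖ ^ 2 = ‖z‖ ^ 2 * (‖L 1‖ ^ 2 + ‖L Complex.I‖ ^ 2) := by
  have h1 : L z = z.re • L 1 + z.im • L Complex.I := by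
    rw [← L.map_smul, ← L.map_smul, ← L.map_add]
    congr 1
    apply Complex.ext <;> simp
  have h2 : L (Complex.I * z) = (-z.im) • L 1 + z.re • L Complex.I := by
    rw [← L.map_smul, ← L.map_smul, ← L.map_add]
    congr 1
    apply Complex.ext <;> simp
  rw [h1, h2]
  simp only [← Complex.normSq_eq_norm_sq, Complex.normSq_apply]
  simp
  ring

theorem isCompact_annulus (R : ℝ) : IsCompact {x : ℂ | 1 ≤ ‖x‖ ∧ ‖x‖ ≤ R} := by
  refine (isCompact_closedBall (0 : ℂ) R).of_isClosed_subset
    ((isClosed_le continuous_const continuous_norm).inter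
      (isClosed_le continuous_norm continuous_const)) fun x hx => ?_
  simpa using hx.2

/-- Integration over an annulus in logarithmic polar coordinates, in the form of an upper bound. -/
theorem setIntegral_annulus_le {R : ℝ} (hR : 1 < R) {e : ℂ → ℝ}
    (he : ContinuousOn e {x : ℂ | 1 ≤ ‖x‖ ∧ ‖x‖ ≤ R}) {Ψ : ℝ → ℝ}
    (hΨ : ContinuousOn Ψ (Set.Icc 0 (Real.log R)))
    (hle : ∀ s ∈ Set.Icc 0 (Real.log R), ∫ θ in (-Real.pi)..Real.pi,
      Real.exp s ^ 2 * e (Complex.exp (s + θ * Complex.I)) ≤ Ψ s) :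
    ∫ x in {x : ℂ | 1 < ‖x‖ ∧ ‖x‖ < R}, e x ≤ ∫ s in (0 : ℝ)..Real.log R, Ψ s := by
  have hR0 : 0 < R := by linarith
  set Ω : Set ℂ := {x : ℂ | 1 < ‖x‖ ∧ ‖x‖ < R} with hΩ
  have hΩm : MeasurableSet Ω :=
    ((isOpen_lt continuous_const continuous_norm).inter
      (isOpen_lt continuous_norm continuous_const)).measurableSet
  rw [← integral_indicator hΩm, ← Complex.integral_comp_polarCoord_symm]
  have hT : MeasurableSet (Set.Ioo 1 R ×ˢ Set.Ioo (-Real.pi) Real.pi) :=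
    measurableSet_Ioo.prod measurableSet_Ioo
  have hsub : Set.Ioo 1 R ×ˢ Set.Ioo (-Real.pi) Real.pi ⊆ polarCoord.target := by
    rintro ⟨r, θ⟩ ⟨h1, h2⟩
    exact ⟨lt_trans one_pos h1.1, h2⟩
  have hcongr : Set.EqOn (fun p : ℝ × ℝ => p.1 • Ω.indicator e (Complex.polarCoord.symm p))
      ((Set.Ioo 1 R ×ˢ Set.Ioo (-Real.pi) Real.pi).indicator
        fun p => p.1 * e (p.1 * Complex.exp (p.2 * Complex.I))) polarCoord.target := by
    rintro ⟨r, θ⟩ ⟨h1, h2⟩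
    have hr : 0 < r := h1
    have hz : Complex.polarCoord.symm (r, θ) = r * Complex.exp (θ * Complex.I) := by
      rw [Complex.polarCoord_symm_apply, Complex.exp_mul_I]; simp
    have hn : ‖(r : ℂ) * Complex.exp (θ * Complex.I)‖ = r := by simp [abs_of_pos hr]
    simp only [hz]
    by_cases hmem : r ∈ Set.Ioo 1 R
    · rw [Set.indicator_of_mem, Set.indicator_of_mem]
      · simp
      · exact ⟨hmem, h2⟩
      · rw [hΩ]; simp only [Set.mem_ofPred_eq, hn]; exact hmem
    · rw [Set.indicator_of_notMem, Set.indicator_of_notMem]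
      · simp
      · exact fun h => hmem h.1
      · rw [hΩ]; simp only [Set.mem_ofPred_eq, hn]; exact hmem
  rw [setIntegral_congr_fun polarCoord.open_target.measurableSet hcongr,
    setIntegral_indicator hT, Set.inter_eq_self_of_subset_right hsub]
  have hc : ContinuousOn (fun p : ℝ × ℝ => p.1 * e (p.1 * Complex.exp (p.2 * Complex.I)))
      (Set.Icc 1 R ×ˢ Set.Icc (-Real.pi) Real.pi) := by
    refine ContinuousOn.mul (by fun_prop) (he.comp (by fun_prop) ?_)
    rintro ⟨r, θ⟩ ⟨h1, h2⟩
    have hr : 0 < r := lt_of_lt_of_le one_pos h1.1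
    have hn : ‖(r : ℂ) * Complex.exp (θ * Complex.I)‖ = r := by simp [abs_of_pos hr]
    simp only [Set.mem_ofPred_eq, hn]
    exact h1
  have hInt : IntegrableOn (fun p : ℝ × ℝ => p.1 * e (p.1 * Complex.exp (p.2 * Complex.I)))
      (Set.Icc 1 R ×ˢ Set.Icc (-Real.pi) Real.pi) :=
    hc.integrableOn_compact (isCompact_Icc.prod isCompact_Icc)
  have hInt' := hInt.mono_set (Set.prod_mono (Set.Ioo_subset_Icc_self (a := (1:ℝ)) (b := R))
    (Set.Ioo_subset_Icc_self (a := -Real.pi) (b := Real.pi)))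
  have hpi : -Real.pi ≤ Real.pi := by linarith [Real.pi_pos]
  rw [Measure.volume_eq_prod] at hInt' ⊢
  rw [setIntegral_prod _ hInt']
  have hsubst := intervalIntegral.integral_comp_mul_deriv'' (a := 1) (b := R)
    (f := Real.log) (f' := fun r => r⁻¹) (g := Ψ)
    (by
      rw [Set.uIcc_of_le hR.le]
      exact Real.continuousOn_log.mono fun x hx => (lt_of_lt_of_le one_pos hx.1).ne')
    (fun x hx => by
      rw [min_eq_left hR.le, max_eq_right hR.le] at hx
      exact (Real.hasDerivAt_log (by linarith [hx.1])).hasDerivWithinAt)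
    (by
      rw [Set.uIcc_of_le hR.le]
      exact continuousOn_inv₀.mono fun x hx => (lt_of_lt_of_le one_pos hx.1).ne')
    (by
      rw [Set.uIcc_of_le hR.le]
      refine hΨ.mono ?_
      rintro _ ⟨x, hx, rfl⟩
      exact ⟨Real.log_nonneg hx.1, Real.log_le_log (lt_of_lt_of_le one_pos hx.1) hx.2⟩)
  rw [Real.log_one] at hsubst
  rw [← hsubst, intervalIntegral.integral_of_le hR.le, integral_Ioc_eq_integral_Ioo]
  have hΨc : ContinuousOn (fun r => (Ψ ∘ Real.log) r * r⁻¹) (Set.Icc 1 R) := by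
    refine ContinuousOn.mul (hΨ.comp ?_ ?_) ?_
    · exact Real.continuousOn_log.mono fun x hx => (lt_of_lt_of_le one_pos hx.1).ne'
    · intro x hx
      exact ⟨Real.log_nonneg hx.1, Real.log_le_log (lt_of_lt_of_le one_pos hx.1) hx.2⟩
    · exact continuousOn_inv₀.mono fun x hx => (lt_of_lt_of_le one_pos hx.1).ne'
  refine setIntegral_mono_on ?_ ?_ measurableSet_Ioo fun r hr => ?_
  · have := hInt'
    rw [IntegrableOn, ← Measure.prod_restrict] at this
    exact this.integral_prod_left
  · exact (hΨc.integrableOn_Icc).mono_set Set.Ioo_subset_Icc_self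
  · have hr0 : 0 < r := lt_trans one_pos hr.1
    have h := hle (Real.log r) ⟨Real.log_nonneg hr.1.le, Real.log_le_log hr0 hr.2.le⟩
    rw [Real.exp_log hr0] at h
    have h2 : ∀ θ : ℝ, Complex.exp ((Real.log r : ℝ) + θ * Complex.I)
        = r * Complex.exp (θ * Complex.I) := by
      intro θ
      rw [Complex.exp_add, ← Complex.ofReal_exp, Real.exp_log hr0]
    simp only [h2] at h
    rw [intervalIntegral.integral_const_mul, intervalIntegral.integral_of_le hpi,
      integral_Ioc_eq_integral_Ioo] at h
    rw [integral_const_mul]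
    simp only [Function.comp]
    rw [← div_eq_mul_inv, le_div_iff₀ hr0]
    nlinarith

open scoped ComplexConjugate in
theorem exists_hasDerivAt_div_conj {f : ℝ → ℂ} {f' : ℂ} {t : ℝ} (hf : HasDerivAt f f' t)
    (h0 : f t ≠ 0) :
    ∃ v, HasDerivAt (fun t => f t / conj (f t)) v t ∧
      ‖v‖ ^ 2 = 4 * ((conj (f t) * f').im) ^ 2 / Complex.normSq (f t) ^ 2 := by
  have hc : conj (f t) ≠ 0 := by simpa using h0
  have hfc : HasDerivAt (fun t => conj (f t)) (conj f') t := hf.star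
  refine ⟨_, hf.div hfc hc, ?_⟩
  have h1 : f' * conj (f t) - f t * conj f' =
      ((2 * (conj (f t) * f').im : ℝ) : ℂ) * Complex.I := by
    apply Complex.ext <;> simp <;> ring
  rw [h1]
  simp only [norm_div, norm_mul, norm_pow, Complex.norm_I, Complex.norm_real, RCLike.norm_conj,
    Complex.normSq_eq_norm_sq, mul_one, div_pow, Real.norm_eq_abs]
  rw [mul_pow, sq_abs, sq_abs]
  norm_num

open scoped ComplexConjugate in
theorem exists_hasDerivAt_div_sqrt {f : ℝ → ℂ} {f' : ℂ} {h : ℝ → ℝ} {h' t : ℝ}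
    (hf : HasDerivAt f f' t) (hh : HasDerivAt h h' t) (h0 : 0 ≤ h t)
    (hN : 0 < Complex.normSq (f t) + h t) :
    ∃ v, HasDerivAt (fun t => f t / (√(Complex.normSq (f t) + h t) : ℂ)) v t ∧
      ‖v‖ ^ 2 ≤ ((conj (f t) * f').im) ^ 2 /
          (Complex.normSq (f t) * (Complex.normSq (f t) + h t)) +
        (2 * ‖f'‖ * h t + ‖f t‖ * |h'|) ^ 2 / (4 * (Complex.normSq (f t) + h t) ^ 3) := by
  set p : ℝ := (conj (f t) * f').re with hp
  set q : ℝ := (conj (f t) * f').im with hq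
  set N : ℝ := Complex.normSq (f t) + h t with hNdef
  have hre : HasDerivAt (fun t => (f t).re) f'.re t := by
    exact (Complex.reCLM.hasFDerivAt (x := f t)).comp_hasDerivAt t hf
  have him : HasDerivAt (fun t => (f t).im) f'.im t := by
    exact (Complex.imCLM.hasFDerivAt (x := f t)).comp_hasDerivAt t hf
  have hns : HasDerivAt (fun t => Complex.normSq (f t) + h t) (2 * p + h') t := by
    have h1 := ((hre.mul hre).add (him.mul him)).add hh
    refine (h1.congr_deriv ?_).congr_of_eventuallyEq (Filter.Eventually.of_forall fun x => ?_)
    · rw [hp]; simp; ring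
    · simp [Complex.normSq_apply]
  have hs := hns.sqrt hN.ne'
  have hsN : √N ≠ 0 := (Real.sqrt_pos.2 hN).ne'
  have hsN2 : √N ^ 2 = N := Real.sq_sqrt hN.le
  refine ⟨_, hf.div hs.ofReal_comp (by exact_mod_cast hsN), ?_⟩
  rw [← hNdef]
  have hv : ‖(f' * (√N : ℂ) - f t * (((2 * p + h') / (2 * √N) : ℝ) : ℂ)) / (√N : ℂ) ^ 2‖ ^ 2 =
      Complex.normSq (f' - (((2 * p + h') / (2 * N) : ℝ) : ℂ) * f t) / N := by
    have e1 : (f' * (√N : ℂ) - f t * (((2 * p + h') / (2 * √N) : ℝ) : ℂ)) / (√N : ℂ) ^ 2 =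
        (f' - (((2 * p + h') / (2 * N) : ℝ) : ℂ) * f t) / (√N : ℂ) := by
      have : (√N : ℂ) ≠ 0 := by exact_mod_cast hsN
      have h3 : (N : ℂ) = (√N : ℂ) ^ 2 := by exact_mod_cast hsN2.symm
      push_cast
      rw [h3]
      field_simp
    rw [e1, norm_div, div_pow, ← Complex.normSq_eq_norm_sq, Complex.norm_real,
      Real.norm_eq_abs, sq_abs, hsN2]
  rw [hv]
  by_cases hf0 : f t = 0
  · have hNh : N = h t := by rw [hNdef, hf0]; simp
    have hh0 : 0 < h t := by rw [← hNh]; exact hN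
    simp only [hf0, hNh, Complex.normSq_eq_norm_sq]
    simp
    field_simp
    linarith
  · have hρ : 0 < Complex.normSq (f t) := Complex.normSq_pos.2 hf0
    have hnf : ‖f t‖ ^ 2 = Complex.normSq (f t) := (Complex.normSq_eq_norm_sq _).symm
    have hnf0 : 0 < ‖f t‖ := norm_pos_iff.2 hf0
    have e2 : Complex.normSq (f' - (((2 * p + h') / (2 * N) : ℝ) : ℂ) * f t) =
        q ^ 2 / Complex.normSq (f t) +
          (p - (2 * p + h') / (2 * N) * Complex.normSq (f t)) ^ 2 / Complex.normSq (f t) := by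
      generalize (2 * p + h') / (2 * N) = c
      field_simp
      rw [hp, hq]
      simp only [Complex.normSq_apply, Complex.sub_re, Complex.sub_im, Complex.mul_re,
        Complex.mul_im, Complex.conj_re, Complex.conj_im, Complex.ofReal_re, Complex.ofReal_im]
      ring
    have e3 : p - (2 * p + h') / (2 * N) * Complex.normSq (f t) =
        (2 * p * h t - h' * Complex.normSq (f t)) / (2 * N) := by
      field_simp
      rw [hNdef]; ring
    have hp1 : |p| ≤ ‖f t‖ * ‖f'‖ := by
      rw [hp]; refine (Complex.abs_re_le_norm _).trans ?_
      simp
    have e4 : (2 * p * h t - h' * Complex.normSq (f t)) ^ 2 ≤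
        (‖f t‖ * (2 * ‖f'‖ * h t + ‖f t‖ * |h'|)) ^ 2 := by
      have h5 : |2 * p * h t - h' * Complex.normSq (f t)| ≤
          ‖f t‖ * (2 * ‖f'‖ * h t + ‖f t‖ * |h'|) := by
        refine (abs_sub _ _).trans ?_
        rw [abs_mul, abs_mul, abs_mul, abs_of_nonneg h0, abs_of_pos hρ, ← hnf, abs_two]
        nlinarith [mul_le_mul_of_nonneg_right hp1 h0]
      rw [← sq_abs]
      gcongr
    rw [e2, e3, add_div]
    refine add_le_add (le_of_eq (by rw [div_div])) ?_
    have e5 : ((2 * p * h t - h' * Complex.normSq (f t)) / (2 * N)) ^ 2 / Complex.normSq (f t) / N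
        = (2 * p * h t - h' * Complex.normSq (f t)) ^ 2 /
          (4 * N ^ 3 * Complex.normSq (f t)) := by
      field_simp; ring
    rw [e5, div_le_div_iff₀ (by positivity) (by positivity)]
    calc _ ≤ (‖f t‖ * (2 * ‖f'‖ * h t + ‖f t‖ * |h'|)) ^ 2 * (4 * N ^ 3) := by gcongr
      _ = _ := by rw [mul_pow, hnf]; ring

/-- The radial amplitude of the vortex profile. -/
noncomputable def vortexAmp (D ℓ x : ℝ) : ℝ := (1 - (x / ℓ) ^ 3) * Real.exp (-(D * x / 2))

/-- The derivative of `vortexAmp`. -/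
noncomputable def vortexAmpDeriv (D ℓ x : ℝ) : ℝ :=
  (-(3 * x ^ 2 / ℓ ^ 3) - D / 2 * (1 - (x / ℓ) ^ 3)) * Real.exp (-(D * x / 2))

/-- The vortex profile in logarithmic polar coordinates. -/
noncomputable def vortexPolar (D ℓ x φ : ℝ) : ℂ :=
  vortexAmp D ℓ x * Complex.exp (φ * Complex.I) + vortexAmp D ℓ (-x)

theorem hasDerivAt_vortexAmp (D ℓ x : ℝ) :
    HasDerivAt (vortexAmp D ℓ) (vortexAmpDeriv D ℓ x) x := by
  have h1 : HasDerivAt (fun x : ℝ => 1 - (x / ℓ) ^ 3) (-(3 * (x / ℓ) ^ 2 * (1 / ℓ))) x := by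
    simpa using (((hasDerivAt_id x).div_const ℓ).pow 3).const_sub 1
  have h2 : HasDerivAt (fun x : ℝ => -(D * x / 2)) (-(D / 2)) x := by
    exact ((((hasDerivAt_id x).const_mul D).div_const 2).neg).congr_deriv (by ring)
  refine (h1.mul h2.exp).congr_deriv ?_
  unfold vortexAmpDeriv
  ring

theorem contDiff_vortexAmp (D ℓ : ℝ) : ContDiff ℝ 1 (vortexAmp D ℓ) := by
  unfold vortexAmp
  fun_prop

section
variable {D ℓ x : ℝ}

theorem abs_div_cube_le_one (hℓ : 0 < ℓ) (hx : |x| ≤ ℓ) : |(x / ℓ) ^ 3| ≤ 1 := by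
  rw [abs_pow, abs_div, abs_of_pos hℓ]
  exact pow_le_one₀ (by positivity) ((div_le_one hℓ).2 hx)

theorem vortexAmp_nonneg (hℓ : 0 < ℓ) (hx : |x| ≤ ℓ) : 0 ≤ vortexAmp D ℓ x :=
  mul_nonneg (by linarith [(abs_le.1 (abs_div_cube_le_one hℓ hx)).2]) (Real.exp_nonneg _)

theorem vortexAmp_mul_neg : vortexAmp D ℓ x * vortexAmp D ℓ (-x) = 1 - ((x / ℓ) ^ 3) ^ 2 := by
  have h : Real.exp (-(D * x / 2)) * Real.exp (-(D * -x / 2)) = 1 := by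
    rw [← Real.exp_add]; simp; ring
  unfold vortexAmp
  linear_combination (1 - ((x / ℓ) ^ 3) ^ 2) * h

theorem vortexAmp_le_one (hD : 0 ≤ D) (hℓ : 0 < ℓ) (hx : 0 ≤ x) (hxℓ : x ≤ ℓ) :
    vortexAmp D ℓ x ≤ 1 := by
  have h1 : 0 ≤ (x / ℓ) ^ 3 := by positivity
  have h2 : (x / ℓ) ^ 3 ≤ 1 := pow_le_one₀ (by positivity) ((div_le_one hℓ).2 hxℓ)
  have h3 : Real.exp (-(D * x / 2)) ≤ 1 := by
    rw [Real.exp_le_one_iff]; have := mul_nonneg hD hx; linarith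
  exact mul_le_one₀ (by linarith) (Real.exp_nonneg _) h3

theorem one_le_vortexAmp_neg (hD : 0 ≤ D) (hℓ : 0 < ℓ) (hx : 0 ≤ x) :
    1 ≤ vortexAmp D ℓ (-x) := by
  have h1 : 0 ≤ (x / ℓ) ^ 3 := by positivity
  have h3 : 1 ≤ Real.exp (-(D * -x / 2)) := by
    rw [Real.one_le_exp_iff]; have := mul_nonneg hD hx; linarith
  have h4 : (-x / ℓ) ^ 3 = -(x / ℓ) ^ 3 := by ring
  unfold vortexAmp
  rw [h4]
  nlinarith

theorem mul_le_vortexAmp_neg_sub (hD : 0 ≤ D) (hℓ : 0 < ℓ) (hx : 0 ≤ x) :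
    D * x ≤ vortexAmp D ℓ (-x) - vortexAmp D ℓ x := by
  have h1 : 0 ≤ (x / ℓ) ^ 3 := by positivity
  have h2 : 0 ≤ D * x := mul_nonneg hD hx
  have h3 := Real.self_le_sinh_iff.2 (show 0 ≤ D * x / 2 by linarith)
  rw [Real.sinh_eq] at h3
  have h4 : (-x / ℓ) ^ 3 = -(x / ℓ) ^ 3 := by ring
  have h5 : -(D * -x / 2) = D * x / 2 := by ring
  unfold vortexAmp
  rw [h4, h5]
  nlinarith [mul_nonneg h1 (Real.exp_nonneg (D * x / 2)),
    mul_nonneg h1 (Real.exp_nonneg (-(D * x / 2)))]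

theorem sq_mul_le_vortexAmp_sub_sq (hD : 0 ≤ D) (hℓ : 0 < ℓ) :
    (D * x) ^ 2 ≤ (vortexAmp D ℓ x - vortexAmp D ℓ (-x)) ^ 2 := by
  rcases le_total 0 x with hx | hx
  · have := mul_le_vortexAmp_neg_sub hD hℓ hx
    have h2 : 0 ≤ D * x := mul_nonneg hD hx
    nlinarith
  · have := mul_le_vortexAmp_neg_sub hD hℓ (neg_nonneg.2 hx)
    have h2 : 0 ≤ D * -x := mul_nonneg hD (neg_nonneg.2 hx)
    rw [neg_neg] at this
    nlinarith

theorem normSq_vortexPolar (φ : ℝ) : Complex.normSq (vortexPolar D ℓ x φ) =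
    vortexAmp D ℓ x ^ 2 + vortexAmp D ℓ (-x) ^ 2 +
      2 * (vortexAmp D ℓ x * vortexAmp D ℓ (-x)) * Real.cos φ := by
  unfold vortexPolar
  rw [Complex.exp_mul_I, ← Complex.ofReal_cos, ← Complex.ofReal_sin, Complex.normSq_apply]
  simp only [Complex.add_re, Complex.add_im, Complex.mul_re, Complex.mul_im,
    Complex.ofReal_re, Complex.ofReal_im, Complex.I_re, Complex.I_im]
  linear_combination vortexAmp D ℓ x ^ 2 * Real.sin_sq_add_cos_sq φ

theorem vortexAmp_sub_sq_le_normSq (hℓ : 0 < ℓ) (hx : |x| ≤ ℓ) (φ : ℝ) :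
    (vortexAmp D ℓ x - vortexAmp D ℓ (-x)) ^ 2 ≤ Complex.normSq (vortexPolar D ℓ x φ) := by
  have h1 := mul_nonneg (vortexAmp_nonneg (D := D) hℓ hx)
    (vortexAmp_nonneg (D := D) hℓ (by rwa [abs_neg] : |-x| ≤ ℓ))
  rw [normSq_vortexPolar]
  nlinarith [Real.neg_one_le_cos φ]

theorem sin_sq_le_normSq (hD : 0 ≤ D) (hℓ : 0 < ℓ) (φ : ℝ) :
    Real.sin φ ^ 2 ≤ Complex.normSq (vortexPolar D ℓ x φ) := by
  have h4 := Real.sin_sq_add_cos_sq φ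
  rw [normSq_vortexPolar]
  rcases le_total 0 x with hx | hx
  · have h1 := one_le_vortexAmp_neg hD hℓ hx
    generalize vortexAmp D ℓ x = A at *
    generalize vortexAmp D ℓ (-x) = B at *
    have h2 : Real.sin φ ^ 2 ≤ B ^ 2 * Real.sin φ ^ 2 :=
      le_mul_of_one_le_left (sq_nonneg _) (one_le_pow₀ h1)
    nlinarith [sq_nonneg (A + B * Real.cos φ)]
  · have h1 := one_le_vortexAmp_neg hD hℓ (neg_nonneg.2 hx)
    rw [neg_neg] at h1
    generalize vortexAmp D ℓ x = A at *
    generalize vortexAmp D ℓ (-x) = B at *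
    have h2 : Real.sin φ ^ 2 ≤ A ^ 2 * Real.sin φ ^ 2 :=
      le_mul_of_one_le_left (sq_nonneg _) (one_le_pow₀ h1)
    nlinarith [sq_nonneg (A * Real.cos φ + B)]

open scoped ComplexConjugate in
/-- The squared angular velocity of the vortex profile. -/
theorem im_sq_add_im_sq_le (hD : 0 < D) (hℓ : 0 < ℓ) (hx : |x| ≤ ℓ) (φ : ℝ) :
    (conj (vortexPolar D ℓ x φ) * (vortexAmp D ℓ x * (Complex.exp (φ * Complex.I) *
        (D * Complex.I)))).im ^ 2 +
      (conj (vortexPolar D ℓ x φ) * (vortexAmpDeriv D ℓ x * Complex.exp (φ * Complex.I) -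
        vortexAmpDeriv D ℓ (-x))).im ^ 2 ≤
    D ^ 2 * vortexAmp D ℓ x ^ 2 * Complex.normSq (vortexPolar D ℓ x φ) +
      12 / ℓ ^ 3 * (D + 3 / ℓ) / D ^ 2 * Complex.normSq (vortexPolar D ℓ x φ) ^ 2 := by
  have hAB : vortexAmp D ℓ x * vortexAmp D ℓ (-x) ≤ 1 := by
    rw [vortexAmp_mul_neg]; nlinarith [sq_nonneg ((x / ℓ) ^ 3)]
  have h1 := sin_sq_le_normSq (x := x) hD.le hℓ φ
  have h2 := (sq_mul_le_vortexAmp_sub_sq hD.le hℓ).trans (vortexAmp_sub_sq_le_normSq (D := D) hℓ hx φ)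
  have hW : vortexAmpDeriv D ℓ x * vortexAmp D ℓ (-x) + vortexAmp D ℓ x * vortexAmpDeriv D ℓ (-x)
      = -(D * (vortexAmp D ℓ x * vortexAmp D ℓ (-x)) + 2 * (3 * x ^ 2 / ℓ ^ 3)) := by
    have h : Real.exp (-(D * x / 2)) * Real.exp (-(D * -x / 2)) = 1 := by
      rw [← Real.exp_add]; simp; ring
    rw [vortexAmp_mul_neg]
    unfold vortexAmp vortexAmpDeriv
    linear_combination (-(D * (1 - ((x / ℓ) ^ 3) ^ 2) + 2 * (3 * x ^ 2 / ℓ ^ 3))) * h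
  have e1 : (conj (vortexPolar D ℓ x φ) * (vortexAmp D ℓ x * (Complex.exp (φ * Complex.I) *
        (D * Complex.I)))).im =
      D * vortexAmp D ℓ x * (vortexAmp D ℓ x + vortexAmp D ℓ (-x) * Real.cos φ) := by
    unfold vortexPolar
    rw [Complex.exp_mul_I, ← Complex.ofReal_cos, ← Complex.ofReal_sin]
    simp only [Complex.add_re, Complex.add_im, Complex.mul_re,
      Complex.mul_im, map_add, map_mul, Complex.conj_re, Complex.conj_im, Complex.ofReal_re,
      Complex.ofReal_im, Complex.I_re, Complex.I_im]
    linear_combination D * vortexAmp D ℓ x ^ 2 * Real.sin_sq_add_cos_sq φ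
  have e2 : (conj (vortexPolar D ℓ x φ) * (vortexAmpDeriv D ℓ x * Complex.exp (φ * Complex.I) -
        vortexAmpDeriv D ℓ (-x))).im =
      (vortexAmpDeriv D ℓ x * vortexAmp D ℓ (-x) + vortexAmp D ℓ x * vortexAmpDeriv D ℓ (-x)) *
        Real.sin φ := by
    unfold vortexPolar
    rw [Complex.exp_mul_I, ← Complex.ofReal_cos, ← Complex.ofReal_sin]
    simp only [Complex.add_re, Complex.add_im, Complex.sub_re, Complex.sub_im, Complex.mul_re,
      Complex.mul_im, map_add, map_mul, Complex.conj_re, Complex.conj_im, Complex.ofReal_re,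
      Complex.ofReal_im, Complex.I_re, Complex.I_im]
    ring
  rw [e1, e2, hW]
  set N := Complex.normSq (vortexPolar D ℓ x φ) with hN
  have hNe : N = _ := normSq_vortexPolar φ
  set A := vortexAmp D ℓ x
  set B := vortexAmp D ℓ (-x)
  set Q := 3 * x ^ 2 / ℓ ^ 3 with hQ
  have hQ0 : 0 ≤ Q := by positivity
  have hN0 : 0 ≤ N := Complex.normSq_nonneg _
  have e3 : (D * A * (A + B * Real.cos φ)) ^ 2 +
      (-(D * (A * B) + 2 * Q) * Real.sin φ) ^ 2 =
      D ^ 2 * A ^ 2 * N + 4 * Q * (D * (A * B) + Q) * Real.sin φ ^ 2 := by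
    rw [hNe]
    linear_combination (D ^ 2 * A ^ 2 * B ^ 2) * Real.sin_sq_add_cos_sq φ
  rw [e3]
  have hQ1 : Q ≤ 3 / ℓ := by
    rw [hQ, div_le_div_iff₀ (by positivity) hℓ]
    have : x ^ 2 ≤ ℓ ^ 2 := sq_le_sq' (by linarith [(abs_le.1 hx).1]) (abs_le.1 hx).2
    nlinarith [mul_le_mul_of_nonneg_right this hℓ.le]
  have hx2 : Q ≤ 3 / ℓ ^ 3 / D ^ 2 * N := by
    rw [hQ, div_div, div_mul_eq_mul_div, div_le_div_iff₀ (by positivity) (by positivity)]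
    nlinarith [mul_le_mul_of_nonneg_left h2 (by positivity : 0 ≤ 3 * ℓ ^ 3)]
  have h3 : 4 * Q * (D * (A * B) + Q) * Real.sin φ ^ 2 ≤
      4 * (3 / ℓ ^ 3 / D ^ 2 * N) * (D + 3 / ℓ) * N := by
    have h4 : D * (A * B) + Q ≤ D + 3 / ℓ := by nlinarith
    have h5 : 4 * Q * (D * (A * B) + Q) ≤ 4 * (3 / ℓ ^ 3 / D ^ 2 * N) * (D + 3 / ℓ) :=
      (mul_le_mul_of_nonneg_left h4 (by positivity)).trans
        (mul_le_mul_of_nonneg_right (by linarith) (by positivity))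
    exact (mul_le_mul_of_nonneg_right h5 (sq_nonneg _)).trans
      (mul_le_mul_of_nonneg_left h1 (by positivity))
  calc _ ≤ _ := add_le_add_right h3 _
    _ = _ := by ring
end

theorem exp_sq_mul_norm_fderiv_sq {u : ℂ → ℂ} {s θ : ℝ} {vs vθ : ℂ}
    (hu : DifferentiableAt ℝ u (Complex.exp (s + θ * Complex.I)))
    (hs : HasDerivAt (fun s : ℝ => u (Complex.exp (s + θ * Complex.I))) vs s)
    (hθ : HasDerivAt (fun θ : ℝ => u (Complex.exp (s + θ * Complex.I))) vθ θ) :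
    Real.exp s ^ 2 * (‖fderiv ℝ u (Complex.exp (s + θ * Complex.I)) 1‖ ^ 2 +
      ‖fderiv ℝ u (Complex.exp (s + θ * Complex.I)) Complex.I‖ ^ 2) = ‖vs‖ ^ 2 + ‖vθ‖ ^ 2 := by
  have h1 : HasDerivAt (fun s : ℝ => Complex.exp (s + θ * Complex.I))
      (Complex.exp (s + θ * Complex.I)) s := by
    simpa using ((Complex.ofRealCLM.hasDerivAt (x := s)).add_const (θ * Complex.I)).cexp
  have h2 : HasDerivAt (fun θ : ℝ => Complex.exp (s + θ * Complex.I))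
      (Complex.I * Complex.exp (s + θ * Complex.I)) θ := by
    have := (((Complex.ofRealCLM.hasDerivAt (x := θ)).mul_const Complex.I).const_add (s : ℂ)).cexp
    simpa [mul_comm] using this
  rw [hs.unique (hu.hasFDerivAt.comp_hasDerivAt s h1),
    hθ.unique (hu.hasFDerivAt.comp_hasDerivAt θ h2), norm_sq_map_add_norm_sq_map_I_mul,
    Complex.norm_exp]
  simp

theorem setIntegral_annulus_energy_le {R ε : ℝ} (hR : 1 < R) {u : ℂ → ℂ}
    (hu : ∀ z ∈ {z : ℂ | 1 ≤ ‖z‖ ∧ ‖z‖ ≤ R}, ContDiffAt ℝ 1 u z) {G : ℝ → ℝ → ℝ} {Ψ : ℝ → ℝ}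
    (hGc : ∀ s ∈ Set.Icc 0 (Real.log R), Continuous (G s))
    (hG : ∀ s ∈ Set.Icc 0 (Real.log R), ∀ θ : ℝ, ∃ vs vθ : ℂ,
      HasDerivAt (fun s : ℝ => u (Complex.exp (s + θ * Complex.I))) vs s ∧
      HasDerivAt (fun θ : ℝ => u (Complex.exp (s + θ * Complex.I))) vθ θ ∧
      ‖vs‖ ^ 2 + ‖vθ‖ ^ 2 + Real.exp s ^ 2 * ((1 / (2 * ε ^ 2)) *
        (‖u (Complex.exp (s + θ * Complex.I))‖ ^ 2 - 1) ^ 2) ≤ G s θ)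
    (hΨ : ContinuousOn Ψ (Set.Icc 0 (Real.log R)))
    (hle : ∀ s ∈ Set.Icc 0 (Real.log R), ∫ θ in (-Real.pi)..Real.pi, G s θ ≤ Ψ s) :
    ∫ x in {x : ℂ | 1 < ‖x‖ ∧ ‖x‖ < R},
      (‖fderiv ℝ u x 1‖ ^ 2 + ‖fderiv ℝ u x Complex.I‖ ^ 2
        + (1 / (2 * ε ^ 2)) * (‖u x‖ ^ 2 - 1) ^ 2) ≤ ∫ s in (0 : ℝ)..Real.log R, Ψ s := by
  have hcont : ContinuousOn (fun x => ‖fderiv ℝ u x 1‖ ^ 2 + ‖fderiv ℝ u x Complex.I‖ ^ 2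
      + (1 / (2 * ε ^ 2)) * (‖u x‖ ^ 2 - 1) ^ 2) {z : ℂ | 1 ≤ ‖z‖ ∧ ‖z‖ ≤ R} := by
    intro z hz
    have h1 := (hu z hz).continuousAt
    have h2 : ContinuousAt (fderiv ℝ u) z :=
      ((hu z hz).fderiv_right (m := 0) (by norm_num)).continuousAt
    apply ContinuousAt.continuousWithinAt
    fun_prop
  refine setIntegral_annulus_le hR hcont hΨ fun s hs => le_trans ?_ (hle s hs)
  have hmem : ∀ θ : ℝ, Complex.exp (s + θ * Complex.I) ∈ {z : ℂ | 1 ≤ ‖z‖ ∧ ‖z‖ ≤ R} := by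
    intro θ
    have h1 : ‖Complex.exp (s + θ * Complex.I)‖ = Real.exp s := by simp [Complex.norm_exp]
    rw [Set.mem_ofPred_eq, h1]
    exact ⟨Real.one_le_exp hs.1, (Real.le_log_iff_exp_le (by linarith)).1 hs.2⟩
  have hcθ : Continuous fun θ : ℝ => Real.exp s ^ 2 *
      (‖fderiv ℝ u (Complex.exp (s + θ * Complex.I)) 1‖ ^ 2
      + ‖fderiv ℝ u (Complex.exp (s + θ * Complex.I)) Complex.I‖ ^ 2
      + (1 / (2 * ε ^ 2)) * (‖u (Complex.exp (s + θ * Complex.I))‖ ^ 2 - 1) ^ 2) :=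
    continuous_const.mul (hcont.comp_continuous (by fun_prop) hmem)
  refine intervalIntegral.integral_mono_on (by linarith [Real.pi_pos])
    (hcθ.intervalIntegrable _ _) ((hGc s hs).intervalIntegrable _ _) fun θ _ => ?_
  obtain ⟨vs, vθ, h1, h2, h3⟩ := hG s hs θ
  rw [mul_add, exp_sq_mul_norm_fderiv_sq ((hu _ (hmem θ)).differentiableAt (by norm_num)) h1 h2]
  exact h3

/-- A map on the punctured plane whose zeros are the `D` points `z` with
`‖z‖ = exp c` and `z ^ D` negative. -/
noncomputable def vortexMap (D : ℕ) (ℓ c : ℝ) (z : ℂ) : ℂ :=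
  vortexAmp D ℓ (Real.log ‖z‖ - c) * (z / ‖z‖) ^ D + vortexAmp D ℓ (-(Real.log ‖z‖ - c))

theorem vortexMap_exp (D : ℕ) (ℓ c s θ : ℝ) :
    vortexMap D ℓ c (Complex.exp (s + θ * Complex.I)) = vortexPolar D ℓ (s - c) (D * θ) := by
  have h1 : ‖Complex.exp (s + θ * Complex.I)‖ = Real.exp s := by simp [Complex.norm_exp]
  unfold vortexMap vortexPolar
  rw [h1, Real.log_exp, Complex.exp_add, Complex.ofReal_exp, mul_div_cancel_left₀ _
    (Complex.exp_ne_zero _), ← Complex.exp_nat_mul]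
  push_cast
  simp [mul_assoc]

theorem exp_log_norm_add_arg {z : ℂ} (hz : z ≠ 0) :
    Complex.exp ((Real.log ‖z‖ : ℝ) + (Complex.arg z : ℝ) * Complex.I) = z := by
  rw [Complex.exp_add, ← Complex.ofReal_exp, Real.exp_log (norm_pos_iff.2 hz),
    Complex.norm_mul_exp_arg_mul_I]

theorem contDiffAt_log_norm {z : ℂ} (hz : z ≠ 0) :
    ContDiffAt ℝ 1 (fun z : ℂ => Real.log ‖z‖) z :=
  (contDiffAt_norm ℝ hz).log (norm_ne_zero_iff.2 hz)

theorem ContDiffAt.complex_div {f g : ℂ → ℂ} {z : ℂ} (hf : ContDiffAt ℝ 1 f z)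
    (hg : ContDiffAt ℝ 1 g z) (h0 : g z ≠ 0) : ContDiffAt ℝ 1 (fun z => f z / g z) z := by
  simp only [div_eq_mul_inv]
  exact hf.mul (hg.inv h0)

theorem contDiffAt_vortexMap (D : ℕ) (ℓ c : ℝ) {z : ℂ} (hz : z ≠ 0) :
    ContDiffAt ℝ 1 (vortexMap D ℓ c) z := by
  have h1 : ContDiffAt ℝ 1 (fun z : ℂ => Real.log ‖z‖ - c) z :=
    (contDiffAt_log_norm hz).sub contDiffAt_const
  have h2 : ContDiffAt ℝ 1 (fun z : ℂ => (‖z‖ : ℂ)) z :=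
    Complex.ofRealCLM.contDiff.contDiffAt.comp z (contDiffAt_norm ℝ hz)
  have h3 : ∀ {g : ℂ → ℝ}, ContDiffAt ℝ 1 g z →
      ContDiffAt ℝ 1 (fun z => (vortexAmp D ℓ (g z) : ℂ)) z :=
    fun hg => Complex.ofRealCLM.contDiff.contDiffAt.comp z
      ((contDiff_vortexAmp D ℓ).contDiffAt.comp z hg)
  have h4 : ContDiffAt ℝ 1 (fun z : ℂ => (z / ‖z‖) ^ D) z :=
    (contDiffAt_id.complex_div h2 (Complex.ofReal_ne_zero.2 (norm_ne_zero_iff.2 hz))).pow D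
  exact ((h3 h1).mul h4).add (h3 h1.neg)

theorem hasDerivAt_vortexPolar_radial (D ℓ c φ s : ℝ) :
    HasDerivAt (fun s : ℝ => vortexPolar D ℓ (s - c) φ)
      (vortexAmpDeriv D ℓ (s - c) * Complex.exp (φ * Complex.I) -
        vortexAmpDeriv D ℓ (-(s - c))) s := by
  have h1 : HasDerivAt (fun s : ℝ => (vortexAmp D ℓ (s - c) : ℂ)) (vortexAmpDeriv D ℓ (s - c)) s := by
    simpa using ((hasDerivAt_vortexAmp D ℓ (s - c)).comp s ((hasDerivAt_id s).sub_const c)).ofReal_comp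
  have h2 : HasDerivAt (fun s : ℝ => (vortexAmp D ℓ (-(s - c)) : ℂ))
      (-vortexAmpDeriv D ℓ (-(s - c))) s := by
    simpa using ((hasDerivAt_vortexAmp D ℓ (-(s - c))).comp s
      ((hasDerivAt_id s).sub_const c).neg).ofReal_comp
  exact ((h1.mul_const _).add h2).congr_deriv (by ring)

theorem hasDerivAt_vortexPolar_angular (D ℓ x θ : ℝ) :
    HasDerivAt (fun θ : ℝ => vortexPolar D ℓ x (D * θ))
      (vortexAmp D ℓ x * (Complex.exp ((D * θ : ℝ) * Complex.I) * (D * Complex.I))) θ := by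
  have h1 : HasDerivAt (fun θ : ℝ => ((D * θ : ℝ) : ℂ) * Complex.I) (D * Complex.I) θ := by
    simpa using (((hasDerivAt_id θ).const_mul D).ofReal_comp).mul_const Complex.I
  exact ((h1.cexp.const_mul _).add_const _)

theorem vortexAmp_sq_lt {D ℓ x : ℝ} (hD : 0 < D) (hℓ : 0 < ℓ) (hx : 0 < x) :
    2 * (vortexAmp D ℓ x * vortexAmp D ℓ (-x)) < vortexAmp D ℓ x ^ 2 + vortexAmp D ℓ (-x) ^ 2 := by
  have h1 := sq_mul_le_vortexAmp_sub_sq (x := x) hD.le hℓ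
  have : 0 < (D * x) ^ 2 := by positivity
  nlinarith

theorem integral_inv_normSq_vortexPolar {D : ℕ} (hD : D ≠ 0) {ℓ x : ℝ} (hx : 0 < x) (hxℓ : x ≤ ℓ) :
    ∫ θ in (-Real.pi)..Real.pi, (Complex.normSq (vortexPolar D ℓ x (D * θ)))⁻¹ =
      2 * Real.pi / ((vortexAmp D ℓ (-x) - vortexAmp D ℓ x) *
        (vortexAmp D ℓ (-x) + vortexAmp D ℓ x)) := by
  have hD0 : 0 < (D : ℝ) := by positivity
  have hℓ : 0 < ℓ := hx.trans_le hxℓ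
  have hA := vortexAmp_nonneg (D := D) hℓ (x := x) (by rwa [abs_of_pos hx])
  have hB := one_le_vortexAmp_neg hD0.le hℓ hx.le
  have hBA := mul_le_vortexAmp_neg_sub hD0.le hℓ hx.le
  have hDx : 0 < D * x := by positivity
  have h0 := vortexAmp_sq_lt hD0 hℓ hx
  simp only [normSq_vortexPolar]
  generalize vortexAmp D ℓ x = A at *
  generalize vortexAmp D ℓ (-x) = B at *
  rw [integral_inv_add_mul_cos_nat_mul (by nlinarith) h0 hD]
  congr 1
  rw [show (A ^ 2 + B ^ 2) ^ 2 - (2 * (A * B)) ^ 2 = ((B - A) * (B + A)) ^ 2 by ring,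
    Real.sqrt_sq]
  exact mul_nonneg (by linarith) (by linarith)

open scoped ComplexConjugate in
/-- Each phase singularity of this unimodular map is a boundary vortex of the annulus
once `c < 0`. -/
noncomputable def boundaryVortexMap (D : ℕ) (ℓ c : ℝ) (z : ℂ) : ℂ :=
  vortexMap D ℓ c z / conj (vortexMap D ℓ c z)

/-- The constant bounding the regular part of the energy density. -/
noncomputable def vortexConst (D ℓ : ℝ) : ℝ := 12 / ℓ ^ 3 * (D + 3 / ℓ) / D ^ 2

theorem normSq_vortexPolar_pos {D ℓ x : ℝ} (hD : 0 < D) (hx : 0 < x) (hxℓ : x ≤ ℓ) (φ : ℝ) :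
    0 < Complex.normSq (vortexPolar D ℓ x φ) := by
  have hℓ : 0 < ℓ := hx.trans_le hxℓ
  have : 0 < (D * x) ^ 2 := by positivity
  exact this.trans_le ((sq_mul_le_vortexAmp_sub_sq hD.le hℓ).trans
    (vortexAmp_sub_sq_le_normSq hℓ (by rwa [abs_of_pos hx]) φ))

theorem contDiffAt_boundaryVortexMap {D : ℕ} (hD : D ≠ 0) {R δ : ℝ} (hδ : 0 < δ)
    {z : ℂ} (hz : z ∈ {z : ℂ | 1 ≤ ‖z‖ ∧ ‖z‖ ≤ R}) :
    ContDiffAt ℝ 1 (boundaryVortexMap D (Real.log R + δ) (-δ)) z := by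
  have hz0 : z ≠ 0 := norm_pos_iff.1 (one_pos.trans_le hz.1)
  have h1 := contDiffAt_vortexMap D (Real.log R + δ) (-δ) hz0
  refine h1.complex_div (Complex.conjCLE.contDiff.contDiffAt.comp z h1) ?_
  have hlog := Real.log_nonneg hz.1
  have := normSq_vortexPolar_pos (D := D) (ℓ := Real.log R + δ) (x := Real.log ‖z‖ - -δ)
    (by positivity) (by linarith)
    (by linarith [Real.log_le_log (by linarith [hz.1]) hz.2]) (D * z.arg)
  rw [← vortexMap_exp, exp_log_norm_add_arg hz0, Complex.normSq_pos] at this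
  simpa using this

theorem boundaryVortexMap_energy_le {D : ℕ} (hD : D ≠ 0) {R δ ε : ℝ} (hR : 1 < R) (hδ : 0 < δ) :
    ∫ x in {x : ℂ | 1 < ‖x‖ ∧ ‖x‖ < R},
      (‖fderiv ℝ (boundaryVortexMap D (Real.log R + δ) (-δ)) x 1‖ ^ 2 +
        ‖fderiv ℝ (boundaryVortexMap D (Real.log R + δ) (-δ)) x Complex.I‖ ^ 2
        + (1 / (2 * ε ^ 2)) * (‖boundaryVortexMap D (Real.log R + δ) (-δ) x‖ ^ 2 - 1) ^ 2) ≤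
      4 * Real.pi * D * Real.log ((Real.log R + δ) / δ) +
        8 * Real.pi * vortexConst D (Real.log R + δ) * Real.log R := by
  set S := Real.log R with hS
  have hS0 : 0 < S := Real.log_pos hR
  set ℓ := S + δ with hℓdef
  have hℓ : 0 < ℓ := by positivity
  have hD0 : 0 < (D : ℝ) := by positivity
  have hne : ∀ s ∈ Set.Icc 0 S, ∀ φ : ℝ, 0 < Complex.normSq (vortexPolar D ℓ (s - -δ) φ) :=
    fun s hs φ => normSq_vortexPolar_pos hD0 (by linarith [hs.1]) (by linarith [hs.2]) φ
  have hInt : ∫ s in (0 : ℝ)..S, (4 * Real.pi * D * (s - -δ)⁻¹ + 8 * Real.pi * vortexConst D ℓ) =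
      4 * Real.pi * D * Real.log (ℓ / δ) + 8 * Real.pi * vortexConst D ℓ * S := by
    rw [intervalIntegral.integral_add, intervalIntegral.integral_const_mul,
      intervalIntegral.integral_comp_sub_right (fun x => x⁻¹), integral_inv_of_pos (by linarith)
        (by linarith)]
    · simp [hℓdef]; ring
    · refine ContinuousOn.intervalIntegrable (continuousOn_const.mul (ContinuousOn.inv₀
        (by fun_prop) fun s hs => ?_))
      rw [Set.uIcc_of_le hS0.le] at hs
      linarith [hs.1]
    · exact intervalIntegrable_const
  rw [← hInt]
  refine setIntegral_annulus_energy_le hR (G := fun s θ => 4 * (D ^ 2 * vortexAmp D ℓ (s - -δ) ^ 2 *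
    (Complex.normSq (vortexPolar D ℓ (s - -δ) (D * θ)))⁻¹ + vortexConst D ℓ)) ?_ ?_ ?_ ?_ ?_
  · exact fun z hz => contDiffAt_boundaryVortexMap hD hδ hz
  · intro s hs
    have h1 : Continuous fun θ : ℝ => vortexPolar D ℓ (s - -δ) (D * θ) := by
      unfold vortexPolar; fun_prop
    have h2 := (Complex.continuous_normSq.comp h1).inv₀ fun θ => (hne s hs (D * θ)).ne'
    exact continuous_const.mul ((continuous_const.mul h2).add continuous_const)
  · intro s hs θ
    have hn := hne s hs (D * θ)
    have h0 := Complex.normSq_pos.1 hn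
    obtain ⟨vs, h1, h1'⟩ := exists_hasDerivAt_div_conj
      (hasDerivAt_vortexPolar_radial D ℓ (-δ) (D * θ) s) h0
    obtain ⟨vθ, h2, h2'⟩ := exists_hasDerivAt_div_conj
      (hasDerivAt_vortexPolar_angular D ℓ (s - -δ) θ) h0
    refine ⟨vs, vθ, ?_, ?_, ?_⟩
    · simpa only [boundaryVortexMap, vortexMap_exp] using h1
    · simpa only [boundaryVortexMap, vortexMap_exp] using h2
    · have h3 : ‖boundaryVortexMap D ℓ (-δ) (Complex.exp (s + θ * Complex.I))‖ = 1 := by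
        rw [boundaryVortexMap, vortexMap_exp, norm_div, RCLike.norm_conj,
          div_self (norm_ne_zero_iff.2 h0)]
      rw [h1', h2', h3]
      have h4 := im_sq_add_im_sq_le hD0 hℓ (x := s - -δ)
        (by rw [abs_of_nonneg] <;> linarith [hs.1, hs.2]) (D * θ)
      rw [← vortexConst] at h4
      generalize Complex.normSq (vortexPolar D ℓ (s - -δ) (D * θ)) = N at *
      rw [← add_div, ← mul_add]
      have h5 : 4 * (D ^ 2 * vortexAmp D ℓ (s - -δ) ^ 2 * N⁻¹ + vortexConst D ℓ) =
        4 * (D ^ 2 * vortexAmp D ℓ (s - -δ) ^ 2 * N + vortexConst D ℓ * N ^ 2) / N ^ 2 := by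
        field_simp
      rw [h5, one_pow, sub_self, zero_pow two_ne_zero, mul_zero, mul_zero, add_zero]
      exact div_le_div_of_nonneg_right (by linarith) (sq_nonneg _)
  · refine ContinuousOn.add (continuousOn_const.mul (ContinuousOn.inv₀
        (by fun_prop) fun s hs => ?_)) continuousOn_const
    linarith [hs.1]
  · intro s hs
    have h1 : IntervalIntegrable (fun θ : ℝ =>
        (Complex.normSq (vortexPolar D ℓ (s - -δ) (D * θ)))⁻¹) volume (-Real.pi) Real.pi := by
      have h1 : Continuous fun θ : ℝ => vortexPolar D ℓ (s - -δ) (D * θ) := by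
        unfold vortexPolar; fun_prop
      exact ((Complex.continuous_normSq.comp h1).inv₀
        fun θ => (hne s hs (D * θ)).ne').intervalIntegrable _ _
    rw [intervalIntegral.integral_const_mul, intervalIntegral.integral_add (h1.const_mul _)
      intervalIntegrable_const, intervalIntegral.integral_const_mul]
    have hx : 0 < s - -δ := by linarith [hs.1]
    have hxℓ : s - -δ ≤ ℓ := by linarith [hs.2]
    rw [integral_inv_normSq_vortexPolar hD hx hxℓ, intervalIntegral.integral_const]
    generalize s - -δ = x at *
    have hA := vortexAmp_nonneg (D := D) hℓ (x := x) (by rwa [abs_of_pos hx])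
    have hA1 := vortexAmp_le_one hD0.le hℓ hx.le hxℓ
    have hB := one_le_vortexAmp_neg hD0.le hℓ hx.le
    have hBA := mul_le_vortexAmp_neg_sub hD0.le hℓ hx.le
    have hDx : 0 < D * x := by positivity
    generalize vortexAmp D ℓ x = A at *
    generalize vortexAmp D ℓ (-x) = B at *
    have h2 : D ^ 2 * A ^ 2 * (2 * Real.pi / ((B - A) * (B + A))) ≤ Real.pi * D * x⁻¹ := by
      rw [← mul_div_assoc, ← div_eq_mul_inv, div_le_div_iff₀
        (mul_pos (by linarith) (by linarith)) hx]
      have h3 : D * x * (2 * A) ≤ (B - A) * (B + A) :=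
        mul_le_mul hBA (by linarith) (by linarith) (by linarith)
      have h4 : A ^ 2 ≤ A := by nlinarith
      have h5 : D * x * (2 * A ^ 2) ≤ (B - A) * (B + A) :=
        (mul_le_mul_of_nonneg_left (by linarith) hDx.le).trans h3
      have := mul_le_mul_of_nonneg_left h5 (by positivity : 0 ≤ Real.pi * D)
      linarith
    rw [smul_eq_mul]
    linarith

theorem boundaryVortexMap_anchoring_le {D : ℕ} (hD : D ≠ 0) {S δ : ℝ} (hS : 0 < S) (hδ : 0 < δ)
    (hδ1 : δ ≤ 1) :
    ∫ θ in (0 : ℝ)..(2 * Real.pi),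
      ‖boundaryVortexMap D (S + δ) (-δ) (Complex.exp (Complex.I * (θ : ℂ)))
        - Complex.exp (Complex.I * ((D : ℂ) * (θ : ℂ)))‖ ^ 2 ≤
      8 * Real.pi * (Real.exp (D / 2) * (D + 2 / S)) * δ := by
  set ℓ := S + δ with hℓdef
  have hℓ : 0 < ℓ := by positivity
  have hδℓ : δ ≤ ℓ := by linarith
  have hD0 : 0 < (D : ℝ) := by positivity
  have hpos := normSq_vortexPolar_pos hD0 hδ hδℓ
  have hA := vortexAmp_nonneg (D := D) hℓ (x := δ) (by rwa [abs_of_pos hδ])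
  have hB := one_le_vortexAmp_neg hD0.le hℓ hδ.le
  have hBA := mul_le_vortexAmp_neg_sub hD0.le hℓ hδ.le
  have hDx : 0 < D * δ := by positivity
  have hpt : ∀ θ : ℝ, ‖boundaryVortexMap D ℓ (-δ) (Complex.exp (Complex.I * (θ : ℂ)))
      - Complex.exp (Complex.I * ((D : ℂ) * (θ : ℂ)))‖ ^ 2 ≤
      4 * (vortexAmp D ℓ (-δ) - vortexAmp D ℓ δ) ^ 2 *
        (Complex.normSq (vortexPolar D ℓ δ (D * θ)))⁻¹ := by
    intro θ
    have e0 : Complex.exp (Complex.I * (θ : ℂ)) = Complex.exp ((0 : ℝ) + θ * Complex.I) := by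
      simp [mul_comm]
    have e1 : Complex.exp (Complex.I * ((D : ℂ) * (θ : ℂ))) =
        Complex.exp ((D * θ : ℝ) * Complex.I) := by
      push_cast; rw [mul_comm]
    rw [e0, e1, boundaryVortexMap, vortexMap_exp, zero_sub, neg_neg]
    have h0 := Complex.normSq_pos.1 (hpos (D * θ))
    have hc : (starRingEnd ℂ) (vortexPolar D ℓ δ (D * θ)) ≠ 0 := by simpa using h0
    rw [div_sub' hc, norm_div, div_pow, RCLike.norm_conj, ← Complex.normSq_eq_norm_sq (vortexPolar _ _ _ _),
      div_eq_mul_inv]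
    refine mul_le_mul_of_nonneg_right ?_ (inv_nonneg.2 (Complex.normSq_nonneg _))
    have e2 : vortexPolar D ℓ δ (D * θ) -
        (starRingEnd ℂ) (vortexPolar D ℓ δ (D * θ)) * Complex.exp ((D * θ : ℝ) * Complex.I) =
        ((vortexAmp D ℓ (-δ) - vortexAmp D ℓ δ : ℝ) : ℂ) *
          (1 - Complex.exp ((D * θ : ℝ) * Complex.I)) := by
      have e3 : Complex.exp (-((D * θ : ℝ) * Complex.I)) * Complex.exp ((D * θ : ℝ) * Complex.I)
          = 1 := by
        rw [← Complex.exp_add]; simp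
      have e4 : (starRingEnd ℂ) (Complex.exp ((D * θ : ℝ) * Complex.I)) =
          Complex.exp (-((D * θ : ℝ) * Complex.I)) := by
        rw [← Complex.exp_conj]; simp
      simp only [vortexPolar, map_add, map_mul, Complex.conj_ofReal, e4]
      push_cast at e3 ⊢
      linear_combination (-(vortexAmp D ℓ δ : ℂ)) * e3
    rw [e2, norm_mul, mul_pow, Complex.norm_real, Real.norm_eq_abs, sq_abs, mul_comm]
    refine mul_le_mul_of_nonneg_right ?_ (sq_nonneg _)
    have h1 : ‖1 - Complex.exp ((D * θ : ℝ) * Complex.I)‖ ≤ 2 := by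
      refine (norm_sub_le _ _).trans ?_
      rw [Complex.norm_exp_ofReal_mul_I]; norm_num
    nlinarith [norm_nonneg (1 - Complex.exp ((D * θ : ℝ) * Complex.I))]
  have hcP : Continuous fun θ : ℝ => vortexPolar D ℓ δ (D * θ) := by
    unfold vortexPolar; fun_prop
  have hcinv : Continuous fun θ : ℝ => (Complex.normSq (vortexPolar D ℓ δ (D * θ)))⁻¹ :=
    (Complex.continuous_normSq.comp hcP).inv₀ fun θ => (hpos (D * θ)).ne'
  have hper : Function.Periodic
      (fun θ : ℝ => (Complex.normSq (vortexPolar D ℓ δ (D * θ)))⁻¹) (2 * Real.pi) := by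
    intro θ
    simp only [normSq_vortexPolar]
    rw [mul_add, Real.cos_add_nat_mul_two_pi]
  have hI : ∫ θ in (0 : ℝ)..(2 * Real.pi), (Complex.normSq (vortexPolar D ℓ δ (D * θ)))⁻¹ =
      2 * Real.pi / ((vortexAmp D ℓ (-δ) - vortexAmp D ℓ δ) *
        (vortexAmp D ℓ (-δ) + vortexAmp D ℓ δ)) := by
    rw [← integral_inv_normSq_vortexPolar hD hδ hδℓ]
    have := hper.intervalIntegral_add_eq 0 (-Real.pi)
    rw [zero_add, show -Real.pi + 2 * Real.pi = Real.pi by ring] at this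
    exact this
  have hdiff : vortexAmp D ℓ (-δ) - vortexAmp D ℓ δ ≤ Real.exp (D / 2) * (D + 2 / S) * δ := by
    have h1 : (δ / ℓ) ^ 3 ≤ δ / S := by
      have h2 : δ / ℓ ≤ 1 := (div_le_one hℓ).2 hδℓ
      have h3 : 0 ≤ δ / ℓ := by positivity
      have h4 : δ / ℓ ≤ δ / S := by gcongr; linarith
      exact (pow_le_of_le_one h3 h2 three_ne_zero).trans h4
    have h0 : 0 ≤ (δ / ℓ) ^ 3 := by positivity
    have h2 : (-δ / ℓ) ^ 3 = -(δ / ℓ) ^ 3 := by ring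
    have h3 : Real.exp (-(D * -δ / 2)) ≤ Real.exp (D / 2) := by
      rw [Real.exp_le_exp]; nlinarith
    have h5 : Real.exp (-(D * δ / 2)) = Real.exp (-(D * -δ / 2)) * Real.exp (-(D * δ)) := by
      rw [← Real.exp_add]; congr 1; ring
    have h6 := Real.add_one_le_exp (-(D * δ))
    have h7 : Real.exp (-(D * δ)) ≤ 1 := Real.exp_le_one_iff.2 (by linarith)
    have h8 : vortexAmp D ℓ (-δ) - vortexAmp D ℓ δ = Real.exp (-(D * -δ / 2)) *
        ((1 - Real.exp (-(D * δ))) + (δ / ℓ) ^ 3 * (1 + Real.exp (-(D * δ)))) := by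
      unfold vortexAmp
      rw [h2, h5]; ring
    rw [h8, mul_assoc]
    refine mul_le_mul h3 ?_ (by nlinarith [Real.exp_pos (-(D * δ))]) (Real.exp_nonneg _)
    have h9 : (D + 2 / S) * δ = D * δ + δ / S * 2 := by ring
    rw [h9]
    nlinarith
  calc _ ≤ ∫ θ in (0 : ℝ)..(2 * Real.pi), 4 * (vortexAmp D ℓ (-δ) - vortexAmp D ℓ δ) ^ 2 *
        (Complex.normSq (vortexPolar D ℓ δ (D * θ)))⁻¹ := by
        rw [intervalIntegral.integral_of_le Real.two_pi_pos.le,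
          intervalIntegral.integral_of_le Real.two_pi_pos.le]
        exact integral_mono_of_nonneg (Filter.Eventually.of_forall fun θ => sq_nonneg _)
          ((continuous_const.mul hcinv).intervalIntegrable _ _).1
          (Filter.Eventually.of_forall hpt)
    _ ≤ 8 * Real.pi * (vortexAmp D ℓ (-δ) - vortexAmp D ℓ δ) := by
        rw [intervalIntegral.integral_const_mul, hI]
        generalize vortexAmp D ℓ δ = A at *
        generalize vortexAmp D ℓ (-δ) = B at *
        have h1 : 0 < B - A := by linarith
        have h2 : 1 ≤ B + A := by linarith
        have h3 : 4 * (B - A) ^ 2 * (2 * Real.pi / ((B - A) * (B + A))) =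
            8 * Real.pi * (B - A) / (B + A) := by
          field_simp; ring
        rw [h3]
        exact div_le_self (by positivity) h2
    _ ≤ _ := by
        rw [mul_assoc (8 * Real.pi)]
        exact mul_le_mul_of_nonneg_left hdiff (by positivity)

theorem boundaryVortexMap_eq_one {D : ℕ} (hD : D ≠ 0) {R δ : ℝ} (hℓ : 0 < Real.log R + δ) {z : ℂ}
    (hz : ‖z‖ = R) : boundaryVortexMap D (Real.log R + δ) (-δ) z = 1 := by
  have hD0 : 0 < (D : ℝ) := by positivity
  have h0 : vortexAmp D (Real.log R + δ) (Real.log R + δ) = 0 := by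
    simp [vortexAmp, div_self hℓ.ne']
  have h1 := one_le_vortexAmp_neg (D := D) hD0.le hℓ hℓ.le
  have h2 : (vortexAmp D (Real.log R + δ) (-(Real.log R + δ)) : ℂ) ≠ 0 :=
    Complex.ofReal_ne_zero.2 (by linarith)
  rw [boundaryVortexMap, vortexMap, hz, sub_neg_eq_add, h0, Complex.ofReal_zero, zero_mul, zero_add,
    Complex.conj_ofReal, div_self h2]

theorem exists_energy_le_boundaryVortex {D : ℕ} (hD : 1 ≤ D) {α K R : ℝ}
    (hα1 : 0 < α) (hK : 0 < K) (hR : 1 < R) :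
    ∃ C : ℝ, ∀ ε : ℝ, 0 < ε → ε < 1 →
      ∃ u : ℂ → ℂ,
        (∃ L : NNReal, LipschitzOnWith L u {x : ℂ | 1 ≤ ‖x‖ ∧ ‖x‖ ≤ R}) ∧
        (∀ x : ℂ, ‖x‖ = R → u x = 1) ∧
        (1 / 2) * (∫ x in {x : ℂ | 1 < ‖x‖ ∧ ‖x‖ < R},
            (‖fderiv ℝ u x 1‖ ^ 2 + ‖fderiv ℝ u x Complex.I‖ ^ 2
              + (1 / (2 * ε ^ 2)) * (‖u x‖ ^ 2 - 1) ^ 2))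
          + (K * ε ^ (-α) / 2) * (∫ θ in (0 : ℝ)..(2 * Real.pi),
              ‖u (Complex.exp (Complex.I * (θ : ℂ)))
                - Complex.exp (Complex.I * ((D : ℂ) * (θ : ℂ)))‖ ^ 2)
        ≤ Real.pi * (2 * α) * (D : ℝ) * Real.log (1 / ε) + C := by
  have hD' : D ≠ 0 := by omega
  have hS : 0 < Real.log R := Real.log_pos hR
  refine ⟨2 * Real.pi * D * Real.log (Real.log R + 1) + 4 * Real.pi * vortexConst D (Real.log R) *
    Real.log R + 4 * Real.pi * K * (Real.exp (D / 2) * (D + 2 / Real.log R)), fun ε hε hε1 => ?_⟩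
  set δ := ε ^ α with hδdef
  have hδ : 0 < δ := Real.rpow_pos_of_pos hε α
  have hδ1 : δ ≤ 1 := Real.rpow_le_one hε.le hε1.le hα1.le
  refine ⟨boundaryVortexMap D (Real.log R + δ) (-δ), exists_lipschitzOnWith_of_contDiffAt
    (isCompact_annulus R) fun z hz => contDiffAt_boundaryVortexMap hD' hδ hz,
    fun x hx => boundaryVortexMap_eq_one hD' (by linarith) hx, ?_⟩
  have h1 := boundaryVortexMap_energy_le hD' (ε := ε) hR hδ
  have h2 := boundaryVortexMap_anchoring_le hD' hS hδ hδ1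
  have h3 : vortexConst D (Real.log R + δ) ≤ vortexConst D (Real.log R) := by
    unfold vortexConst
    have : Real.log R ≤ Real.log R + δ := by linarith
    gcongr
  have h4 : Real.log ((Real.log R + δ) / δ) ≤ Real.log (Real.log R + 1) + α * Real.log (1 / ε) := by
    rw [Real.log_div (by linarith) hδ.ne', hδdef, Real.log_rpow hε, one_div, Real.log_inv]
    have := Real.log_le_log (by linarith) (by linarith : Real.log R + δ ≤ Real.log R + 1)
    linarith
  have h5 : ε ^ (-α) * δ = 1 := by rw [hδdef, ← Real.rpow_add hε]; simp
  have h6 := mul_le_mul_of_nonneg_left h2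
    (by have := Real.rpow_pos_of_pos hε (-α); positivity : 0 ≤ K * ε ^ (-α) / 2)
  have h7 : K * ε ^ (-α) / 2 * (8 * Real.pi * (Real.exp (D / 2) * (D + 2 / Real.log R)) * δ) =
      4 * Real.pi * K * (Real.exp (D / 2) * (D + 2 / Real.log R)) := by
    linear_combination (4 * Real.pi * K * (Real.exp (D / 2) * (D + 2 / Real.log R))) * h5
  have h8 := mul_le_mul_of_nonneg_left h4 (by positivity : 0 ≤ 2 * Real.pi * D)
  have h9 := mul_le_mul_of_nonneg_left h3 (by positivity : 0 ≤ 4 * Real.pi * Real.log R)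
  linarith

/-- The regularization added to the squared modulus of the vortex profile. -/
noncomputable def vortexReg (D ℓ ε x : ℝ) : ℝ := 4 * D ^ 2 * ε ^ 2 * (1 - ((x / ℓ) ^ 3) ^ 2) ^ 2

theorem exists_hasDerivAt_vortexReg {D ℓ ε x : ℝ} (hℓ : 0 < ℓ) (hx : |x| ≤ ℓ) :
    ∃ h', HasDerivAt (vortexReg D ℓ ε) h' x ∧ |h'| ≤ 48 * D ^ 2 / ℓ * ε ^ 2 := by
  have h1 : HasDerivAt (fun x : ℝ => (x / ℓ) ^ 3) (3 * (x / ℓ) ^ 2 * (1 / ℓ)) x := by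
    simpa using ((hasDerivAt_id x).div_const ℓ).fun_pow 3
  have h2 := (((h1.fun_pow 2).const_sub 1).fun_pow 2).const_mul (4 * D ^ 2 * ε ^ 2)
  refine ⟨_, h2, ?_⟩
  have h3 := abs_div_cube_le_one hℓ hx
  have h4 : (x / ℓ) ^ 2 ≤ 1 := by
    rw [sq_le_one_iff_abs_le_one, abs_div, abs_of_pos hℓ]
    exact (div_le_one hℓ).2 hx
  have h5 := sq_nonneg (x / ℓ)
  generalize (x / ℓ) ^ 3 = P at *
  generalize (x / ℓ) ^ 2 = Q at *
  have h6 : |1 - P ^ 2| ≤ 1 := by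
    have := (sq_le_one_iff_abs_le_one P).2 h3
    rw [abs_le]; constructor <;> nlinarith
  have h7 : |(1 - P ^ 2) * (P * Q)| ≤ 1 := by
    rw [abs_mul, abs_mul, abs_of_nonneg h5]
    exact mul_le_one₀ h6 (by positivity) (mul_le_one₀ h3 h5 h4)
  have e : 48 * D ^ 2 / ℓ * ε ^ 2 * -((1 - P ^ 2) * (P * Q)) = 4 * D ^ 2 * ε ^ 2 *
      ((2 : ℕ) * (1 - P ^ 2) ^ (2 - 1) * -((2 : ℕ) * P ^ (2 - 1) * (3 * Q * (1 / ℓ)))) := by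
    norm_num; ring
  rw [← e, abs_mul, abs_neg, abs_of_nonneg (by positivity)]
  exact mul_le_of_le_one_right (by positivity) h7

section
variable {D ℓ ε x : ℝ}

theorem vortexReg_nonneg : 0 ≤ vortexReg D ℓ ε x := by unfold vortexReg; positivity

theorem vortexReg_le (hℓ : 0 < ℓ) (hx : |x| ≤ ℓ) : vortexReg D ℓ ε x ≤ 4 * D ^ 2 * ε ^ 2 := by
  have h3 := abs_div_cube_le_one hℓ hx
  unfold vortexReg
  refine mul_le_of_le_one_right (by positivity) (pow_le_one₀ ?_ ?_)
  · nlinarith [(sq_le_one_iff_abs_le_one _).2 h3]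
  · nlinarith [sq_nonneg ((x / ℓ) ^ 3)]

theorem vortexAmp_le (hD : 0 ≤ D) (hℓ : 0 < ℓ) (hx : |x| ≤ ℓ) :
    vortexAmp D ℓ x ≤ 2 * Real.exp (D * ℓ / 2) := by
  have h3 := abs_le.1 (abs_div_cube_le_one hℓ hx)
  have h4 : Real.exp (-(D * x / 2)) ≤ Real.exp (D * ℓ / 2) := by
    rw [Real.exp_le_exp]
    nlinarith [mul_le_mul_of_nonneg_left (abs_le.1 hx).1 hD]
  unfold vortexAmp
  exact mul_le_mul (by linarith) h4 (Real.exp_nonneg _) (by norm_num)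

theorem abs_vortexAmpDeriv_le (hD : 0 ≤ D) (hℓ : 0 < ℓ) (hx : |x| ≤ ℓ) :
    |vortexAmpDeriv D ℓ x| ≤ (3 / ℓ + D) * Real.exp (D * ℓ / 2) := by
  have h3 := abs_le.1 (abs_div_cube_le_one hℓ hx)
  have h4 : Real.exp (-(D * x / 2)) ≤ Real.exp (D * ℓ / 2) := by
    rw [Real.exp_le_exp]
    nlinarith [mul_le_mul_of_nonneg_left (abs_le.1 hx).1 hD]
  unfold vortexAmpDeriv
  rw [abs_mul, Real.abs_exp]
  refine mul_le_mul ?_ h4 (Real.exp_nonneg _) (by positivity)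
  have h5 : 3 * x ^ 2 / ℓ ^ 3 ≤ 3 / ℓ := by
    rw [div_le_div_iff₀ (by positivity) hℓ]
    have : x ^ 2 ≤ ℓ ^ 2 := sq_le_sq' (by linarith [(abs_le.1 hx).1]) (abs_le.1 hx).2
    nlinarith [mul_le_mul_of_nonneg_right this hℓ.le]
  have h6 : 0 ≤ 3 * x ^ 2 / ℓ ^ 3 := by positivity
  rw [abs_le]
  constructor <;> nlinarith

/-- The minimum over the angle of the regularized squared modulus. -/
noncomputable def vortexCore (D ℓ ε x : ℝ) : ℝ :=
  (vortexAmp D ℓ x - vortexAmp D ℓ (-x)) ^ 2 + vortexReg D ℓ ε x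

theorem vortexCore_le (hℓ : 0 < ℓ) (hx : |x| ≤ ℓ) (φ : ℝ) : vortexCore D ℓ ε x ≤
    Complex.normSq (vortexPolar D ℓ x φ) + vortexReg D ℓ ε x :=
  add_le_add_left (vortexAmp_sub_sq_le_normSq hℓ hx φ) _

theorem le_vortexCore_or (hD : 0 ≤ D) (hℓ : 0 < ℓ) :
    D ^ 2 * (x ^ 2 + ε ^ 2) ≤ vortexCore D ℓ ε x ∨
      ((D * x) ^ 2 ≤ vortexCore D ℓ ε x ∧ (ℓ / 2) ^ 2 ≤ x ^ 2) := by
  have h1 := sq_mul_le_vortexAmp_sub_sq (x := x) hD hℓ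
  unfold vortexCore
  rcases le_total (((x / ℓ) ^ 3) ^ 2) (1 / 2) with h | h
  · left
    have h2 : 1 / 4 ≤ (1 - ((x / ℓ) ^ 3) ^ 2) ^ 2 := by nlinarith
    have h3 : D ^ 2 * ε ^ 2 ≤ vortexReg D ℓ ε x := by
      unfold vortexReg
      nlinarith [mul_le_mul_of_nonneg_left h2 (by positivity : 0 ≤ 4 * D ^ 2 * ε ^ 2)]
    nlinarith
  · right
    refine ⟨by linarith [vortexReg_nonneg (D := D) (ℓ := ℓ) (ε := ε) (x := x)], ?_⟩
    by_contra! hlt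
    have h2 : (x / ℓ) ^ 2 < 1 / 4 := by
      rw [div_pow, div_lt_iff₀ (by positivity)]; nlinarith
    have h3 : ((x / ℓ) ^ 3) ^ 2 = ((x / ℓ) ^ 2) ^ 3 := by ring
    rw [h3] at h
    have h4 : ((x / ℓ) ^ 2) ^ 3 ≤ (1 / 4) ^ 3 := pow_le_pow_left₀ (sq_nonneg _) h2.le 3
    norm_num at h4
    linarith

theorem vortexCore_pos (hD : 0 < D) (hℓ : 0 < ℓ) (hε : 0 < ε) : 0 < vortexCore D ℓ ε x := by
  rcases le_vortexCore_or (x := x) (ε := ε) hD.le hℓ with h | ⟨h, h2⟩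
  · exact lt_of_lt_of_le (by positivity) h
  · have : 0 < (ℓ / 2) ^ 2 := by positivity
    exact lt_of_lt_of_le (by rw [mul_pow]; exact mul_pos (by positivity) (by linarith)) h

theorem inv_sqrt_vortexCore_le (hD : 0 < D) (hℓ : 0 < ℓ) (hε : 0 < ε) :
    (√(vortexCore D ℓ ε x))⁻¹ ≤ D⁻¹ * (√(x ^ 2 + ε ^ 2))⁻¹ + 2 / (D * ℓ) := by
  rcases le_vortexCore_or (x := x) (ε := ε) hD.le hℓ with h | ⟨h, h2⟩
  · have h3 : D * √(x ^ 2 + ε ^ 2) ≤ √(vortexCore D ℓ ε x) := by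
      refine Real.le_sqrt_of_sq_le ?_
      rw [mul_pow, Real.sq_sqrt (by positivity)]
      exact h
    have h4 : (√(vortexCore D ℓ ε x))⁻¹ ≤ (D * √(x ^ 2 + ε ^ 2))⁻¹ :=
      inv_anti₀ (by positivity) h3
    rw [mul_inv] at h4
    have : 0 ≤ 2 / (D * ℓ) := by positivity
    linarith
  · have h3 : D * ℓ / 2 ≤ √(vortexCore D ℓ ε x) := by
      refine Real.le_sqrt_of_sq_le (le_trans ?_ h)
      nlinarith [mul_le_mul_of_nonneg_left h2 (sq_nonneg D)]
    have h4 : (√(vortexCore D ℓ ε x))⁻¹ ≤ (D * ℓ / 2)⁻¹ := inv_anti₀ (by positivity) h3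
    rw [inv_div] at h4
    have : 0 ≤ D⁻¹ * (√(x ^ 2 + ε ^ 2))⁻¹ := by positivity
    linarith

theorem sq_add_sq_le_mul_vortexCore (hD : 0 < D) (hℓ : 0 < ℓ) (hε : 0 < ε) (hε1 : ε ≤ 1) :
    x ^ 2 + ε ^ 2 ≤ (1 + 4 / ℓ ^ 2) / D ^ 2 * vortexCore D ℓ ε x := by
  have hM : 0 ≤ 4 / ℓ ^ 2 := by positivity
  rw [div_mul_eq_mul_div, le_div_iff₀ (by positivity)]
  rcases le_vortexCore_or (x := x) (ε := ε) hD.le hℓ with h | ⟨h, h2⟩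
  · nlinarith [vortexCore_pos (x := x) hD hℓ hε]
  · have h3 : 1 ≤ 4 / ℓ ^ 2 * x ^ 2 := by
      rw [div_mul_eq_mul_div, le_div_iff₀ (by positivity)]; nlinarith
    have h4 : x ^ 2 + ε ^ 2 ≤ (1 + 4 / ℓ ^ 2) * x ^ 2 := by nlinarith
    calc _ ≤ (1 + 4 / ℓ ^ 2) * x ^ 2 * D ^ 2 := by gcongr
      _ = (1 + 4 / ℓ ^ 2) * (D * x) ^ 2 := by ring
      _ ≤ _ := by gcongr

theorem sq_div_vortexCore_le (hD : 0 < D) (hℓ : 0 < ℓ) (hε : 0 < ε) (hε1 : ε ≤ 1) :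
    ε ^ 2 / vortexCore D ℓ ε x * (√(vortexCore D ℓ ε x))⁻¹ ≤
      ((1 + 4 / ℓ ^ 2) / D ^ 2 + 1) ^ 2 * (ε / (x ^ 2 + ε ^ 2)) := by
  have h1 := sq_add_sq_le_mul_vortexCore (x := x) hD hℓ hε hε1
  have hE := vortexCore_pos (x := x) hD hℓ hε
  have hM0 : 0 ≤ (1 + 4 / ℓ ^ 2) / D ^ 2 := by positivity
  set M := (1 + 4 / ℓ ^ 2) / D ^ 2
  set E := vortexCore D ℓ ε x
  have hs := Real.sqrt_pos.2 hE
  have h2 : ε ≤ (M + 1) * √E := by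
    refine abs_le_of_sq_le_sq' ?_ (by positivity) |>.2
    rw [mul_pow, Real.sq_sqrt hE.le]
    nlinarith [sq_nonneg x, mul_nonneg hM0 hE.le, mul_nonneg (sq_nonneg M) hE.le]
  rw [div_mul_eq_mul_div, div_le_iff₀ hE, ← div_eq_mul_inv, div_le_iff₀ hs, ← mul_div_assoc,
    div_mul_eq_mul_div, div_mul_eq_mul_div, le_div_iff₀ (by positivity)]
  have h3 : x ^ 2 + ε ^ 2 ≤ (M + 1) * E := by linarith
  have := mul_le_mul h2 h3 (by positivity) (by positivity)
  nlinarith [mul_le_mul_of_nonneg_left this hε.le]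

theorem one_le_vortexAmp_add_neg (hD : 0 ≤ D) (hℓ : 0 < ℓ) (hx : |x| ≤ ℓ) :
    1 ≤ vortexAmp D ℓ x + vortexAmp D ℓ (-x) := by
  have hA := vortexAmp_nonneg (D := D) hℓ hx
  have hB := vortexAmp_nonneg (D := D) hℓ (by rwa [abs_neg] : |-x| ≤ ℓ)
  rcases le_total 0 x with h | h
  · linarith [one_le_vortexAmp_neg hD hℓ h]
  · have := one_le_vortexAmp_neg hD hℓ (neg_nonneg.2 h)
    rw [neg_neg] at this
    linarith

theorem integral_inv_normSq_vortexPolar_add_le {D : ℕ} (hD : D ≠ 0) (hℓ : 0 < ℓ) (hx : |x| ≤ ℓ)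
    (hε : 0 < ε) :
    ∫ θ in (-Real.pi)..Real.pi,
      (Complex.normSq (vortexPolar D ℓ x (D * θ)) + vortexReg D ℓ ε x)⁻¹ ≤
      2 * Real.pi * (√(vortexCore D ℓ ε x))⁻¹ * (vortexAmp D ℓ x + vortexAmp D ℓ (-x))⁻¹ := by
  have hD0 : 0 < (D : ℝ) := by positivity
  have hA := vortexAmp_nonneg (D := D) hℓ hx
  have hB := vortexAmp_nonneg (D := D) hℓ (by rwa [abs_neg] : |-x| ≤ ℓ)
  have hE := vortexCore_pos (x := x) hD0 hℓ hε
  have hh := vortexReg_nonneg (D := D) (ℓ := ℓ) (ε := ε) (x := x)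
  have hAB := one_le_vortexAmp_add_neg (D := D) hD0.le hℓ hx
  unfold vortexCore at *
  simp only [normSq_vortexPolar]
  generalize vortexReg D ℓ ε x = h at *
  generalize vortexAmp D ℓ x = A at *
  generalize vortexAmp D ℓ (-x) = B at *
  have e : ∀ θ : ℝ, A ^ 2 + B ^ 2 + 2 * (A * B) * Real.cos (D * θ) + h =
      (A ^ 2 + B ^ 2 + h) + 2 * (A * B) * Real.cos (D * θ) := fun θ => by ring
  simp only [e]
  rw [integral_inv_add_mul_cos_nat_mul (by positivity) (by nlinarith) hD]
  have h1 : √((A - B) ^ 2 + h) * (A + B) ≤ √((A ^ 2 + B ^ 2 + h) ^ 2 - (2 * (A * B)) ^ 2) := by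
    refine Real.le_sqrt_of_sq_le ?_
    rw [mul_pow, Real.sq_sqrt hE.le]
    nlinarith [mul_nonneg hE.le hh]
  have hs := Real.sqrt_pos.2 hE
  rw [mul_assoc (2 * Real.pi), ← mul_inv, ← div_eq_mul_inv]
  exact div_le_div_of_nonneg_left (by positivity) (by positivity) h1

theorem vortexAmp_sq_mul_inv_le (hD : 0 < D) (hℓ : 0 < ℓ) (hx : |x| ≤ ℓ) :
    vortexAmp D ℓ x ^ 2 * (vortexAmp D ℓ x + vortexAmp D ℓ (-x))⁻¹ ≤
      1 / 2 + √(vortexCore D ℓ ε x) := by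
  have hA := vortexAmp_nonneg (D := D) hℓ hx
  have hB := vortexAmp_nonneg (D := D) hℓ (by rwa [abs_neg] : |-x| ≤ ℓ)
  have h0 : |vortexAmp D ℓ x - vortexAmp D ℓ (-x)| ≤ √(vortexCore D ℓ ε x) :=
    Real.abs_le_sqrt (le_add_of_nonneg_right vortexReg_nonneg)
  generalize √(vortexCore D ℓ ε x) = E at *
  rw [← div_eq_mul_inv]
  rcases le_total 0 x with h | h
  · have h1 := one_le_vortexAmp_neg hD.le hℓ h
    have h2 := vortexAmp_le_one hD.le hℓ h (abs_le.1 hx).2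
    generalize vortexAmp D ℓ x = A at *
    generalize vortexAmp D ℓ (-x) = B at *
    have hE : 0 ≤ E := (abs_nonneg _).trans h0
    rw [div_le_iff₀ (by linarith)]
    nlinarith
  · have h1 := one_le_vortexAmp_neg hD.le hℓ (neg_nonneg.2 h)
    rw [neg_neg] at h1
    have h2 := vortexAmp_le_one hD.le hℓ (neg_nonneg.2 h) (by linarith [(abs_le.1 hx).1])
    generalize vortexAmp D ℓ x = A at *
    generalize vortexAmp D ℓ (-x) = B at *
    rw [div_le_iff₀ (by linarith)]
    have h3 := (le_abs_self _).trans h0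
    nlinarith [mul_le_mul_of_nonneg_right h3 (by linarith : 0 ≤ A + B)]
end

/-- A map with modulus close to one away from the zeros of `vortexMap D ℓ ℓ`. -/
noncomputable def interiorVortexMap (D : ℕ) (ℓ ε : ℝ) (z : ℂ) : ℂ :=
  vortexMap D ℓ ℓ z /
    (√(Complex.normSq (vortexMap D ℓ ℓ z) + vortexReg D ℓ ε (Real.log ‖z‖ - ℓ)) : ℂ)

theorem sq_div_four_mul_pow_le {D ε F H N g h k r : ℝ} (hε : 0 ≤ ε) (hε1 : ε ≤ 1) (hN : 0 < N)
    (h0 : 0 ≤ h) (hh : h ≤ 4 * D ^ 2 * ε ^ 2) (hhN : h ≤ N) (hrN : r ^ 2 ≤ N)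
    (hg : 0 ≤ g) (hgF : g ≤ F) (hk : 0 ≤ k) (hkH : k ≤ H * ε ^ 2) :
    (2 * g * h + r * k) ^ 2 / (4 * N ^ 3) ≤ (8 * F ^ 2 * D ^ 2 + H ^ 2 / 2) * (ε ^ 2 / N ^ 2) := by
  have h1 : (2 * g * h + r * k) ^ 2 ≤ 8 * (g ^ 2 * h ^ 2) + 2 * (r ^ 2 * k ^ 2) := by
    nlinarith [sq_nonneg (2 * g * h - r * k)]
  have h2 : g ^ 2 * h ^ 2 ≤ F ^ 2 * (4 * D ^ 2 * ε ^ 2 * N) :=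
    mul_le_mul (pow_le_pow_left₀ hg hgF 2)
      (by rw [sq]; exact mul_le_mul hh hhN h0 (by positivity)) (by positivity) (by positivity)
  have h3 : r ^ 2 * k ^ 2 ≤ N * (H ^ 2 * ε ^ 2) := by
    refine mul_le_mul hrN ?_ (sq_nonneg _) hN.le
    have h4 : ε ^ 4 ≤ ε ^ 2 := pow_le_pow_of_le_one hε hε1 (by norm_num)
    calc k ^ 2 ≤ (H * ε ^ 2) ^ 2 := pow_le_pow_left₀ hk hkH 2
      _ = H ^ 2 * ε ^ 4 := by ring
      _ ≤ _ := mul_le_mul_of_nonneg_left h4 (sq_nonneg _)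
  have e : (8 * F ^ 2 * D ^ 2 + H ^ 2 / 2) * (ε ^ 2 / N ^ 2) =
      (8 * (F ^ 2 * (4 * D ^ 2 * ε ^ 2 * N)) + 2 * (N * (H ^ 2 * ε ^ 2))) / (4 * N ^ 3) := by
    field_simp; ring
  rw [e]
  exact div_le_div_of_nonneg_right (by linarith) (by positivity)

/-- The constant bounding the energy density in the vortex cores. -/
noncomputable def coreConst (D ℓ R : ℝ) : ℝ :=
  2 * (8 * (2 * ((3 / ℓ + D) * Real.exp (D * ℓ / 2))) ^ 2 * D ^ 2 + (48 * D ^ 2 / ℓ) ^ 2 / 2) +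
    8 * R ^ 2 * D ^ 4

theorem coreConst_nonneg {D ℓ R : ℝ} : 0 ≤ coreConst D ℓ R := by unfold coreConst; positivity

theorem interiorVortexMap_density_le {D : ℕ} (hD : D ≠ 0) {ℓ ε R : ℝ} (hℓ : 0 < ℓ) (hε : 0 < ε)
    (hε1 : ε ≤ 1) (hR : 0 < R) {s : ℝ} (hs : |s - ℓ| ≤ ℓ) (hsR : Real.exp s ≤ R) (θ : ℝ) :
    ∃ vs vθ : ℂ,
      HasDerivAt (fun s : ℝ => interiorVortexMap D ℓ ε (Complex.exp (s + θ * Complex.I))) vs s ∧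
      HasDerivAt (fun θ : ℝ => interiorVortexMap D ℓ ε (Complex.exp (s + θ * Complex.I))) vθ θ ∧
      ‖vs‖ ^ 2 + ‖vθ‖ ^ 2 + Real.exp s ^ 2 * ((1 / (2 * ε ^ 2)) *
        (‖interiorVortexMap D ℓ ε (Complex.exp (s + θ * Complex.I))‖ ^ 2 - 1) ^ 2) ≤
      (D ^ 2 * vortexAmp D ℓ (s - ℓ) ^ 2 +
        coreConst D ℓ R * (ε ^ 2 / vortexCore D ℓ ε (s - ℓ))) *
        (Complex.normSq (vortexPolar D ℓ (s - ℓ) (D * θ)) + vortexReg D ℓ ε (s - ℓ))⁻¹ +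
        vortexConst D ℓ := by
  have hD0 : 0 < (D : ℝ) := by positivity
  have heq : ∀ s θ : ℝ, interiorVortexMap D ℓ ε (Complex.exp (s + θ * Complex.I)) =
      vortexPolar D ℓ (s - ℓ) (D * θ) / (√(Complex.normSq (vortexPolar D ℓ (s - ℓ) (D * θ)) +
        vortexReg D ℓ ε (s - ℓ)) : ℂ) := by
    intro s θ
    have h1 : ‖Complex.exp (s + θ * Complex.I)‖ = Real.exp s := by simp [Complex.norm_exp]
    rw [interiorVortexMap, vortexMap_exp, h1, Real.log_exp]
  simp only [heq]
  have hE := vortexCore_pos (x := s - ℓ) hD0 hℓ hε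
  have hEN := vortexCore_le (D := D) (ε := ε) hℓ hs (D * θ)
  have hN := hE.trans_le hEN
  have h0 := vortexReg_nonneg (D := D) (ℓ := ℓ) (ε := ε) (x := s - ℓ)
  have hh := vortexReg_le (D := D) (ε := ε) hℓ hs
  obtain ⟨h', hh', hh'b⟩ := exists_hasDerivAt_vortexReg (D := D) (ε := ε) hℓ hs
  have hreg : HasDerivAt (fun s => vortexReg D ℓ ε (s - ℓ)) h' s := hh'.comp_sub_const s ℓ
  obtain ⟨vs, h1, h1'⟩ := exists_hasDerivAt_div_sqrt
    (hasDerivAt_vortexPolar_radial D ℓ ℓ (D * θ) s) hreg h0 hN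
  obtain ⟨vθ, h2, h2'⟩ := exists_hasDerivAt_div_sqrt
    (hasDerivAt_vortexPolar_angular D ℓ (s - ℓ) θ)
    (hasDerivAt_const θ (vortexReg D ℓ ε (s - ℓ))) h0 hN
  refine ⟨vs, vθ, h1, h2, ?_⟩
  have hq := im_sq_add_im_sq_le hD0 hℓ hs (D * θ)
  rw [← vortexConst] at hq
  have hs' : |-(s - ℓ)| ≤ ℓ := by rwa [abs_neg]
  have hnexp : ‖Complex.exp ((D * θ : ℝ) * Complex.I)‖ = 1 := Complex.norm_exp_ofReal_mul_I _
  have hFs : ‖(vortexAmpDeriv D ℓ (s - ℓ) : ℂ) * Complex.exp ((D * θ : ℝ) * Complex.I) -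
      vortexAmpDeriv D ℓ (-(s - ℓ))‖ ≤ 2 * ((3 / ℓ + D) * Real.exp (D * ℓ / 2)) := by
    refine (norm_sub_le _ _).trans ?_
    rw [norm_mul, hnexp, Complex.norm_real, Complex.norm_real, mul_one, Real.norm_eq_abs,
      Real.norm_eq_abs]
    linarith [abs_vortexAmpDeriv_le (D := D) hD0.le hℓ hs,
      abs_vortexAmpDeriv_le (D := D) hD0.le hℓ hs']
  have hFθ : ‖(vortexAmp D ℓ (s - ℓ) : ℂ) * (Complex.exp ((D * θ : ℝ) * Complex.I) *
      ((D : ℝ) * Complex.I))‖ ≤ 2 * ((3 / ℓ + D) * Real.exp (D * ℓ / 2)) := by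
    rw [norm_mul, norm_mul, hnexp, norm_mul, Complex.norm_I, Complex.norm_real, Complex.norm_real,
      mul_one, one_mul, Real.norm_eq_abs, Real.norm_eq_abs, abs_of_pos hD0,
      abs_of_nonneg (vortexAmp_nonneg hℓ hs)]
    have h3 := mul_le_mul_of_nonneg_right (vortexAmp_le hD0.le hℓ hs) hD0.le
    have : 0 < 3 / ℓ * Real.exp (D * ℓ / 2) := by positivity
    linarith
  have hnf : ‖vortexPolar D ℓ (s - ℓ) (D * θ)‖ ^ 2 =
    Complex.normSq (vortexPolar D ℓ (s - ℓ) (D * θ)) := (Complex.normSq_eq_norm_sq _).symm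
  have hρ : 0 ≤ Complex.normSq (vortexPolar D ℓ (s - ℓ) (D * θ)) := Complex.normSq_nonneg _
  have hrem1 := sq_div_four_mul_pow_le hε.le hε1 hN h0 hh (by linarith)
    (by rw [hnf]; linarith) (norm_nonneg _) hFs (abs_nonneg _) hh'b
  have hrem2 := sq_div_four_mul_pow_le (k := |0|) (H := 48 * D ^ 2 / ℓ) hε.le hε1 hN h0 hh
    (by linarith) (by rw [hnf]; linarith) (norm_nonneg _) hFθ (abs_nonneg _)
    (by rw [abs_zero]; positivity)
  have hpot : Real.exp s ^ 2 * ((1 / (2 * ε ^ 2)) *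
      (‖vortexPolar D ℓ (s - ℓ) (D * θ) / (√(Complex.normSq (vortexPolar D ℓ (s - ℓ) (D * θ)) +
        vortexReg D ℓ ε (s - ℓ)) : ℂ)‖ ^ 2 - 1) ^ 2) ≤ 8 * R ^ 2 * D ^ 4 *
        (ε ^ 2 / (Complex.normSq (vortexPolar D ℓ (s - ℓ) (D * θ)) +
          vortexReg D ℓ ε (s - ℓ)) ^ 2) := by
    rw [norm_div, div_pow, hnf, Complex.norm_real, Real.norm_eq_abs, sq_abs, Real.sq_sqrt hN.le]
    generalize vortexReg D ℓ ε (s - ℓ) = h at *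
    generalize Complex.normSq (vortexPolar D ℓ (s - ℓ) (D * θ)) = ρ at *
    have e : (ρ / (ρ + h) - 1) ^ 2 = h ^ 2 / (ρ + h) ^ 2 := by field_simp; ring
    rw [e]
    have h3 : h ^ 2 ≤ (4 * D ^ 2 * ε ^ 2) ^ 2 := pow_le_pow_left₀ h0 hh 2
    calc _ ≤ R ^ 2 * (1 / (2 * ε ^ 2) * ((4 * D ^ 2 * ε ^ 2) ^ 2 / (ρ + h) ^ 2)) := by gcongr
      _ = _ := by field_simp; ring
  have hmain : ∀ {a b : ℝ}, b ^ 2 + a ^ 2 ≤ D ^ 2 * vortexAmp D ℓ (s - ℓ) ^ 2 *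
        Complex.normSq (vortexPolar D ℓ (s - ℓ) (D * θ)) +
      vortexConst D ℓ * Complex.normSq (vortexPolar D ℓ (s - ℓ) (D * θ)) ^ 2 →
      a ^ 2 / (Complex.normSq (vortexPolar D ℓ (s - ℓ) (D * θ)) *
        (Complex.normSq (vortexPolar D ℓ (s - ℓ) (D * θ)) + vortexReg D ℓ ε (s - ℓ))) +
      b ^ 2 / (Complex.normSq (vortexPolar D ℓ (s - ℓ) (D * θ)) *
        (Complex.normSq (vortexPolar D ℓ (s - ℓ) (D * θ)) + vortexReg D ℓ ε (s - ℓ))) ≤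
      D ^ 2 * vortexAmp D ℓ (s - ℓ) ^ 2 *
      (Complex.normSq (vortexPolar D ℓ (s - ℓ) (D * θ)) + vortexReg D ℓ ε (s - ℓ))⁻¹ +
      vortexConst D ℓ := by
    intro a b hab
    have hC : 0 ≤ vortexConst D ℓ := by unfold vortexConst; positivity
    generalize vortexReg D ℓ ε (s - ℓ) = h at *
    generalize Complex.normSq (vortexPolar D ℓ (s - ℓ) (D * θ)) = ρ at *
    rcases hρ.eq_or_lt with hρ0 | hρ0
    · rw [← hρ0]
      simp only [zero_mul, div_zero, add_zero]
      positivity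
    · rw [← add_div, div_le_iff₀ (mul_pos hρ0 hN)]
      have e : (D ^ 2 * vortexAmp D ℓ (s - ℓ) ^ 2 * (ρ + h)⁻¹ + vortexConst D ℓ) * (ρ * (ρ + h)) =
          D ^ 2 * vortexAmp D ℓ (s - ℓ) ^ 2 * ρ + vortexConst D ℓ * ρ ^ 2 +
            vortexConst D ℓ * ρ * h := by
        field_simp
        ring
      rw [e]
      linarith [mul_nonneg (mul_nonneg hC hρ) h0]
  have hmain' := hmain hq
  have hcore : ε ^ 2 / (Complex.normSq (vortexPolar D ℓ (s - ℓ) (D * θ)) +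
      vortexReg D ℓ ε (s - ℓ)) ^ 2 ≤ ε ^ 2 / vortexCore D ℓ ε (s - ℓ) *
      (Complex.normSq (vortexPolar D ℓ (s - ℓ) (D * θ)) + vortexReg D ℓ ε (s - ℓ))⁻¹ := by
    rw [← div_eq_mul_inv, div_div, sq (_ + _)]
    gcongr
  have hcore' := mul_le_mul_of_nonneg_left hcore (coreConst_nonneg (D := D) (ℓ := ℓ) (R := R))
  rw [coreConst] at hcore' ⊢
  linarith

theorem integral_inv_sqrt_sq_add_sq_le {ℓ ε : ℝ} (hℓ : 0 < ℓ) (hε : 0 < ε) (hε1 : ε ≤ 1) :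
    ∫ s in (0 : ℝ)..(2 * ℓ), (√((s - ℓ) ^ 2 + ε ^ 2))⁻¹ ≤
      2 * (Real.log (1 + 2 * ℓ) + Real.log (1 / ε)) := by
  have hder : ∀ s : ℝ, HasDerivAt (fun s => Real.arsinh ((s - ℓ) / ε))
      (√((s - ℓ) ^ 2 + ε ^ 2))⁻¹ s := by
    intro s
    refine ((((hasDerivAt_id s).sub_const ℓ).div_const ε).arsinh).congr_deriv ?_
    have h1 : (s - ℓ) ^ 2 + ε ^ 2 = ε ^ 2 * (1 + ((s - ℓ) / ε) ^ 2) := by field_simp; ring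
    rw [h1, Real.sqrt_mul (sq_nonneg ε), Real.sqrt_sq hε.le, mul_inv, smul_eq_mul, mul_comm]
    simp
  rw [intervalIntegral.integral_eq_sub_of_hasDerivAt (fun s _ => hder s)
    (Continuous.intervalIntegrable (by
      refine Continuous.inv₀ (by fun_prop) fun s => ?_
      have : 0 < (s - ℓ) ^ 2 + ε ^ 2 := by positivity
      exact (Real.sqrt_pos.2 this).ne') _ _)]
  have e1 : (2 * ℓ - ℓ) / ε = ℓ / ε := by ring
  have e2 : (0 - ℓ) / ε = -(ℓ / ε) := by ring
  rw [e1, e2, Real.arsinh_neg, sub_neg_eq_add, ← two_mul]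
  refine mul_le_mul_of_nonneg_left ?_ (by norm_num)
  rw [← Real.log_mul (by positivity) (by positivity), Real.arsinh]
  have hy : 0 < ℓ / ε := by positivity
  refine Real.log_le_log (by positivity) ?_
  have h1 : √(1 + (ℓ / ε) ^ 2) ≤ 1 + ℓ / ε := by
    rw [Real.sqrt_le_left (by positivity)]; nlinarith
  have h2 : (1 + 2 * ℓ) * (1 / ε) = 1 / ε + 2 * (ℓ / ε) := by ring
  have h3 : 1 ≤ 1 / ε := by rw [le_div_iff₀ hε]; linarith
  linarith

theorem integral_div_sq_add_sq_le {ℓ ε : ℝ} (hε : 0 < ε) :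
    ∫ s in (0 : ℝ)..(2 * ℓ), ε / ((s - ℓ) ^ 2 + ε ^ 2) ≤ Real.pi := by
  have hder : ∀ s : ℝ, HasDerivAt (fun s => Real.arctan ((s - ℓ) / ε))
      (ε / ((s - ℓ) ^ 2 + ε ^ 2)) s := by
    intro s
    refine ((((hasDerivAt_id s).sub_const ℓ).div_const ε).arctan).congr_deriv ?_
    have : 0 < (s - ℓ) ^ 2 + ε ^ 2 := by positivity
    have h2 : 0 < 1 + ((s - ℓ) / ε) ^ 2 := by positivity
    simp only [id]
    field_simp
    ring
  rw [intervalIntegral.integral_eq_sub_of_hasDerivAt (fun s _ => hder s)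
    (Continuous.intervalIntegrable (by
      refine Continuous.div₀ (by fun_prop) (by fun_prop) fun s => ?_
      have : 0 < (s - ℓ) ^ 2 + ε ^ 2 := by positivity
      exact this.ne') _ _)]
  linarith [Real.arctan_lt_pi_div_two ((2 * ℓ - ℓ) / ε), Real.neg_pi_div_two_lt_arctan ((0 - ℓ) / ε)]

/-- The coefficient of the integrable part of the core energy. -/
noncomputable def coreCoeff (D ℓ R : ℝ) : ℝ :=
  2 * Real.pi * coreConst D ℓ R * ((1 + 4 / ℓ ^ 2) / D ^ 2 + 1) ^ 2

theorem contDiffAt_interiorVortexMap {D : ℕ} (hD : D ≠ 0) {R ℓ ε : ℝ} (hε : 0 < ε) (hℓ : 0 < ℓ)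
    (hRℓ : Real.log R = 2 * ℓ) {z : ℂ} (hz : z ∈ {z : ℂ | 1 ≤ ‖z‖ ∧ ‖z‖ ≤ R}) :
    ContDiffAt ℝ 1 (interiorVortexMap D ℓ ε) z := by
  have hz0 : z ≠ 0 := norm_pos_iff.1 (one_pos.trans_le hz.1)
  have hlog := Real.log_nonneg hz.1
  have hlog' := Real.log_le_log (by linarith [hz.1]) hz.2
  have hx : |Real.log ‖z‖ - ℓ| ≤ ℓ := by rw [abs_le]; constructor <;> linarith
  have hN := (vortexCore_pos (D := D) (ε := ε) (by positivity) hℓ hε).trans_le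
    (vortexCore_le hℓ hx (D * z.arg))
  rw [← vortexMap_exp, exp_log_norm_add_arg hz0] at hN
  have h1 := contDiffAt_vortexMap D ℓ ℓ hz0
  have h2 : ContDiffAt ℝ 1 (fun z => Complex.normSq (vortexMap D ℓ ℓ z) +
      vortexReg D ℓ ε (Real.log ‖z‖ - ℓ)) z := by
    have h3 : ContDiff ℝ 1 (vortexReg D ℓ ε) := by unfold vortexReg; fun_prop
    simp only [Complex.normSq_eq_norm_sq]
    exact (h1.norm_sq ℝ).add (h3.contDiffAt.comp z ((contDiffAt_log_norm hz0).sub contDiffAt_const))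
  exact h1.complex_div (Complex.ofRealCLM.contDiff.contDiffAt.comp z (h2.sqrt hN.ne'))
    (Complex.ofReal_ne_zero.2 (Real.sqrt_pos.2 hN).ne')

theorem interiorVortexMap_energy_le {D : ℕ} (hD : D ≠ 0) {R ℓ ε : ℝ} (hR : 1 < R) (hε : 0 < ε)
    (hε1 : ε ≤ 1) (hℓ : 0 < ℓ) (hRℓ : Real.log R = 2 * ℓ) :
    ∫ x in {x : ℂ | 1 < ‖x‖ ∧ ‖x‖ < R},
      (‖fderiv ℝ (interiorVortexMap D ℓ ε) x 1‖ ^ 2 +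
        ‖fderiv ℝ (interiorVortexMap D ℓ ε) x Complex.I‖ ^ 2
        + (1 / (2 * ε ^ 2)) * (‖interiorVortexMap D ℓ ε x‖ ^ 2 - 1) ^ 2) ≤
      2 * Real.pi * D * (Real.log (1 + 2 * ℓ) + Real.log (1 / ε)) + coreCoeff D ℓ R * Real.pi +
        2 * ℓ * (2 * Real.pi * D / ℓ + 2 * Real.pi * D ^ 2 + 2 * Real.pi * vortexConst D ℓ) := by
  have hD0 : 0 < (D : ℝ) := by positivity
  have hx : ∀ s ∈ Set.Icc 0 (Real.log R), |s - ℓ| ≤ ℓ := by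
    intro s hs
    rw [abs_le]; constructor <;> linarith [hs.1, hs.2]
  have hpos : ∀ s : ℝ, 0 < (s - ℓ) ^ 2 + ε ^ 2 := fun s => by positivity
  have hN : ∀ s ∈ Set.Icc 0 (Real.log R), ∀ θ : ℝ, 0 <
      Complex.normSq (vortexPolar D ℓ (s - ℓ) (D * θ)) + vortexReg D ℓ ε (s - ℓ) := fun s hs θ =>
    (vortexCore_pos hD0 hℓ hε).trans_le (vortexCore_le hℓ (hx s hs) _)
  have hc1 : Continuous fun s : ℝ => (√((s - ℓ) ^ 2 + ε ^ 2))⁻¹ :=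
    Continuous.inv₀ (by fun_prop) fun s => (Real.sqrt_pos.2 (hpos s)).ne'
  have hc2 : Continuous fun s : ℝ => ε / ((s - ℓ) ^ 2 + ε ^ 2) :=
    Continuous.div₀ (by fun_prop) (by fun_prop) fun s => (hpos s).ne'
  have hcN : ∀ s ∈ Set.Icc 0 (Real.log R), Continuous fun θ : ℝ =>
      (Complex.normSq (vortexPolar D ℓ (s - ℓ) (D * θ)) + vortexReg D ℓ ε (s - ℓ))⁻¹ := by
    intro s hs
    have h1 : Continuous fun θ : ℝ => vortexPolar D ℓ (s - ℓ) (D * θ) := by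
      unfold vortexPolar; fun_prop
    exact ((Complex.continuous_normSq.comp h1).add continuous_const).inv₀ fun θ => (hN s hs θ).ne'
  have hC : 0 ≤ coreConst D ℓ R := coreConst_nonneg
  refine (setIntegral_annulus_energy_le hR (G := fun s θ => (D ^ 2 * vortexAmp D ℓ (s - ℓ) ^ 2 +
        coreConst D ℓ R * (ε ^ 2 / vortexCore D ℓ ε (s - ℓ))) *
        (Complex.normSq (vortexPolar D ℓ (s - ℓ) (D * θ)) + vortexReg D ℓ ε (s - ℓ))⁻¹ +
        vortexConst D ℓ)
    (Ψ := fun s => Real.pi * D * (√((s - ℓ) ^ 2 + ε ^ 2))⁻¹ +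
      coreCoeff D ℓ R * (ε / ((s - ℓ) ^ 2 + ε ^ 2)) +
      (2 * Real.pi * D / ℓ + 2 * Real.pi * D ^ 2 + 2 * Real.pi * vortexConst D ℓ))
    (fun z hz => contDiffAt_interiorVortexMap hD hε hℓ hRℓ hz)
    (fun s hs => (continuous_const.mul (hcN s hs)).add continuous_const)
    (fun s hs θ => interiorVortexMap_density_le hD hℓ hε hε1 (by linarith) (hx s hs)
      ((Real.le_log_iff_exp_le (by linarith)).1 hs.2) θ) ?_ ?_).trans ?_
  · exact (((continuous_const.mul hc1).add (continuous_const.mul hc2)).add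
      continuous_const).continuousOn
  · intro s hs
    rw [intervalIntegral.integral_add (((hcN s hs).intervalIntegrable _ _).const_mul _)
      intervalIntegrable_const, intervalIntegral.integral_const_mul,
      intervalIntegral.integral_const, smul_eq_mul]
    have hA := vortexAmp_nonneg (D := D) hℓ (hx s hs)
    have hB := vortexAmp_nonneg (D := D) hℓ (by rw [abs_neg]; exact hx s hs : |-(s - ℓ)| ≤ ℓ)
    have hI := integral_inv_normSq_vortexPolar_add_le hD hℓ (hx s hs) hε
    have hE := vortexCore_pos (x := s - ℓ) hD0 hℓ hε
    have h1 := vortexAmp_sq_mul_inv_le (ε := ε) hD0 hℓ (hx s hs)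
    have h2 := inv_sqrt_vortexCore_le (x := s - ℓ) hD0 hℓ hε
    have h3 := sq_div_vortexCore_le (x := s - ℓ) hD0 hℓ hε hε1
    have hv := one_le_vortexAmp_add_neg (D := D) hD0.le hℓ (hx s hs)
    have hs := Real.sqrt_pos.2 hE
    generalize vortexCore D ℓ ε (s - ℓ) = E at *
    generalize vortexAmp D ℓ (s - ℓ) = A at *
    generalize vortexAmp D ℓ (-(s - ℓ)) = B at *
    have hv1 : (A + B)⁻¹ ≤ 1 := inv_le_one_of_one_le₀ hv
    have hv0 : 0 ≤ (A + B)⁻¹ := by positivity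
    have hw : (√E)⁻¹ * √E = 1 := inv_mul_cancel₀ hs.ne'
    have hw0 : 0 ≤ (√E)⁻¹ := by positivity
    generalize (A + B)⁻¹ = v at *
    have k1 := mul_le_mul_of_nonneg_left hI
      (by positivity : 0 ≤ D ^ 2 * A ^ 2 + coreConst D ℓ R * (ε ^ 2 / E))
    have k2 := mul_le_mul_of_nonneg_left h1 (by positivity : 0 ≤ 2 * Real.pi * D ^ 2 * (√E)⁻¹)
    have k3 := mul_le_mul_of_nonneg_left h2 (by positivity : 0 ≤ Real.pi * D ^ 2)
    have k4 := mul_le_mul_of_nonneg_left h3 (by positivity : 0 ≤ 2 * Real.pi * coreConst D ℓ R)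
    have k5 := mul_le_mul_of_nonneg_left hv1
      (by positivity : 0 ≤ 2 * Real.pi * coreConst D ℓ R * (ε ^ 2 / E * (√E)⁻¹))
    have k6 : Real.pi * D ^ 2 * ((D : ℝ)⁻¹ * (√((s - ℓ) ^ 2 + ε ^ 2))⁻¹ + 2 / (D * ℓ)) =
        Real.pi * D * (√((s - ℓ) ^ 2 + ε ^ 2))⁻¹ + 2 * Real.pi * D / ℓ := by
      field_simp
    have k7 : 2 * Real.pi * D ^ 2 * (√E)⁻¹ * (1 / 2 + √E) =
        Real.pi * D ^ 2 * (√E)⁻¹ + 2 * Real.pi * D ^ 2 := by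
      linear_combination 2 * Real.pi * D ^ 2 * hw
    rw [coreCoeff]
    linarith
  · rw [intervalIntegral.integral_add, intervalIntegral.integral_add,
      intervalIntegral.integral_const_mul, intervalIntegral.integral_const_mul,
      intervalIntegral.integral_const, smul_eq_mul, hRℓ, sub_zero]
    · have h1 := mul_le_mul_of_nonneg_left (integral_inv_sqrt_sq_add_sq_le hℓ hε hε1)
        (by positivity : 0 ≤ Real.pi * D)
      have h2 := mul_le_mul_of_nonneg_left (integral_div_sq_add_sq_le (ℓ := ℓ) hε)
        (by unfold coreCoeff; positivity : 0 ≤ coreCoeff D ℓ R)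
      linarith
    · exact (continuous_const.mul hc1).intervalIntegrable _ _
    · exact (continuous_const.mul hc2).intervalIntegrable _ _
    · exact ((continuous_const.mul hc1).add (continuous_const.mul hc2)).intervalIntegrable _ _
    · exact intervalIntegrable_const

theorem interiorVortexMap_eq_one {D : ℕ} (hD : D ≠ 0) {R ℓ ε : ℝ} (hℓ : 0 < ℓ)
    (hRℓ : Real.log R = 2 * ℓ) {z : ℂ} (hz : ‖z‖ = R) : interiorVortexMap D ℓ ε z = 1 := by
  have hD0 : 0 < (D : ℝ) := by positivity
  have h0 : vortexAmp D ℓ ℓ = 0 := by simp [vortexAmp, div_self hℓ.ne']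
  have h3 : vortexReg D ℓ ε ℓ = 0 := by simp [vortexReg, div_self hℓ.ne']
  have h1 := one_le_vortexAmp_neg (D := D) hD0.le hℓ hℓ.le
  have h2 : (vortexAmp D ℓ (-ℓ) : ℂ) ≠ 0 := Complex.ofReal_ne_zero.2 (by linarith)
  rw [interiorVortexMap, vortexMap, hz, hRℓ, show 2 * ℓ - ℓ = ℓ by ring, h0, h3, Complex.ofReal_zero,
    zero_mul, zero_add, Complex.normSq_ofReal, add_zero, Real.sqrt_mul_self (by linarith),
    div_self h2]

theorem interiorVortexMap_exp_eq {D : ℕ} (hD : D ≠ 0) {ℓ ε : ℝ} (hℓ : 0 < ℓ) (θ : ℝ) :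
    interiorVortexMap D ℓ ε (Complex.exp (Complex.I * (θ : ℂ))) =
      Complex.exp (Complex.I * ((D : ℂ) * (θ : ℂ))) := by
  have hD0 : 0 < (D : ℝ) := by positivity
  have e0 : Complex.exp (Complex.I * (θ : ℂ)) = Complex.exp ((0 : ℝ) + θ * Complex.I) := by
    simp [mul_comm]
  have e1 : Complex.exp (Complex.I * ((D : ℂ) * (θ : ℂ))) =
      Complex.exp ((D * θ : ℝ) * Complex.I) := by
    push_cast; rw [mul_comm]
  have h0 : vortexAmp D ℓ ℓ = 0 := by simp [vortexAmp, div_self hℓ.ne']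
  have h3 : vortexReg D ℓ ε (-ℓ) = 0 := by
    have : -ℓ / ℓ = -1 := by field_simp
    simp [vortexReg, this]
    norm_num
  have h1 := one_le_vortexAmp_neg (D := D) hD0.le hℓ hℓ.le
  have h2 : (vortexAmp D ℓ (-ℓ) : ℂ) ≠ 0 := Complex.ofReal_ne_zero.2 (by linarith)
  have hn : ‖Complex.exp ((0 : ℝ) + θ * Complex.I)‖ = 1 := by simp [Complex.norm_exp]
  rw [e0, e1, interiorVortexMap, vortexMap_exp, hn, Real.log_one, zero_sub, h3, vortexPolar, neg_neg,
    h0, Complex.ofReal_zero, add_zero, Complex.normSq_eq_norm_sq, norm_mul,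
    Complex.norm_exp_ofReal_mul_I, add_zero, mul_one, Complex.norm_real, Real.norm_eq_abs, sq_abs,
    Real.sqrt_sq (by linarith)]
  field_simp

theorem exists_energy_le_interiorVortex {D : ℕ} (hD : 1 ≤ D) {α K R : ℝ} (hR : 1 < R) :
    ∃ C : ℝ, ∀ ε : ℝ, 0 < ε → ε < 1 →
      ∃ u : ℂ → ℂ,
        (∃ L : NNReal, LipschitzOnWith L u {x : ℂ | 1 ≤ ‖x‖ ∧ ‖x‖ ≤ R}) ∧
        (∀ x : ℂ, ‖x‖ = R → u x = 1) ∧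
        (1 / 2) * (∫ x in {x : ℂ | 1 < ‖x‖ ∧ ‖x‖ < R},
            (‖fderiv ℝ u x 1‖ ^ 2 + ‖fderiv ℝ u x Complex.I‖ ^ 2
              + (1 / (2 * ε ^ 2)) * (‖u x‖ ^ 2 - 1) ^ 2))
          + (K * ε ^ (-α) / 2) * (∫ θ in (0 : ℝ)..(2 * Real.pi),
              ‖u (Complex.exp (Complex.I * (θ : ℂ)))
                - Complex.exp (Complex.I * ((D : ℂ) * (θ : ℂ)))‖ ^ 2)
        ≤ Real.pi * (D : ℝ) * Real.log (1 / ε) + C := by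
  have hD' : D ≠ 0 := by omega
  obtain ⟨ℓ, hRℓ⟩ : ∃ ℓ, Real.log R = 2 * ℓ := ⟨Real.log R / 2, by ring⟩
  have hℓ : 0 < ℓ := by linarith [Real.log_pos hR]
  refine ⟨Real.pi * D * Real.log (1 + 2 * ℓ) + coreCoeff D ℓ R * Real.pi / 2 +
    ℓ * (2 * Real.pi * D / ℓ + 2 * Real.pi * D ^ 2 + 2 * Real.pi * vortexConst D ℓ),
    fun ε hε hε1 => ⟨interiorVortexMap D ℓ ε, exists_lipschitzOnWith_of_contDiffAt
      (isCompact_annulus R) fun z hz => contDiffAt_interiorVortexMap hD' hε hℓ hRℓ hz,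
      fun x hx => interiorVortexMap_eq_one hD' hℓ hRℓ hx, ?_⟩⟩
  have h1 := interiorVortexMap_energy_le hD' hR hε hε1.le hℓ hRℓ
  simp only [interiorVortexMap_exp_eq hD' hℓ, sub_self, norm_zero, zero_pow two_ne_zero,
    intervalIntegral.integral_zero, mul_zero, add_zero]
  linarith

/-- Upper bound for the weak-anchoring Ginzburg–Landau energy in the annular
droplet geometry `Ω = B_R(0) \ closure(B_1(0))` with anchoring datum
`g(θ) = e^{iDθ}` of degree `D` on the inner circle, anchoring strength
`λ = K ε^{−α}`, and strong anchoring `u ≡ 1` on the outer circle: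
there is a constant `C` such that for every `ε ∈ (0,1)` there is a Lipschitz
map `u` on the closed annulus, equal to `1` on the outer circle, with
`(1/2)∫_Ω (‖Du‖² + (1/2ε²)(‖u‖²−1)²) + (Kε^{−α}/2)∫₀^{2π} ‖u(e^{iθ}) − e^{iDθ}‖² dθ
  ≤ π min{2α,1} D log(1/ε) + C`,
where `‖Du‖²` is the squared Frobenius norm `‖Du(1)‖² + ‖Du(I)‖²` of the
(a.e. defined) real Fréchet derivative. -/
theorem weak_anchoring_upper_bound (D : ℕ) (hD : 1 ≤ D) (α K R : ℝ)
    (hα1 : 0 < α) (hα2 : α ≤ 1) (hK : 0 < K) (hR : 1 < R) :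
    ∃ C : ℝ, ∀ ε : ℝ, 0 < ε → ε < 1 →
      ∃ u : ℂ → ℂ,
        (∃ L : NNReal, LipschitzOnWith L u {x : ℂ | 1 ≤ ‖x‖ ∧ ‖x‖ ≤ R}) ∧
        (∀ x : ℂ, ‖x‖ = R → u x = 1) ∧
        (1 / 2) * (∫ x in {x : ℂ | 1 < ‖x‖ ∧ ‖x‖ < R},
            (‖fderiv ℝ u x 1‖ ^ 2 + ‖fderiv ℝ u x Complex.I‖ ^ 2
              + (1 / (2 * ε ^ 2)) * (‖u x‖ ^ 2 - 1) ^ 2))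
          + (K * ε ^ (-α) / 2) * (∫ θ in (0 : ℝ)..(2 * Real.pi),
              ‖u (Complex.exp (Complex.I * (θ : ℂ)))
                - Complex.exp (Complex.I * ((D : ℂ) * (θ : ℂ)))‖ ^ 2)
        ≤ Real.pi * min (2 * α) 1 * (D : ℝ) * Real.log (1 / ε) + C := by
  rcases le_total (2 * α) 1 with h | h
  · rw [min_eq_left h]
    exact exists_energy_le_boundaryVortex hD hα1 hK hR
  · rw [min_eq_right h, mul_one]
    exact exists_energy_le_interiorVortex hD hR
end
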